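/- There is an absolute constant C₀ > 0 and for every k ≥ 1 a constant C_k > 0 such that the following holds: for every δ ∈ (0, 0.01] and all measurable sets A, B ⊆ ℝ^k with |A| = |B| and 0 < |A| < ∞ satisfying |A+B| ≤ 2^k(1+δ)|A|, there exist measurable subsets A' ⊆ A and B' ⊆ B and a vector v ∈ ℝ^k such that |A \ A'| ≤ (δ² + C₀δ³)|A|, |B \ B'| ≤ (δ² + C₀δ³)|A|, and |co(A' ∪ (B'+v))| ≤ C_k|A|. -/

import Mathlib

open Set Pointwise MeasureTheory

set_option linter.unusedSectionVars false

/-- Cutting a subset of the line at a point splits its measure. -/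
lemma volume_real_eq_Iic_add_Ici {S : Set ℝ} (hS : IsCompact S) (u : ℝ) :
    volume.real S = volume.real (S ∩ Iic u) + volume.real (S ∩ Ici u) := by
  have h1 : volume.real (S ∩ Iic u) + volume.real (S \ Iic u) = volume.real S :=
    measureReal_inter_add_sdiff measurableSet_Iic hS.measure_lt_top.ne
  have h2 : volume.real (S \ Iic u) = volume.real (S ∩ Ici u) := by
    apply measureReal_congr
    have : S \ Iic u = S ∩ Ioi u := by ext; simp
    rw [this]
    exact (Filter.EventuallyEq.refl _ S).inter Ioi_ae_eq_Ici
  linarith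

/-- `D` gains a window of length `γ` in sums. -/
def GapGain (D : Set ℝ) (γ : ℝ) : Prop :=
  ∀ E : Set ℝ, IsCompact E → E.Nonempty → ∀ q : ℝ,
    volume.real D + volume.real E + volume.real (E ∩ Icc q (q + γ)) ≤ volume.real (D + E)

lemma volume_real_add_le_three {S S₁ S₂ S₃ : Set ℝ} (hS : IsCompact S) {u v : ℝ} (huv : u ≤ v)
    (h₁ : S₁ ⊆ S ∩ Iic u) (h₂ : S₂ ⊆ S ∩ Icc u v) (h₃ : S₃ ⊆ S ∩ Ici v) :
    volume.real S₁ + volume.real S₂ + volume.real S₃ ≤ volume.real S := by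
  have e1 := volume_real_eq_Iic_add_Ici hS u
  have e2 := volume_real_eq_Iic_add_Ici (hS.inter_right (isClosed_Ici (a := u))) v
  have f1 : volume.real S₁ ≤ volume.real (S ∩ Iic u) :=
    measureReal_mono h₁ (measure_ne_top_of_subset inter_subset_left hS.measure_lt_top.ne)
  have f2 : volume.real S₂ ≤ volume.real (S ∩ Ici u ∩ Iic v) :=
    measureReal_mono (fun x hx => ⟨⟨(h₂ hx).1, (h₂ hx).2.1⟩, (h₂ hx).2.2⟩)
      (measure_ne_top_of_subset (inter_subset_left.trans inter_subset_left) hS.measure_lt_top.ne)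
  have f3 : volume.real S₃ ≤ volume.real (S ∩ Ici u ∩ Ici v) :=
    measureReal_mono (fun x hx => ⟨⟨(h₃ hx).1, huv.trans (h₃ hx).2⟩, (h₃ hx).2⟩)
      (measure_ne_top_of_subset (inter_subset_left.trans inter_subset_left) hS.measure_lt_top.ne)
  linarith

lemma volume_real_image_add_left (a : ℝ) (S : Set ℝ) :
    volume.real ((a + ·) '' S) = volume.real S := by
  simp [measureReal_def]

/-- Brunn–Minkowski on the line, for compact sets. -/
lemma volume_real_add_le_add {D E : Set ℝ} (hD : IsCompact D) (hD' : D.Nonempty)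
    (hE : IsCompact E) (hE' : E.Nonempty) :
    volume.real D + volume.real E ≤ volume.real (D + E) := by
  obtain ⟨p, hp⟩ := hD.exists_isGreatest hD'
  obtain ⟨e, he⟩ := hE.exists_isLeast hE'
  have h := volume_real_add_le_three (hD.add hE) (S₁ := (e + ·) '' D) (S₂ := ∅) (S₃ := (p + ·) '' E)
    (le_refl (p + e)) ?_ (empty_subset _) ?_
  · rw [volume_real_image_add_left, volume_real_image_add_left] at h
    simpa using h
  · rintro _ ⟨d, hd, rfl⟩
    exact ⟨⟨d, hd, e, he.1, by simp; ring⟩, by have := hp.2 hd; simp; linarith⟩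
  · rintro _ ⟨d, hd, rfl⟩
    exact ⟨⟨p, hp.1, d, hd, rfl⟩, by have := he.2 hd; simp; linarith⟩

lemma GapGain.mono {D : Set ℝ} {γ γ' : ℝ} (h : GapGain D γ) (hγ : γ' ≤ γ) : GapGain D γ' := by
  intro E hE hE' q
  refine le_trans ?_ (h E hE hE' q)
  gcongr
  exact measure_ne_top_of_subset inter_subset_left hE.measure_lt_top.ne

lemma GapGain.union {D R : Set ℝ} {γ L p : ℝ} (h : GapGain D γ) (hD : IsCompact D)
    (hR : IsCompact R) (hp : IsGreatest D p) (hL : 0 ≤ L) (hl : IsLeast R (p + L)) :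
    GapGain (D ∪ R) (γ + L) := by
  intro E hE hE' q
  obtain ⟨e₀, he₀⟩ := hE.exists_isLeast hE'
  obtain ⟨e₁, he₁⟩ := hE.exists_isGreatest hE'
  have he := he₀.2 he₁.1
  obtain ⟨θ, hθ⟩ : ∃ θ, θ = max e₀ (min (q + γ) e₁) := ⟨_, rfl⟩
  have hθ0 : e₀ ≤ θ := hθ ▸ le_max_left _ _
  have hθ1 : θ ≤ e₁ := hθ ▸ max_le he (min_le_right _ _)
  have fin : ∀ {T : Set ℝ}, volume (E ∩ T) ≠ ⊤ := fun {T} =>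
    measure_ne_top_of_subset inter_subset_left hE.measure_lt_top.ne
  have k1 := h (E ∩ Iic θ) (hE.inter_right isClosed_Iic) ⟨e₀, he₀.1, hθ0⟩ q
  have k3 := volume_real_add_le_add hR ⟨_, hl.1⟩ (hE.inter_right (isClosed_Ici (a := θ)))
    ⟨e₁, he₁.1, hθ1⟩
  have k4 := volume_real_eq_Iic_add_Ici hE θ
  have k5 : volume.real (E ∩ Icc q (q + (γ + L))) ≤
      volume.real (E ∩ Iic θ ∩ Icc q (q + γ)) + volume.real (E ∩ Icc θ (θ + L)) := by
    refine le_trans (measureReal_mono ?_ ?_) (measureReal_union_le _ _)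
    · rintro x ⟨hx, hx1, hx2⟩
      have := he₁.2 hx
      have := he₀.2 hx
      rcases le_or_gt x (q + γ) with hc | hc
      · left
        exact ⟨⟨hx, hθ ▸ le_max_of_le_right (le_min hc ‹x ≤ e₁›)⟩, hx1, hc⟩
      · right
        have h1 : θ ≤ x := hθ ▸ max_le ‹_› ((min_le_left _ _).trans hc.le)
        have h2 : q + γ ≤ θ := hθ ▸ le_max_of_le_right (le_min le_rfl (hc.le.trans ‹x ≤ e₁›))
        exact ⟨hx, h1, by linarith⟩
    · rw [inter_assoc]
      exact ((measure_union_le _ _).trans_lt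
        (ENNReal.add_lt_top.2 ⟨fin.lt_top, fin.lt_top⟩)).ne
  have k6 := volume_real_add_le_three ((hD.union hR).add hE) (S₁ := D + (E ∩ Iic θ))
    (S₂ := (p + ·) '' (E ∩ Icc θ (θ + L))) (S₃ := R + (E ∩ Ici θ))
    (u := p + θ) (v := p + θ + L) (by linarith) ?_ ?_ ?_
  · rw [volume_real_image_add_left] at k6
    have k7 : volume.real (D ∪ R) ≤ volume.real D + volume.real R := measureReal_union_le _ _
    linarith
  · rintro _ ⟨d, hd, e, ⟨hee, het⟩, rfl⟩
    refine ⟨⟨d, Or.inl hd, e, hee, rfl⟩, ?_⟩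
    have := hp.2 hd
    simp only [mem_Iic] at *
    linarith
  · rintro _ ⟨e, ⟨hee, het⟩, rfl⟩
    refine ⟨⟨p, Or.inl hp.1, e, hee, rfl⟩, ?_⟩
    simp only [mem_Icc] at *
    constructor <;> linarith
  · rintro _ ⟨d, hd, e, ⟨hee, het⟩, rfl⟩
    refine ⟨⟨d, Or.inr hd, e, hee, rfl⟩, ?_⟩
    have := hl.2 hd
    simp only [mem_Ici] at *
    linarith

lemma gapGain_zero {D : Set ℝ} (hD : IsCompact D) (hD' : D.Nonempty) : GapGain D 0 := by
  intro E hE hE' q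
  have : volume.real (E ∩ Icc q (q + 0)) = 0 := by
    have : volume (E ∩ Icc q (q + 0)) = 0 := measure_mono_null inter_subset_right (by simp)
    rw [measureReal_def, this, ENNReal.toReal_zero]
  rw [this, add_zero]
  exact volume_real_add_le_add hD hD' hE hE'

lemma gapGain_cthickening {D : Set ℝ} (hD : IsCompact D) {d₀ d₁ s : ℝ} (hd₀ : IsLeast D d₀)
    (hd₁ : IsGreatest D d₁) (hs : 0 < s) :
    GapGain D (d₁ - d₀ - volume.real (Metric.cthickening s D)) := by
  have hT : IsCompact (Metric.cthickening s D) := hD.cthickening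
  set T := Metric.cthickening s D with hTdef
  have key : ∀ i : ℕ, ∀ p, IsGreatest (D ∩ Iic (d₀ + i * s)) p →
      GapGain (D ∩ Iic (d₀ + i * s)) (p - d₀ - volume.real (T ∩ Icc d₀ p)) := by
    intro i
    induction i with
    | zero =>
      intro p hp
      refine (gapGain_zero (hD.inter_right isClosed_Iic) ⟨p, hp.1⟩).mono ?_
      have h1 : p ≤ d₀ := by simpa using hp.1.2
      have : 0 ≤ volume.real (T ∩ Icc d₀ p) := measureReal_nonneg
      linarith
    | succ i ih =>
      intro p' hp'
      set R := D ∩ Icc (d₀ + i * s) (d₀ + (i + 1 : ℕ) * s) with hR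
      have hun : D ∩ Iic (d₀ + (i + 1 : ℕ) * s) = (D ∩ Iic (d₀ + i * s)) ∪ R := by
        ext x
        simp only [mem_inter_iff, mem_Iic, mem_union, hR, mem_Icc]
        have : d₀ + i * s ≤ d₀ + (i + 1 : ℕ) * s := by push_cast; nlinarith
        constructor
        · rintro ⟨h, h'⟩
          rcases le_total x (d₀ + i * s) with hc | hc
          · exact Or.inl ⟨h, hc⟩
          · exact Or.inr ⟨h, hc, h'⟩
        · rintro (⟨h, h'⟩ | ⟨h, h', h''⟩)
          · exact ⟨h, h'.trans this⟩
          · exact ⟨h, h''⟩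
      have hRc : IsCompact R := hD.inter_right isClosed_Icc
      rcases R.eq_empty_or_nonempty with hRe | hRe
      · rw [hun, hRe, union_empty] at hp' ⊢
        exact ih p' hp'
      · have hDi : IsCompact (D ∩ Iic (d₀ + i * s)) := hD.inter_right isClosed_Iic
        obtain ⟨p, hp⟩ := hDi.exists_isGreatest ⟨d₀, hd₀.1, by simp; positivity⟩
        obtain ⟨l, hl⟩ := hRc.exists_isLeast hRe
        have hpl : p ≤ l := le_trans hp.1.2 hl.1.2.1
        have hlp' : l ≤ p' := hp'.2 (by rw [hun]; exact Or.inr hl.1)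
        have hps : p' - l ≤ s := by
          have h1 := hl.1.2.1
          have h2 : p' ≤ d₀ + (i + 1 : ℕ) * s := hp'.1.2
          push_cast at h2
          linarith
        have h0p : d₀ ≤ p := hd₀.2 hp.1.1
        rw [hun]
        refine ((ih p hp).union hDi hRc hp (sub_nonneg.2 hpl) (by simpa using hl)).mono ?_
        have hsub : Icc l p' ⊆ T := fun x hx => by
          refine Metric.mem_cthickening_of_dist_le x l s D hl.1.1 ?_
          rw [Real.dist_eq, abs_le]
          constructor <;> linarith [hx.1, hx.2]
        have h3 := volume_real_add_le_three (hT.inter_right (isClosed_Icc (a := d₀) (b := p')))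
          (S₁ := T ∩ Icc d₀ p) (S₂ := ∅) (S₃ := Icc l p') hpl ?_ (empty_subset _) ?_
        · have : volume.real (Icc l p') = p' - l := by simp [hlp']
          rw [this] at h3
          simp only [measureReal_empty, add_zero] at h3
          linarith
        · rintro x ⟨hx, hx1, hx2⟩
          exact ⟨⟨hx, hx1, by linarith⟩, hx2⟩
        · rintro x hx
          exact ⟨⟨hsub hx, by linarith [hx.1], hx.2⟩, hx.1⟩
  obtain ⟨i, hi⟩ := exists_nat_ge ((d₁ - d₀) / s)
  have hD1 : D ∩ Iic (d₀ + i * s) = D := by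
    refine inter_eq_left.2 fun x hx => ?_
    have := hd₁.2 hx
    rw [div_le_iff₀ hs] at hi
    simp only [mem_Iic]
    linarith
  have := key i d₁ (by rwa [hD1])
  rw [hD1] at this
  refine this.mono ?_
  have : volume.real (T ∩ Icc d₀ d₁) ≤ volume.real T :=
    measureReal_mono inter_subset_left hT.measure_lt_top.ne
  linarith

lemma gapGain_of_lt {D : Set ℝ} (hD : IsCompact D) {d₀ d₁ γ : ℝ} (hd₀ : IsLeast D d₀)
    (hd₁ : IsGreatest D d₁) (hγ : γ < d₁ - d₀ - volume.real D) : GapGain D γ := by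
  have h := tendsto_measure_cthickening_of_isCompact (μ := volume) hD
  have h' := (ENNReal.tendsto_toReal hD.measure_lt_top.ne).comp h
  have h2 : ∀ᶠ s in nhds (0:ℝ), volume.real (Metric.cthickening s D) < d₁ - d₀ - γ :=
    h'.eventually (gt_mem_nhds (by simp only [measureReal_def] at hγ; linarith))
  have h3 := (h2.filter_mono nhdsWithin_le_nhds).and (self_mem_nhdsWithin (s := Ioi (0:ℝ)))
  obtain ⟨s, hs, hs'⟩ := h3.exists
  exact (gapGain_cthickening hD hd₀ hd₁ hs').mono (by linarith)

lemma GapGain.two_mul {D E : Set ℝ} {γ e₀ e₁ : ℝ} (h : GapGain D γ) (hE : IsCompact E)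
    (he₀ : IsLeast E e₀) (he₁ : IsGreatest E e₁) (hγ : e₁ - e₀ ≤ 2 * γ) :
    2 * (volume.real D + volume.real E) + volume.real E ≤ 2 * volume.real (D + E) := by
  have h1 := h E hE ⟨_, he₀.1⟩ e₀
  have h2 := h E hE ⟨_, he₀.1⟩ (e₀ + γ)
  have h3 : volume.real E ≤ volume.real (E ∩ Icc e₀ (e₀ + γ)) +
      volume.real (E ∩ Icc (e₀ + γ) (e₀ + γ + γ)) := by
    refine le_trans (measureReal_mono ?_ ?_) (measureReal_union_le _ _)
    · intro x hx
      have := he₀.2 hx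
      have := he₁.2 hx
      rcases le_total x (e₀ + γ) with hc | hc
      · exact Or.inl ⟨hx, by assumption, hc⟩
      · exact Or.inr ⟨hx, hc, by linarith⟩
    · rw [← inter_union_distrib_left]
      exact measure_ne_top_of_subset inter_subset_left hE.measure_lt_top.ne
  linarith

/-- Two compact sets of reals with near-minimal sumset are contained in short intervals. -/
lemma exists_subset_Icc_of_volume_add_lt {D E : Set ℝ} (hD : IsCompact D) (hE : IsCompact E)
    (hD0 : 0 < volume.real D) (hE0 : 0 < volume.real E)
    (h : volume.real (D + E) <
      volume.real D + volume.real E + min (volume.real D) (volume.real E) / 2) :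
    (∃ d, D ⊆ Icc d (d + 2 * (volume.real D + volume.real E))) ∧
      ∃ e, E ⊆ Icc e (e + 2 * (volume.real D + volume.real E)) := by
  have ne : ∀ {S : Set ℝ}, 0 < volume.real S → S.Nonempty := fun {S} hS =>
    nonempty_iff_ne_empty.2 fun he => by simp [he] at hS
  obtain ⟨d₀, hd₀⟩ := hD.exists_isLeast (ne hD0)
  obtain ⟨d₁, hd₁⟩ := hD.exists_isGreatest (ne hD0)
  obtain ⟨e₀, he₀⟩ := hE.exists_isLeast (ne hE0)
  obtain ⟨e₁, he₁⟩ := hE.exists_isGreatest (ne hE0)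
  have hm1 := min_le_left (volume.real D) (volume.real E)
  have hm2 := min_le_right (volume.real D) (volume.real E)
  have key : d₁ - d₀ ≤ 2 * (volume.real D + volume.real E) ∧
      e₁ - e₀ ≤ 2 * (volume.real D + volume.real E) := by
    rcases le_total (e₁ - e₀ - volume.real E) (d₁ - d₀ - volume.real D) with hc | hc
    · have : d₁ - d₀ ≤ volume.real D + volume.real E := by
        by_contra! hlt
        have := (gapGain_of_lt hD hd₀ hd₁ (γ := (e₁ - e₀) / 2) (by linarith)).two_mul
          hE he₀ he₁ (by linarith)
        linarith
      constructor <;> linarith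
    · have : e₁ - e₀ ≤ volume.real D + volume.real E := by
        by_contra! hlt
        have := (gapGain_of_lt hE he₀ he₁ (γ := (d₁ - d₀) / 2) (by linarith)).two_mul
          hD hd₀ hd₁ (by linarith)
        rw [add_comm E D] at this
        linarith
      constructor <;> linarith
  refine ⟨⟨d₀, fun x hx => ⟨hd₀.2 hx, ?_⟩⟩, ⟨e₀, fun x hx => ⟨he₀.2 hx, ?_⟩⟩⟩
  · linarith [hd₁.2 hx, key.1]
  · linarith [he₁.2 hx, key.2]

section

/-- Brunn–Minkowski on the line, for measurable sets. -/
lemma volume_real_add_le_of_add_subset {F G H : Set ℝ} (hF : MeasurableSet F)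
    (hG : MeasurableSet G) (hF' : F.Nonempty) (hG' : G.Nonempty) (hFt : volume F ≠ ⊤)
    (hGt : volume G ≠ ⊤) (hHt : volume H ≠ ⊤) (h : F + G ⊆ H) :
    volume.real F + volume.real G ≤ volume.real H := by
  have approx : ∀ {S : Set ℝ}, MeasurableSet S → S.Nonempty → volume S ≠ ⊤ → ∀ ε > (0:ℝ),
      ∃ K ⊆ S, IsCompact K ∧ K.Nonempty ∧ volume.real S ≤ volume.real K + ε := by
    intro S hS ⟨x, hx⟩ hSt ε hε
    obtain ⟨K, hKS, hK, hlt⟩ := hS.exists_isCompact_lt_add hSt (ENNReal.ofReal_pos.2 hε).ne'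
    refine ⟨insert x K, insert_subset hx hKS, hK.insert x, insert_nonempty _ _, ?_⟩
    have h1 : volume S ≤ volume (insert x K) + ENNReal.ofReal ε :=
      hlt.le.trans (by gcongr; exact subset_insert _ _)
    have h2 := ENNReal.toReal_mono (by simp [(hK.insert x).measure_lt_top.ne]) h1
    rwa [ENNReal.toReal_add (hK.insert x).measure_lt_top.ne (by simp),
      ENNReal.toReal_ofReal hε.le] at h2
  refine le_of_forall_pos_le_add fun ε hε => ?_
  obtain ⟨K, hKF, hK, hK', hK1⟩ := approx hF hF' hFt (ε / 2) (by positivity)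
  obtain ⟨L, hLG, hL, hL', hL1⟩ := approx hG hG' hGt (ε / 2) (by positivity)
  have h1 := volume_real_add_le_add hK hK' hL hL'
  have h2 : volume.real (K + L) ≤ volume.real H :=
    measureReal_mono ((add_subset_add hKF hLG).trans h) hHt
  linarith

/-- A measurable integrable function on the line with values in `[0, 1]` and supremum `1`. -/
structure IsProfile (φ : ℝ → ℝ) : Prop where
  meas : Measurable φ
  nonneg : ∀ x, 0 ≤ φ x
  le_one : ∀ x, φ x ≤ 1
  exists_lt : ∀ t < 1, ∃ x, t < φ x
  integrable : Integrable φ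

/-- `h` dominates the geometric-mean convolution of `φ` and `ψ`. -/
structure IsMajorant (φ ψ h : ℝ → ℝ) : Prop where
  meas : Measurable h
  integrable : Integrable h
  le : ∀ x y, √(φ x * ψ y) ≤ h (x + y)

lemma IsMajorant.nonneg {φ ψ h : ℝ → ℝ} (H : IsMajorant φ ψ h) (z : ℝ) : 0 ≤ h z := by
  have := H.le z 0
  rw [add_zero] at this
  exact (Real.sqrt_nonneg _).trans this

lemma IsMajorant.symm {φ ψ h : ℝ → ℝ} (H : IsMajorant φ ψ h) : IsMajorant ψ φ h :=
  ⟨H.meas, H.integrable, fun x y => by rw [mul_comm, add_comm]; exact H.le y x⟩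

variable {φ ψ h : ℝ → ℝ}

lemma IsMajorant.level_add_subset (H : IsMajorant φ ψ h) {t : ℝ} (ht : 0 < t) :
    {x | t < φ x} + {x | t < ψ x} ⊆ {x | t < h x} := by
  rintro _ ⟨x, hx, y, hy, rfl⟩
  refine lt_of_lt_of_le (Real.lt_sqrt_of_sq_lt ?_) (H.le x y)
  simp only [mem_ofPred_eq] at hx hy
  nlinarith

lemma IsMajorant.level (H : IsMajorant φ ψ h) (hφ : IsProfile φ) (hψ : IsProfile ψ) {t : ℝ}
    (ht : 0 < t) (ht1 : t < 1) :
    volume.real {x | t < φ x} + volume.real {x | t < ψ x} ≤ volume.real {x | t < h x} :=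
  volume_real_add_le_of_add_subset (measurableSet_lt measurable_const hφ.meas)
    (measurableSet_lt measurable_const hψ.meas) (hφ.exists_lt t ht1) (hψ.exists_lt t ht1)
    (hφ.integrable.measure_gt_lt_top ht).ne (hψ.integrable.measure_gt_lt_top ht).ne
    (H.integrable.measure_gt_lt_top ht).ne (H.level_add_subset ht)

lemma measurable_volume_superlevel (φ : ℝ → ℝ) :
    Measurable fun t : ℝ => volume {x | t < φ x} :=
  Antitone.measurable fun _ _ hst => measure_mono fun _ hx => lt_of_le_of_lt hst hx

lemma IsMajorant.integral_add_le (H : IsMajorant φ ψ h) (hφ : IsProfile φ) (hψ : IsProfile ψ)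
    {κ l : ℝ} (hκ : 0 ≤ κ) (hl : 0 < l) (hl1 : 2 * l ≤ 1)
    (hgain : ∀ t ∈ Ioo l (2 * l), volume.real {x | t < φ x} + volume.real {x | t < ψ x} + κ ≤
      volume.real {x | t < h x}) :
    (∫ x, φ x) + (∫ x, ψ x) + κ * l ≤ ∫ x, h x := by
  have e1 := ofReal_integral_eq_lintegral_ofReal hφ.integrable (ae_of_all _ hφ.nonneg)
  have e2 := ofReal_integral_eq_lintegral_ofReal hψ.integrable (ae_of_all _ hψ.nonneg)
  have e3 := ofReal_integral_eq_lintegral_ofReal H.integrable (ae_of_all _ H.nonneg)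
  rw [lintegral_eq_lintegral_meas_lt _ (ae_of_all _ hφ.nonneg) hφ.meas.aemeasurable] at e1
  rw [lintegral_eq_lintegral_meas_lt _ (ae_of_all _ hψ.nonneg) hψ.meas.aemeasurable] at e2
  rw [lintegral_eq_lintegral_meas_lt _ (ae_of_all _ H.nonneg) H.meas.aemeasurable] at e3
  have e4 : ENNReal.ofReal (κ * l) =
      ∫⁻ t in Ioi (0:ℝ), (Ioo l (2 * l)).indicator (fun _ => ENNReal.ofReal κ) t := by
    rw [lintegral_indicator measurableSet_Ioo, setLIntegral_const,
      Measure.restrict_apply measurableSet_Ioo]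
    have : Ioo l (2 * l) ∩ Ioi 0 = Ioo l (2 * l) :=
      inter_eq_left.2 fun x hx => hl.trans hx.1
    rw [this, Real.volume_Ioo, ENNReal.ofReal_mul hκ]
    congr 2; ring
  have n0 : 0 ≤ ∫ x, φ x := integral_nonneg hφ.nonneg
  have n1 : 0 ≤ ∫ x, ψ x := integral_nonneg hψ.nonneg
  have n2 : 0 ≤ ∫ x, h x := integral_nonneg H.nonneg
  have hsum : Measurable fun t : ℝ => volume {x | t < φ x} + volume {x | t < ψ x} :=
    (measurable_volume_superlevel φ).add (measurable_volume_superlevel ψ)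
  rw [← ENNReal.ofReal_le_ofReal_iff n2, ENNReal.ofReal_add (by positivity) (by positivity),
    ENNReal.ofReal_add n0 n1, e1, e2, e3, e4,
    ← lintegral_add_left (measurable_volume_superlevel φ),
    ← lintegral_add_left hsum]
  refine setLIntegral_mono' measurableSet_Ioi fun t ht => ?_
  have t1 := (hφ.integrable.measure_gt_lt_top ht).ne
  have t2 := (hψ.integrable.measure_gt_lt_top ht).ne
  have t3 := (H.integrable.measure_gt_lt_top ht).ne
  rcases lt_or_ge t 1 with h1 | h1
  · by_cases hts : t ∈ Ioo l (2 * l)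
    · rw [indicator_of_mem hts, ← ofReal_measureReal t1, ← ofReal_measureReal t2,
        ← ofReal_measureReal t3, ← ENNReal.ofReal_add measureReal_nonneg measureReal_nonneg,
        ← ENNReal.ofReal_add (by positivity) hκ]
      exact ENNReal.ofReal_le_ofReal (hgain t hts)
    · rw [indicator_of_notMem hts, ← ofReal_measureReal t1, ← ofReal_measureReal t2,
        ← ofReal_measureReal t3, ← ENNReal.ofReal_add measureReal_nonneg measureReal_nonneg,
        add_zero]
      exact ENNReal.ofReal_le_ofReal (H.level hφ hψ ht h1)
  · have f1 : {x | t < φ x} = ∅ := eq_empty_of_forall_notMem fun x hx =>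
      absurd (hφ.le_one x) (not_le.2 (h1.trans_lt hx))
    have f2 : {x | t < ψ x} = ∅ := eq_empty_of_forall_notMem fun x hx =>
      absurd (hψ.le_one x) (not_le.2 (h1.trans_lt hx))
    have f3 : t ∉ Ioo l (2 * l) := fun hm => by linarith [hm.2]
    simp [f1, f2, f3]

lemma IsMajorant.integral_add_le' (H : IsMajorant φ ψ h) (hφ : IsProfile φ) (hψ : IsProfile ψ) :
    (∫ x, φ x) + (∫ x, ψ x) ≤ ∫ x, h x := by
  have := H.integral_add_le hφ hψ (κ := 0) (l := 1 / 2) le_rfl (by norm_num) (by norm_num)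
    fun t ht => by
      rw [add_zero]
      exact H.level hφ hψ (by linarith [ht.1]) (by linarith [ht.2])
  simpa using this

/-- Normalising a bounded nonnegative function by its supremum gives a profile. -/
lemma isProfile_div_iSup (hm : Measurable φ) (h0 : ∀ x, 0 ≤ φ x) (hb : BddAbove (range φ))
    (hi : Integrable φ) (hpos : 0 < ⨆ x, φ x) : IsProfile fun x => φ x / ⨆ x, φ x where
  meas := hm.div_const _
  nonneg x := div_nonneg (h0 x) hpos.le
  le_one x := (div_le_one hpos).2 (le_ciSup hb x)
  exists_lt t ht := by
    obtain ⟨x, hx⟩ := exists_lt_of_lt_ciSup (f := φ) (b := t * ⨆ x, φ x) (by nlinarith)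
    exact ⟨x, (lt_div_iff₀ hpos).2 hx⟩
  integrable := hi.div_const _

lemma IsMajorant.div (H : IsMajorant φ ψ h) {a b : ℝ} (ha : 0 < a) (hb : 0 < b) :
    IsMajorant (fun x => φ x / a) (fun x => ψ x / b) (fun x => h x / √(a * b)) where
  meas := H.meas.div_const _
  integrable := H.integrable.div_const _
  le x y := by
    rw [div_mul_div_comm, Real.sqrt_div' _ (by positivity)]
    exact div_le_div_of_nonneg_right (H.le x y) (Real.sqrt_nonneg _)

/-- The Prékopa–Leindler inequality on the line. -/
lemma IsMajorant.two_mul_sqrt_le (H : IsMajorant φ ψ h) (hφm : Measurable φ)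
    (hφ0 : ∀ x, 0 ≤ φ x) (hφb : BddAbove (range φ)) (hφi : Integrable φ) (hψm : Measurable ψ)
    (hψ0 : ∀ x, 0 ≤ ψ x) (hψb : BddAbove (range ψ)) (hψi : Integrable ψ) :
    2 * √((∫ x, φ x) * ∫ x, ψ x) ≤ ∫ x, h x := by
  have n2 : 0 ≤ ∫ x, h x := integral_nonneg H.nonneg
  have triv : ∀ {φ : ℝ → ℝ}, (∀ x, 0 ≤ φ x) → BddAbove (range φ) → ¬ 0 < (⨆ x, φ x) →
      ∫ x, φ x = 0 := by
    intro φ h0 hb hn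
    have : φ = fun _ => 0 := funext fun x => le_antisymm ((le_ciSup hb x).trans (not_lt.1 hn)) (h0 x)
    simp [this]
  by_cases ha : 0 < ⨆ x, φ x
  swap
  · simpa [triv hφ0 hφb ha] using n2
  by_cases hb : 0 < ⨆ x, ψ x
  swap
  · simpa [triv hψ0 hψb hb] using n2
  have key := (H.div ha hb).integral_add_le' (isProfile_div_iSup hφm hφ0 hφb hφi ha)
    (isProfile_div_iSup hψm hψ0 hψb hψi hb)
  simp only [integral_div] at key
  have n0 : 0 ≤ ∫ x, φ x := integral_nonneg hφ0
  have n1 : 0 ≤ ∫ x, ψ x := integral_nonneg hψ0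
  generalize (⨆ x, φ x) = a at *
  generalize (⨆ x, ψ x) = b at *
  generalize (∫ x, φ x) = f at *
  generalize (∫ x, ψ x) = g at *
  have hab : 0 < √(a * b) := Real.sqrt_pos.2 (mul_pos ha hb)
  have h1 : 2 * √(f / a * (g / b)) ≤ f / a + g / b := by
    have p0 : 0 ≤ f / a := by positivity
    have p1 : 0 ≤ g / b := by positivity
    rw [Real.sqrt_mul p0]
    nlinarith [sq_nonneg (√(f / a) - √(g / b)), Real.sq_sqrt p0, Real.sq_sqrt p1]
  have h2 : √(f / a * (g / b)) = √(f * g) / √(a * b) := by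
    rw [div_mul_div_comm, Real.sqrt_div' _ (by positivity)]
  rw [h2] at h1
  have h3 := h1.trans key
  rw [← mul_div_assoc, div_le_div_iff_of_pos_right hab] at h3
  exact h3

lemma le_two_mul_of_add_le_sqrt {f g δ : ℝ} (hf : 0 ≤ f) (hg : 0 ≤ g) (hδ : δ ≤ 1 / 100)
    (h : f + g ≤ 2 * (1 + δ) * √(f * g)) :
    f ≤ 2 * g ∧ 2 * (1 + δ) * √(f * g) ≤ 3 * g := by
  rw [Real.sqrt_mul hf] at *
  have hu := Real.sq_sqrt hf
  have hv := Real.sq_sqrt hg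
  have hu0 := Real.sqrt_nonneg f
  have hv0 := Real.sqrt_nonneg g
  generalize √f = u at *
  generalize √g = v at *
  have h1 : 2 * (1 + δ) * (u * v) ≤ 2.02 * (u * v) := by
    gcongr; linarith
  have h2 : u ≤ 1.2 * v := by
    by_contra! hc
    nlinarith
  constructor <;> nlinarith

/-- The part of a profile below a small level carries little mass. -/
lemma IsMajorant.setIntegral_le_level (H : IsMajorant φ ψ h) (hφ : IsProfile φ)
    (hψ : IsProfile ψ) (l : ℝ) :
    ∫ y in {y | ψ y ≤ l}, ψ y ≤ 2 * √l * ∫ x, h x := by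
  obtain ⟨x, hx⟩ := hφ.exists_lt (1 / 4) (by norm_num)
  have hs : MeasurableSet {y | ψ y ≤ l} := measurableSet_le hψ.meas measurable_const
  have hi : Integrable fun y => 2 * √l * h (x + y) :=
    (H.integrable.comp_add_left x).const_mul _
  have n : ∀ y, 0 ≤ 2 * √l * h (x + y) := fun y =>
    mul_nonneg (by positivity) (H.nonneg _)
  calc ∫ y in {y | ψ y ≤ l}, ψ y ≤ ∫ y in {y | ψ y ≤ l}, 2 * √l * h (x + y) := by
        refine setIntegral_mono_on hψ.integrable.integrableOn hi.integrableOn hs fun y hy => ?_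
        have h0 := hψ.nonneg y
        have h1 : √(ψ y) * (1 / 2) ≤ h (x + y) := by
          refine le_trans ?_ (H.le x y)
          rw [mul_comm, Real.sqrt_mul (hφ.nonneg x)]
          refine mul_le_mul_of_nonneg_right ?_ (Real.sqrt_nonneg _)
          exact Real.le_sqrt_of_sq_le (by norm_num; linarith)
        have h2 : √(ψ y) ≤ √l := Real.sqrt_le_sqrt hy
        have h3 := Real.mul_self_sqrt h0
        have h4 := Real.sqrt_nonneg (ψ y)
        have h5 := Real.sqrt_nonneg l
        nlinarith
    _ ≤ ∫ y, 2 * √l * h (x + y) :=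
        setIntegral_le_integral hi (ae_of_all _ n)
    _ = 2 * √l * ∫ x, h x := by
        rw [integral_const_mul, integral_add_left_eq_self (fun y => h y) x]

lemma volume_real_superlevel_le (hφ : IsProfile φ) {t : ℝ} (ht : 0 < t) :
    volume.real {x | t < φ x} ≤ (∫ x, φ x) / t := by
  rw [le_div_iff₀ ht, mul_comm]
  refine le_trans ?_ (mul_meas_ge_le_integral_of_nonneg (ae_of_all _ hφ.nonneg) hφ.integrable t)
  gcongr
  · exact (hφ.integrable.measure_ge_lt_top ht).ne
  · exact fun hx => le_of_lt hx

lemma setIntegral_le_volume_real (hφ : IsProfile φ) {s : Set ℝ} (hs : MeasurableSet s)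
    (hst : volume s ≠ ⊤) :
    ∫ x in s, φ x ≤ volume.real s := by
  calc ∫ x in s, φ x ≤ ∫ x in s, (1 : ℝ) :=
        setIntegral_mono_on hφ.integrable.integrableOn (by simp [hst.lt_top]) hs
          fun x _ => hφ.le_one x
    _ = volume.real s := by simp

/-- A compact subset of a superlevel set carrying almost all the mass. -/
lemma IsProfile.exists_compact_superlevel (hφ : IsProfile φ) {t l η m : ℝ} (hl0 : 0 < l)
    (hlt : l < t) (hη : 0 < η) (hη1 : η ≤ 1) (hm0 : 0 < m) (hmφ : m ≤ ∫ x, φ x)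
    (hsq : √t ≤ η / 14) (htail : ∫ x in {x | φ x ≤ t}, φ x ≤ 6 * √t * ∫ x, φ x) :
    ∃ D ⊆ {x | t < φ x}, IsCompact D ∧ 0.46 * m < volume.real D ∧
      volume.real {x | t < φ x} ≤ volume.real D + η * m / 32 ∧
      volume.real D ≤ (∫ x, φ x) / l ∧
      ∀ I, MeasurableSet I → D ⊆ I → ∫ x in Iᶜ, φ x ≤ η * ∫ x, φ x := by
  have ht0 : 0 < t := hl0.trans hlt
  have hlev : MeasurableSet {x | t < φ x} := measurableSet_lt measurable_const hφ.meas
  have htop := (hφ.integrable.measure_gt_lt_top ht0).ne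
  have hε : 0 < η * m / 32 := by positivity
  obtain ⟨D, hDs, hD, hDlt⟩ := hlev.exists_isCompact_sdiff_lt htop
    (ENNReal.ofReal_pos.2 hε).ne'
  have htd : volume ({x | t < φ x} \ D) ≠ ⊤ := measure_ne_top_of_subset sdiff_subset htop
  have hdiff : volume.real ({x | t < φ x} \ D) ≤ η * m / 32 := by
    have := ENNReal.toReal_mono ENNReal.ofReal_ne_top hDlt.le
    rwa [ENNReal.toReal_ofReal hε.le] at this
  have hcompl : {x | t < φ x}ᶜ = {x | φ x ≤ t} := by ext; simp
  have hsplit := integral_add_compl hlev hφ.integrable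
  rw [hcompl] at hsplit
  have hle : volume.real {x | t < φ x} ≤ volume.real D + volume.real ({x | t < φ x} \ D) := by
    refine le_trans (measureReal_mono ?_ ?_) (measureReal_union_le _ _)
    · rw [union_sdiff_self]; exact subset_union_right
    · exact ((measure_union_le _ _).trans_lt
        (ENNReal.add_lt_top.2 ⟨hD.measure_lt_top, htd.lt_top⟩)).ne
  have hF := setIntegral_le_volume_real hφ hlev htop
  have hp : 0 < ∫ x, φ x := hm0.trans_le hmφ
  have htail' : ∫ x in {x | φ x ≤ t}, φ x ≤ 3 / 7 * η * ∫ x, φ x := by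
    nlinarith
  refine ⟨D, hDs, hD, by nlinarith, by linarith, ?_, ?_⟩
  · calc volume.real D ≤ volume.real {x | t < φ x} := measureReal_mono hDs htop
      _ ≤ (∫ x, φ x) / t := volume_real_superlevel_le hφ ht0
      _ ≤ (∫ x, φ x) / l := by gcongr
  · intro I hI hDI
    have hlow : MeasurableSet {x | φ x ≤ t} := measurableSet_le hφ.meas measurable_const
    have hdm : MeasurableSet ({x | t < φ x} \ D) := hlev.diff hD.measurableSet
    calc ∫ x in Iᶜ, φ x ≤ ∫ x in {x | φ x ≤ t} ∪ ({x | t < φ x} \ D), φ x := by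
          refine setIntegral_mono_set hφ.integrable.integrableOn
            (ae_of_all _ hφ.nonneg) (LE.le.eventuallyLE ?_)
          intro x hx
          rcases le_or_gt (φ x) t with hc | hc
          · exact Or.inl hc
          · exact Or.inr ⟨hc, fun hxD => hx (hDI hxD)⟩
      _ = (∫ x in {x | φ x ≤ t}, φ x) + ∫ x in {x | t < φ x} \ D, φ x := by
          refine setIntegral_union ?_ hdm hφ.integrable.integrableOn hφ.integrable.integrableOn
          exact Set.disjoint_left.2 fun x hx hx' => (not_lt.2 hx : ¬ t < φ x) hx'.1
      _ ≤ 3 / 7 * η * (∫ x, φ x) + η * m / 32 :=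
          add_le_add htail' ((setIntegral_le_volume_real hφ hdm htd).trans hdiff)
      _ ≤ η * ∫ x, φ x := by nlinarith

/-- Near equality in one-dimensional Prékopa–Leindler forces both functions to live, up to a
proportion `η`, on intervals of length comparable to their mass. -/
lemma IsMajorant.exists_interval (H : IsMajorant φ ψ h) (hφ : IsProfile φ) (hψ : IsProfile ψ)
    {η δ : ℝ} (hη : 0 < η) (hη1 : η ≤ 1) (hδ : δ ≤ η ^ 2 / 12800) (hf : 0 < ∫ x, φ x)
    (hg : 0 < ∫ x, ψ x) (hh : ∫ x, h x ≤ 2 * (1 + δ) * √((∫ x, φ x) * ∫ x, ψ x)) :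
    (∃ d, ∫ x in (Icc d (d + 2400 / η ^ 2 * ∫ x, φ x))ᶜ, φ x ≤ η * ∫ x, φ x) ∧
    ∃ d, ∫ x in (Icc d (d + 2400 / η ^ 2 * ∫ x, ψ x))ᶜ, ψ x ≤ η * ∫ x, ψ x := by
  have hη2 : η ^ 2 ≤ 1 := by nlinarith
  have hδ' : δ ≤ 1 / 100 := by linarith
  have hsum := H.integral_add_le' hφ hψ
  obtain ⟨fg, h3g⟩ := le_two_mul_of_add_le_sqrt hf.le hg.le hδ' (hsum.trans hh)
  obtain ⟨gf, h3f⟩ := le_two_mul_of_add_le_sqrt hg.le hf.le hδ'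
    (by rw [add_comm, mul_comm (∫ x, ψ x)]; exact hsum.trans hh)
  rw [mul_comm (∫ x, ψ x)] at h3f
  set f := ∫ x, φ x with hfdef
  set g := ∫ x, ψ x with hgdef
  set m := min f g with hm
  have hm0 : 0 < m := lt_min hf hg
  have hmf : m ≤ f := min_le_left _ _
  have hmg : m ≤ g := min_le_right _ _
  have hfm : f + g ≤ 3 * m := by
    rcases min_choice f g with hc | hc <;> rw [hm, hc] <;> linarith
  obtain ⟨l, hl⟩ : ∃ l, l = η ^ 2 / 400 := ⟨_, rfl⟩
  have hl0 : 0 < l := by rw [hl]; positivity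
  obtain ⟨t, ht, hNt⟩ : ∃ t ∈ Ioo l (2 * l), volume.real {x | t < h x} <
      volume.real {x | t < φ x} + volume.real {x | t < ψ x} + m / 8 := by
    by_contra! hcon
    have := H.integral_add_le hφ hψ (by positivity) hl0 (by rw [hl]; linarith) hcon
    have h2 : 2 * √(f * g) ≤ f + g := by
      rw [Real.sqrt_mul hf.le]
      nlinarith [sq_nonneg (√f - √g), Real.sq_sqrt hf.le, Real.sq_sqrt hg.le]
    have h4 : 2 * δ * √(f * g) ≥ m / 8 * l := by nlinarith
    have h5 : δ ≤ l / 32 := by rw [hl]; linarith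
    have h6 := Real.sqrt_nonneg (f * g)
    have h7 : 2 * δ * √(f * g) ≤ l / 32 * (3 * m) := by
      nlinarith
    nlinarith [mul_pos hm0 hl0]
  have ht0 : 0 < t := hl0.trans ht.1
  have hsq : √t ≤ η / 14 := by
    rw [Real.sqrt_le_left (by positivity)]
    have := ht.2
    rw [hl] at this
    nlinarith
  have nh : 0 ≤ √t := Real.sqrt_nonneg t
  obtain ⟨D, hDs, hD, hD0, hD1, hDl, hDI⟩ :=
    hφ.exists_compact_superlevel hl0 ht.1 hη hη1 hm0 hmf hsq
    ((H.symm.setIntegral_le_level hψ hφ t).trans (by nlinarith))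
  obtain ⟨E, hEs, hE, hE0, hE1, hEl, hEI⟩ :=
    hψ.exists_compact_superlevel hl0 ht.1 hη hη1 hm0 hmg hsq
    ((H.setIntegral_le_level hφ hψ t).trans (by nlinarith))
  have hDE : volume.real (D + E) ≤ volume.real {x | t < h x} :=
    measureReal_mono ((add_subset_add hDs hEs).trans (H.level_add_subset ht0))
      (H.integrable.measure_gt_lt_top ht0).ne
  have hmin : 0.46 * m ≤ min (volume.real D) (volume.real E) := le_min hD0.le hE0.le
  have hηm : η * m ≤ m := by nlinarith
  obtain ⟨⟨d, hd⟩, ⟨e, he⟩⟩ := exists_subset_Icc_of_volume_add_lt hD hE (by linarith) (by linarith)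
    (by linarith)
  have hlen : ∀ s, m ≤ s → f + g ≤ 3 * s → 2 * (volume.real D + volume.real E) ≤ 2400 / η ^ 2 * s := by
    intro s _ hs
    calc 2 * (volume.real D + volume.real E) ≤ 2 * (f / l + g / l) := by gcongr
      _ = 2 * (f + g) / l := by ring
      _ ≤ 2 * (3 * s) / l := by gcongr
      _ = 2400 / η ^ 2 * s := by rw [hl]; field_simp; ring
  refine ⟨⟨d, hDI _ measurableSet_Icc (hd.trans (Icc_subset_Icc_right ?_))⟩,
    ⟨e, hEI _ measurableSet_Icc (he.trans (Icc_subset_Icc_right ?_))⟩⟩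
  · have := hlen f hmf (by linarith)
    linarith
  · have := hlen g hmg (by linarith)
    linarith

end

section Slices

variable {X : Type*} [AddCommGroup X] [TopologicalSpace X] [IsTopologicalAddGroup X] [T2Space X]
  [SecondCountableTopology X] [MeasureSpace X] [BorelSpace X] [SFinite (volume : Measure X)]
  [IsFiniteMeasureOnCompacts (volume : Measure X)]

/-- The measure of a vertical slice. -/
noncomputable def sliceVol (A : Set (ℝ × X)) (x : ℝ) : ℝ := volume.real (Prod.mk x ⁻¹' A)

lemma sliceVol_nonneg (A : Set (ℝ × X)) (x : ℝ) : 0 ≤ sliceVol A x := measureReal_nonneg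

lemma isCompact_slice {A : Set (ℝ × X)} (hA : IsCompact A) (x : ℝ) :
    IsCompact (Prod.mk x ⁻¹' A) := by
  have : Prod.mk x ⁻¹' A = Prod.snd '' (A ∩ Prod.fst ⁻¹' {x}) := by
    ext z
    simp
  rw [this]
  exact (hA.inter_right (isClosed_singleton.preimage continuous_fst)).image continuous_snd

lemma measurable_sliceVol {A : Set (ℝ × X)} (hA : MeasurableSet A) : Measurable (sliceVol A) :=
  (measurable_measure_prodMk_left hA).ennreal_toReal

lemma integrable_sliceVol {A : Set (ℝ × X)} (hA : MeasurableSet A) (hA' : volume A ≠ ⊤) :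
    Integrable (sliceVol A) :=
  Measure.integrable_measure_prodMk_left hA hA'

lemma integral_sliceVol {A : Set (ℝ × X)} (hA : MeasurableSet A) (hA' : volume A ≠ ⊤) :
    ∫ x, sliceVol A x = volume.real A := by
  rw [Measure.volume_eq_prod] at hA'
  have h1 : ∫⁻ x, volume (Prod.mk x ⁻¹' A) = volume A := by
    rw [Measure.volume_eq_prod, Measure.prod_apply hA]
  have h2 : ∀ᵐ x : ℝ, volume (Prod.mk x ⁻¹' A) < ⊤ := Measure.ae_measure_lt_top hA hA'
  rw [measureReal_def, ← h1]
  exact integral_toReal (measurable_measure_prodMk_left hA).aemeasurable h2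

lemma setIntegral_sliceVol {A : Set (ℝ × X)} (hA : MeasurableSet A) (hA' : volume A ≠ ⊤)
    {S : Set ℝ} (hS : MeasurableSet S) :
    ∫ x in S, sliceVol A x = volume.real (A ∩ Prod.fst ⁻¹' S) := by
  have hm : MeasurableSet (A ∩ Prod.fst ⁻¹' S) := hA.inter (measurable_fst hS)
  rw [← integral_sliceVol hm (measure_ne_top_of_subset inter_subset_left hA'),
    ← integral_indicator hS]
  congr 1
  ext x
  by_cases hx : x ∈ S
  · have : Prod.mk x ⁻¹' (A ∩ Prod.fst ⁻¹' S) = Prod.mk x ⁻¹' A := by ext; simp [hx]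
    rw [indicator_of_mem hx, sliceVol, sliceVol, this]
  · have : Prod.mk x ⁻¹' (A ∩ Prod.fst ⁻¹' S) = ∅ := by ext; simp [hx]
    rw [indicator_of_notMem hx, sliceVol, this, measureReal_empty]

lemma bddAbove_range_sliceVol {A : Set (ℝ × X)} (hA : IsCompact A) :
    BddAbove (range (sliceVol A)) := by
  refine ⟨volume.real (Prod.snd '' A), ?_⟩
  rintro _ ⟨x, rfl⟩
  exact measureReal_mono (fun z hz => ⟨(x, z), hz, rfl⟩)
    (hA.image continuous_snd).measure_lt_top.ne

lemma slice_add_subset (A B : Set (ℝ × X)) (x y : ℝ) :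
    Prod.mk x ⁻¹' A + Prod.mk y ⁻¹' B ⊆ Prod.mk (x + y) ⁻¹' (A + B) := by
  rintro _ ⟨z, hz, w, hw, rfl⟩
  exact ⟨_, hz, _, hw, rfl⟩

/-- The Brunn–Minkowski inequality with constant `c`, for compact sets. -/
def BrunnMinkowski (X : Type*) [AddCommGroup X] [TopologicalSpace X] [MeasureSpace X]
    (c : ℝ) : Prop :=
  ∀ A B : Set X, IsCompact A → IsCompact B →
    c * √(volume.real A * volume.real B) ≤ volume.real (A + B)

lemma BrunnMinkowski.slice {c : ℝ} (hX : BrunnMinkowski X c) {A B : Set (ℝ × X)}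
    (hA : IsCompact A) (hB : IsCompact B) (x y : ℝ) :
    c * √(sliceVol A x * sliceVol B y) ≤ sliceVol (A + B) (x + y) :=
  (hX _ _ (isCompact_slice hA x) (isCompact_slice hB y)).trans
    (measureReal_mono (slice_add_subset A B x y)
      (isCompact_slice (hA.add hB) _).measure_lt_top.ne)

lemma isMajorant_sliceVol {c : ℝ} (hc : 0 < c) {A B : Set (ℝ × X)}
    (hA : IsCompact A) (hB : IsCompact B) {φ ψ : ℝ → ℝ}
    (h : ∀ x y, c * √(φ x * ψ y) ≤ sliceVol (A + B) (x + y)) :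
    IsMajorant φ ψ (fun z => sliceVol (A + B) z / c) where
  meas := (measurable_sliceVol (hA.add hB).measurableSet).div_const c
  integrable :=
    (integrable_sliceVol (hA.add hB).measurableSet (hA.add hB).measure_lt_top.ne).div_const c
  le x y := (le_div_iff₀' hc).2 (h x y)

/-- Near equality in Brunn–Minkowski bounds the mass of slices with a multiplicative gain. -/
lemma BrunnMinkowski.mul_volume_gain_le {c κ δ : ℝ} (hX : BrunnMinkowski X c) (hc : 0 < c)
    (hκ : 0 ≤ κ) (hδ : 0 ≤ 1 + δ) {A B : Set (ℝ × X)} (hA : IsCompact A) (hB : IsCompact B)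
    (hB0 : 0 < volume.real B)
    (hAB : volume.real (A + B) ≤ 2 * c * (1 + δ) * √(volume.real A * volume.real B))
    {N : Set ℝ} (hN : MeasurableSet N)
    (hgain : ∀ x ∈ N, ∀ y, c * √((1 + κ) * sliceVol A x * sliceVol B y) ≤
      sliceVol (A + B) (x + y)) :
    κ * volume.real (A ∩ Prod.fst ⁻¹' N) ≤ (2 * δ + δ ^ 2) * volume.real A := by
  have hAm := hA.measurableSet
  have hBm := hB.measurableSet
  have hAi := integrable_sliceVol hAm hA.measure_lt_top.ne
  have hBi := integrable_sliceVol hBm hB.measure_lt_top.ne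
  set φ : ℝ → ℝ := fun x => sliceVol A x + κ * N.indicator (sliceVol A) x with hφ
  have ind0 : ∀ x, 0 ≤ N.indicator (sliceVol A) x :=
    fun x => indicator_nonneg (fun _ _ => sliceVol_nonneg A _) x
  have indle : ∀ x, N.indicator (sliceVol A) x ≤ sliceVol A x :=
    fun x => indicator_le_self' (fun _ _ => sliceVol_nonneg A _) x
  have hM : IsMajorant φ (sliceVol B) (fun z => sliceVol (A + B) z / c) := by
    refine isMajorant_sliceVol hc hA hB fun x y => ?_
    by_cases hx : x ∈ N
    · have : φ x = (1 + κ) * sliceVol A x := by simp [hφ, hx]; ring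
      rw [this]
      exact hgain x hx y
    · have : φ x = sliceVol A x := by simp [hφ, hx]
      rw [this]
      exact hX.slice hA hB x y
  obtain ⟨M, hMb⟩ := bddAbove_range_sliceVol hA
  have hMb' : ∀ x, sliceVol A x ≤ M := fun x => hMb ⟨x, rfl⟩
  have key := hM.two_mul_sqrt_le
    ((measurable_sliceVol hAm).add (((measurable_sliceVol hAm).indicator hN).const_mul κ))
    (fun x => add_nonneg (sliceVol_nonneg A x) (mul_nonneg hκ (ind0 x)))
    ⟨M + κ * M, by
      rintro _ ⟨x, rfl⟩
      exact add_le_add (hMb' x) (mul_le_mul_of_nonneg_left ((indle x).trans (hMb' x)) hκ)⟩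
    (hAi.add ((hAi.indicator hN).const_mul κ)) (measurable_sliceVol hBm) (sliceVol_nonneg B)
    (bddAbove_range_sliceVol hB) hBi
  have e1 : ∫ x, φ x = volume.real A + κ * volume.real (A ∩ Prod.fst ⁻¹' N) := by
    rw [hφ, integral_add hAi ((hAi.indicator hN).const_mul κ), integral_const_mul,
      integral_indicator hN, integral_sliceVol hAm hA.measure_lt_top.ne,
      setIntegral_sliceVol hAm hA.measure_lt_top.ne hN]
  rw [e1, integral_div, integral_sliceVol hBm hB.measure_lt_top.ne,
    integral_sliceVol (hA.add hB).measurableSet (hA.add hB).measure_lt_top.ne,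
    le_div_iff₀ hc] at key
  have hmn : 0 ≤ volume.real (A ∩ Prod.fst ⁻¹' N) := measureReal_nonneg
  have ha0 : 0 ≤ volume.real A := measureReal_nonneg
  have k2 : √((volume.real A + κ * volume.real (A ∩ Prod.fst ⁻¹' N)) * volume.real B) ≤
      (1 + δ) * √(volume.real A * volume.real B) := by
    have := key.trans hAB
    nlinarith
  rw [Real.sqrt_le_left (by positivity), mul_pow, Real.sq_sqrt (by positivity)] at k2
  have k3 : volume.real A + κ * volume.real (A ∩ Prod.fst ⁻¹' N) ≤
      (1 + δ) ^ 2 * volume.real A := by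
    rw [← mul_assoc] at k2
    exact le_of_mul_le_mul_right k2 hB0
  nlinarith

lemma BrunnMinkowski.prod {c : ℝ} (hX : BrunnMinkowski X c) (hc : 0 < c) :
    BrunnMinkowski (ℝ × X) (2 * c) := by
  intro A B hA hB
  have hAm := hA.measurableSet
  have hBm := hB.measurableSet
  have key := (isMajorant_sliceVol hc hA hB (hX.slice hA hB)).two_mul_sqrt_le
    (measurable_sliceVol hAm) (sliceVol_nonneg A) (bddAbove_range_sliceVol hA)
    (integrable_sliceVol hAm hA.measure_lt_top.ne) (measurable_sliceVol hBm) (sliceVol_nonneg B)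
    (bddAbove_range_sliceVol hB) (integrable_sliceVol hBm hB.measure_lt_top.ne)
  rw [integral_div, integral_sliceVol hBm hB.measure_lt_top.ne,
    integral_sliceVol hAm hA.measure_lt_top.ne,
    integral_sliceVol (hA.add hB).measurableSet (hA.add hB).measure_lt_top.ne,
    le_div_iff₀ hc] at key
  linarith

/-- The normalised slice functions of a pair of compact sets. -/
lemma BrunnMinkowski.exists_profile {c δ : ℝ} (hX : BrunnMinkowski X c) (hc : 0 < c)
    {A B : Set (ℝ × X)} (hA : IsCompact A) (hB : IsCompact B) (hA0 : 0 < volume.real A)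
    (hB0 : 0 < volume.real B)
    (hAB : volume.real (A + B) ≤ 2 * c * (1 + δ) * √(volume.real A * volume.real B)) :
    0 < (⨆ x, sliceVol A x) ∧ IsProfile (fun x => sliceVol A x / ⨆ x, sliceVol A x) ∧
    IsProfile (fun x => sliceVol B x / ⨆ x, sliceVol B x) ∧
    ∃ h, IsMajorant (fun x => sliceVol A x / ⨆ x, sliceVol A x)
        (fun x => sliceVol B x / ⨆ x, sliceVol B x) h ∧
      ∫ x, h x ≤ 2 * (1 + δ) * √((∫ x, sliceVol A x / ⨆ x, sliceVol A x) *
        ∫ x, sliceVol B x / ⨆ x, sliceVol B x) := by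
  have pos : ∀ {A : Set (ℝ × X)}, IsCompact A → 0 < volume.real A →
      0 < ⨆ x, sliceVol A x := by
    intro A hA hA0
    by_contra! hn
    have : sliceVol A = fun _ => 0 := funext fun x =>
      le_antisymm ((le_ciSup (bddAbove_range_sliceVol hA) x).trans hn) (sliceVol_nonneg A x)
    rw [← integral_sliceVol hA.measurableSet hA.measure_lt_top.ne, this] at hA0
    simp at hA0
  have prof : ∀ {A : Set (ℝ × X)}, IsCompact A → 0 < volume.real A →
      IsProfile (fun x => sliceVol A x / ⨆ x, sliceVol A x) := fun hA hA0 =>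
    isProfile_div_iSup (measurable_sliceVol hA.measurableSet) (sliceVol_nonneg _)
      (bddAbove_range_sliceVol hA) (integrable_sliceVol hA.measurableSet hA.measure_lt_top.ne)
      (pos hA hA0)
  refine ⟨pos hA hA0, prof hA hA0, prof hB hB0, _,
    (isMajorant_sliceVol hc hA hB (hX.slice hA hB)).div (pos hA hA0) (pos hB hB0), ?_⟩
  simp only [integral_div]
  rw [integral_sliceVol hA.measurableSet hA.measure_lt_top.ne,
    integral_sliceVol hB.measurableSet hB.measure_lt_top.ne,
    integral_sliceVol (hA.add hB).measurableSet (hA.add hB).measure_lt_top.ne, div_mul_div_comm,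
    Real.sqrt_div' _ (mul_pos (pos hA hA0) (pos hB hB0)).le, ← mul_div_assoc]
  refine div_le_div_of_nonneg_right ?_ (Real.sqrt_nonneg _)
  rw [div_le_iff₀ hc]
  linarith

/-- The horizontal extent of a set: its measure over its largest slice. -/
noncomputable def extent (A : Set (ℝ × X)) : ℝ := volume.real A / ⨆ x, sliceVol A x

/-- A pair of compact sets of positive measure, nearly extremal for Brunn–Minkowski. -/
structure NearBM {X : Type*} [AddCommGroup X] [TopologicalSpace X] [MeasureSpace X]
    (c δ : ℝ) (A B : Set X) : Prop where
  left : IsCompact A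
  right : IsCompact B
  left_pos : 0 < volume.real A
  right_pos : 0 < volume.real B
  le : volume.real (A + B) ≤ c * (1 + δ) * √(volume.real A * volume.real B)

lemma NearBM.symm {X : Type*} [AddCommGroup X] [TopologicalSpace X] [MeasureSpace X]
    {c δ : ℝ} {A B : Set X} (h : NearBM c δ A B) : NearBM c δ B A :=
  ⟨h.right, h.left, h.right_pos, h.left_pos, by rw [add_comm, mul_comm (volume.real B)]; exact h.le⟩

lemma NearBM.exists_interval {c δ η : ℝ} (hX : BrunnMinkowski X c) (hc : 0 < c)
    {A B : Set (ℝ × X)} (h : NearBM (2 * c) δ A B) (hη : 0 < η) (hη1 : η ≤ 1)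
    (hδ : δ ≤ η ^ 2 / 12800) :
    ∃ d, volume.real (A ∩ Prod.fst ⁻¹' (Icc d (d + 2400 / η ^ 2 * extent A))ᶜ) ≤
      η * volume.real A := by
  obtain ⟨ha, p1, p2, H, hH, hle⟩ := hX.exists_profile hc h.left h.right h.left_pos h.right_pos h.le
  obtain ⟨hb, -⟩ := hX.exists_profile hc h.symm.left h.symm.right h.symm.left_pos
    h.symm.right_pos h.symm.le
  have e : ∀ {A : Set (ℝ × X)}, IsCompact A →
      ∫ x, sliceVol A x / ⨆ x, sliceVol A x = extent A := by
    intro A hA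
    rw [integral_div, integral_sliceVol hA.measurableSet hA.measure_lt_top.ne, extent]
  have key := (hH.exists_interval p1 p2 hη hη1 hδ
    (by rw [e h.left]; exact div_pos h.left_pos ha)
    (by rw [e h.right]; exact div_pos h.right_pos hb) hle).1
  obtain ⟨d, hd⟩ := key
  refine ⟨d, ?_⟩
  rw [e h.left, integral_div, setIntegral_sliceVol h.left.measurableSet
    h.left.measure_lt_top.ne measurableSet_Icc.compl, div_le_iff₀ ha, mul_assoc, extent,
    div_mul_cancel₀ _ ha.ne', ← extent] at hd
  exact hd

lemma NearBM.extent_pos {c δ : ℝ} (hX : BrunnMinkowski X c) (hc : 0 < c)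
    {A B : Set (ℝ × X)} (h : NearBM (2 * c) δ A B) : 0 < extent A :=
  div_pos h.left_pos
    (hX.exists_profile hc h.left h.right h.left_pos h.right_pos h.le).1

lemma NearBM.extent_le {c δ : ℝ} (hX : BrunnMinkowski X c) (hc : 0 < c)
    {A B : Set (ℝ × X)} (h : NearBM (2 * c) δ A B) (hδ : δ ≤ 1 / 100) :
    extent A ≤ 2 * extent B := by
  obtain ⟨ha, p1, p2, H, hH, hle⟩ := hX.exists_profile hc h.left h.right h.left_pos h.right_pos h.le
  have key := hH.integral_add_le' p1 p2
  have := (le_two_mul_of_add_le_sqrt (integral_nonneg p1.nonneg) (integral_nonneg p2.nonneg) hδ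
    (key.trans hle)).1
  rwa [integral_div, integral_div, integral_sliceVol h.left.measurableSet h.left.measure_lt_top.ne,
    integral_sliceVol h.right.measurableSet h.right.measure_lt_top.ne] at this

lemma NearBM.volume_low_slices_le {c δ : ℝ} (hX : BrunnMinkowski X c) (hc : 0 < c)
    {A B : Set (ℝ × X)} (h : NearBM (2 * c) δ A B) (hδ : δ ≤ 1 / 100) (l : ℝ) :
    volume.real (A ∩ {p | sliceVol A p.1 ≤ l * ⨆ x, sliceVol A x}) ≤
      6 * √l * volume.real A := by
  obtain ⟨ha, p1, p2, H, hH, hle⟩ :=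
    hX.exists_profile hc h.symm.left h.symm.right h.symm.left_pos h.symm.right_pos h.symm.le
  obtain ⟨hb, -⟩ := hX.exists_profile hc h.left h.right h.left_pos h.right_pos h.le
  have key := hH.integral_add_le' p1 p2
  have h3 := (le_two_mul_of_add_le_sqrt (integral_nonneg p1.nonneg) (integral_nonneg p2.nonneg) hδ
    (key.trans hle)).2
  have h4 := hH.setIntegral_le_level p1 p2 l
  have hS : {y | sliceVol A y / (⨆ x, sliceVol A x) ≤ l} =
      {y | sliceVol A y ≤ l * ⨆ x, sliceVol A x} := by
    ext y
    exact div_le_iff₀ hb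
  have hSm : MeasurableSet {y | sliceVol A y ≤ l * ⨆ x, sliceVol A x} :=
    measurableSet_le (measurable_sliceVol h.left.measurableSet) measurable_const
  have h5 := h4.trans (mul_le_mul_of_nonneg_left (hle.trans h3) (by positivity))
  rw [integral_div, integral_div, hS, setIntegral_sliceVol h.left.measurableSet
    h.left.measure_lt_top.ne hSm, integral_sliceVol h.left.measurableSet
    h.left.measure_lt_top.ne, ← mul_div_assoc, ← mul_div_assoc,
    div_le_div_iff_of_pos_right hb] at h5
  calc _ ≤ _ := h5
    _ = _ := by ring

end Slices

lemma NearBM.image {X Y : Type*} [AddCommGroup X] [TopologicalSpace X] [MeasureSpace X]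
    [AddCommGroup Y] [TopologicalSpace Y] [MeasureSpace Y] {c δ κ : ℝ} {A B : Set X}
    (h : NearBM c δ A B) (e : X ≃ₜ+ Y) (hκ : 0 < κ)
    (he : ∀ S : Set X, volume.real (e '' S) = κ * volume.real S) :
    NearBM c δ (e '' A) (e '' B) where
  left := h.left.image e.continuous
  right := h.right.image e.continuous
  left_pos := by rw [he]; exact mul_pos hκ h.left_pos
  right_pos := by rw [he]; exact mul_pos hκ h.right_pos
  le := by
    rw [← Set.image_add, he, he, he, mul_mul_mul_comm, Real.sqrt_mul (mul_self_nonneg κ),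
      Real.sqrt_mul_self hκ.le]
    calc κ * volume.real (A + B) ≤ κ * (c * (1 + δ) * √(volume.real A * volume.real B)) :=
          mul_le_mul_of_nonneg_left h.le hκ.le
      _ = _ := by ring

lemma volume_real_image_of_measurePreserving {X Y : Type*} [AddCommGroup X] [TopologicalSpace X]
    [MeasureSpace X] [BorelSpace X] [AddCommGroup Y] [TopologicalSpace Y] [MeasureSpace Y]
    [BorelSpace Y] (e : X ≃ₜ+ Y) (he : MeasurePreserving e) (S : Set X) :
    volume.real (e '' S) = volume.real S := by
  have h : MeasurePreserving e.toHomeomorph.toMeasurableEquiv := he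
  have := h.measure_preimage_equiv (e '' S)
  rw [measureReal_def, measureReal_def, ← this]
  congr 2
  exact (preimage_image_eq S e.injective)

section

variable {Z : Type*} [AddCommGroup Z] [TopologicalSpace Z] [IsTopologicalAddGroup Z] [T2Space Z]
  [SecondCountableTopology Z] [MeasureSpace Z] [BorelSpace Z] [SFinite (volume : Measure Z)]
  [IsFiniteMeasureOnCompacts (volume : Measure Z)]

/-- The shear `(y, x, z) ↦ (y - m x, x, z)`. -/
def shear (Z : Type*) [AddCommGroup Z] [TopologicalSpace Z] (m : ℝ) :
    ℝ × (ℝ × Z) ≃ₜ+ ℝ × (ℝ × Z) where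
  toFun p := (p.1 - m * p.2.1, p.2)
  invFun p := (p.1 + m * p.2.1, p.2)
  left_inv p := by simp
  right_inv p := by simp
  map_add' p q := by ext <;> simp; ring
  continuous_toFun := by fun_prop
  continuous_invFun := by fun_prop

/-- The swap `(y, x, z) ↦ (x, y, z)`. -/
def swapFst (Z : Type*) [AddCommGroup Z] [TopologicalSpace Z] :
    ℝ × (ℝ × Z) ≃ₜ+ ℝ × (ℝ × Z) where
  toFun p := (p.2.1, (p.1, p.2.2))
  invFun p := (p.2.1, (p.1, p.2.2))
  left_inv _ := rfl
  right_inv _ := rfl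
  map_add' _ _ := rfl
  continuous_toFun := by fun_prop
  continuous_invFun := by fun_prop

lemma shear_apply (m : ℝ) (p : ℝ × (ℝ × Z)) : shear Z m p = (p.1 - m * p.2.1, p.2) := rfl

lemma swapFst_apply (p : ℝ × (ℝ × Z)) : swapFst Z p = (p.2.1, (p.1, p.2.2)) := rfl

lemma mem_shear_image {m : ℝ} {D : Set (ℝ × (ℝ × Z))} {t : ℝ} {u : ℝ × Z} :
    (t, u) ∈ shear Z m '' D ↔ (t + m * u.1, u) ∈ D := by
  constructor
  · rintro ⟨p, hp, h⟩
    rw [shear_apply, Prod.mk.injEq] at h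
    obtain ⟨h1, rfl⟩ := h
    rw [← h1, sub_add_cancel]
    exact hp
  · intro h
    exact ⟨_, h, by rw [shear_apply]; simp⟩

lemma mem_swapFst_image {D : Set (ℝ × (ℝ × Z))} {x y : ℝ} {z : Z} :
    (x, (y, z)) ∈ swapFst Z '' D ↔ (y, (x, z)) ∈ D := by
  constructor
  · rintro ⟨p, hp, h⟩
    rw [swapFst_apply, Prod.mk.injEq, Prod.mk.injEq] at h
    obtain ⟨rfl, rfl, rfl⟩ := h
    exact hp
  · intro h
    exact ⟨_, h, rfl⟩

lemma measurePreserving_shear (m : ℝ) : MeasurePreserving (shear Z m) := by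
  have hm : Measurable (shear Z m) := (shear Z m).continuous.measurable
  refine ⟨hm, Measure.ext fun S hS => ?_⟩
  rw [Measure.map_apply hm hS, Measure.volume_eq_prod, Measure.prod_apply_symm hS,
    Measure.prod_apply_symm (hm hS)]
  congr 1
  ext u
  have : (fun x => (x, u)) ⁻¹' (shear Z m ⁻¹' S) =
      (fun x => x - m * u.1) ⁻¹' ((fun x => (x, u)) ⁻¹' S) := rfl
  rw [this]
  simp [sub_eq_add_neg]

lemma measurePreserving_swapFst : MeasurePreserving (swapFst Z) := by
  have h1 : MeasurePreserving (MeasurableEquiv.prodAssoc : (ℝ × ℝ) × Z ≃ᵐ ℝ × ℝ × Z) :=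
    volume_preserving_prodAssoc
  have h2 : MeasurePreserving (Prod.swap : ℝ × ℝ → ℝ × ℝ) := Measure.measurePreserving_swap
  exact h1.comp ((h2.prod (MeasurePreserving.id volume)).comp (h1.symm _))

lemma volume_real_shear (m : ℝ) (S : Set (ℝ × (ℝ × Z))) :
    volume.real (shear Z m '' S) = volume.real S :=
  volume_real_image_of_measurePreserving _ (measurePreserving_shear m) S

lemma volume_real_swapFst (S : Set (ℝ × (ℝ × Z))) :
    volume.real (swapFst Z '' S) = volume.real S :=
  volume_real_image_of_measurePreserving _ measurePreserving_swapFst S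

lemma NearBM.shear {c δ : ℝ} {A B : Set (ℝ × (ℝ × Z))} (h : NearBM c δ A B) (m : ℝ) :
    NearBM c δ (shear Z m '' A) (shear Z m '' B) :=
  h.image _ one_pos fun S => by rw [volume_real_shear, one_mul]

lemma NearBM.swapFst {c δ : ℝ} {A B : Set (ℝ × (ℝ × Z))} (h : NearBM c δ A B) :
    NearBM c δ (swapFst Z '' A) (swapFst Z '' B) :=
  h.image _ one_pos fun S => by rw [volume_real_swapFst, one_mul]

end

section

variable {Z : Type*} [AddCommGroup Z] [TopologicalSpace Z] [IsTopologicalAddGroup Z] [T2Space Z]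
  [SecondCountableTopology Z] [MeasureSpace Z] [BorelSpace Z] [SFinite (volume : Measure Z)]
  [IsFiniteMeasureOnCompacts (volume : Measure Z)]

lemma measurable_sliceVol_slice {E : Set (ℝ × (ℝ × Z))} (hE : MeasurableSet E) :
    Measurable fun q : ℝ × ℝ => sliceVol (Prod.mk q.1 ⁻¹' E) q.2 := by
  have h := (measurable_measure_prodMk_left (ν := (volume : Measure Z))
    ((MeasurableEquiv.prodAssoc : (ℝ × ℝ) × Z ≃ᵐ ℝ × ℝ × Z).measurable hE)).ennreal_toReal
  exact h

/-- The part of a set lying on fibres of small measure. -/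
def thinPart (E : Set (ℝ × (ℝ × Z))) (l : ℝ) : Set (ℝ × (ℝ × Z)) :=
  E ∩ {p | sliceVol (Prod.mk p.1 ⁻¹' E) p.2.1 < l}

lemma measurableSet_thinPart {E : Set (ℝ × (ℝ × Z))} (hE : MeasurableSet E) (l : ℝ) :
    MeasurableSet (thinPart E l) := by
  have h : Measurable fun p : ℝ × (ℝ × Z) => sliceVol (Prod.mk p.1 ⁻¹' E) p.2.1 :=
    (measurable_sliceVol_slice hE).comp
      (measurable_fst.prodMk (measurable_fst.comp measurable_snd))
  exact hE.inter (measurableSet_lt h measurable_const)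

/-- Pairs of points in a common slice that are far apart. -/
def farPairs (E : Set (ℝ × (ℝ × Z))) (r : ℝ) : Set (ℝ × ((ℝ × Z) × (ℝ × Z))) :=
  {p | (p.1, p.2.1) ∈ E ∧ (p.1, p.2.2) ∈ E ∧ r < |p.2.1.1 - p.2.2.1|}

lemma measurableSet_farPairs {E : Set (ℝ × (ℝ × Z))} (hE : MeasurableSet E) (r : ℝ) :
    MeasurableSet (farPairs E r) := by
  have h1 : Measurable fun p : ℝ × ((ℝ × Z) × (ℝ × Z)) => (p.1, p.2.1) := by fun_prop
  have h2 : Measurable fun p : ℝ × ((ℝ × Z) × (ℝ × Z)) => (p.1, p.2.2) := by fun_prop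
  have h3 : Measurable fun p : ℝ × ((ℝ × Z) × (ℝ × Z)) => |p.2.1.1 - p.2.2.1| := by fun_prop
  exact (h1 hE).inter ((h2 hE).inter (measurableSet_lt measurable_const h3))

lemma farPairs_subset {E : Set (ℝ × (ℝ × Z))} {r : ℝ} :
    farPairs E r ⊆ (Prod.fst '' E) ×ˢ ((Prod.snd '' E) ×ˢ (Prod.snd '' E)) :=
  fun _ hp => ⟨⟨_, hp.1, rfl⟩, ⟨_, hp.1, rfl⟩, ⟨_, hp.2.1, rfl⟩⟩

lemma volume_farPairs_ne_top {E : Set (ℝ × (ℝ × Z))} (hE : IsCompact E) (r : ℝ) :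
    volume (farPairs E r) ≠ ⊤ :=
  measure_ne_top_of_subset farPairs_subset
    ((hE.image continuous_fst).prod
      ((hE.image continuous_snd).prod (hE.image continuous_snd))).measure_ne_top

lemma sliceVol_farPairs_le {E : Set (ℝ × (ℝ × Z))} (hE : IsCompact E) (r t : ℝ) :
    sliceVol (farPairs E r) t ≤ sliceVol E t * sliceVol E t := by
  have hc := isCompact_slice hE t
  unfold sliceVol
  rw [measureReal_def, measureReal_def, ← ENNReal.toReal_mul, ← Measure.prod_prod]
  refine measureReal_mono (μ := volume) (s₂ := (Prod.mk t ⁻¹' E) ×ˢ (Prod.mk t ⁻¹' E)) ?_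
    (hc.prod hc).measure_ne_top
  exact fun p hp => ⟨hp.1, hp.2.1⟩

lemma sliceVol_farPairs_le_of_interval {E : Set (ℝ × (ℝ × Z))} (hE : IsCompact E) {r t d η l : ℝ}
    (hl : l ≤ r)
    (h : volume.real ((Prod.mk t ⁻¹' E) ∩ Prod.fst ⁻¹' (Icc d (d + l))ᶜ) ≤ η * sliceVol E t) :
    sliceVol (farPairs E r) t ≤ 2 * η * (sliceVol E t * sliceVol E t) := by
  have hc := isCompact_slice hE t
  set S := Prod.mk t ⁻¹' E with hS
  set R := S ∩ Prod.fst ⁻¹' (Icc d (d + l))ᶜ with hR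
  have hRt : volume R ≠ ⊤ := measure_ne_top_of_subset inter_subset_left hc.measure_ne_top
  have hsub : Prod.mk t ⁻¹' farPairs E r ⊆ R ×ˢ S ∪ S ×ˢ R := by
    rintro ⟨u, u'⟩ ⟨h1, h2, h3⟩
    simp only at h1 h2 h3
    by_cases hu : u.1 ∈ Icc d (d + l)
    · by_cases hu' : u'.1 ∈ Icc d (d + l)
      · exfalso
        have : |u.1 - u'.1| ≤ l := by
          rw [abs_le]; constructor <;> linarith [hu.1, hu.2, hu'.1, hu'.2]
        linarith
      · exact Or.inr ⟨h1, h2, hu'⟩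
    · exact Or.inl ⟨⟨h1, hu⟩, h2⟩
  have hp1 : volume.real (R ×ˢ S) = volume.real R * volume.real S := by
    rw [measureReal_def, Measure.volume_eq_prod, Measure.prod_prod, ENNReal.toReal_mul]; rfl
  have hp2 : volume.real (S ×ˢ R) = volume.real S * volume.real R := by
    rw [measureReal_def, Measure.volume_eq_prod, Measure.prod_prod, ENNReal.toReal_mul]; rfl
  have hSt : volume S ≠ ⊤ := hc.measure_ne_top
  have ht1 : volume (R ×ˢ S) ≠ ⊤ := by
    rw [Measure.volume_eq_prod, Measure.prod_prod]; exact ENNReal.mul_ne_top hRt hSt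
  have ht2 : volume (S ×ˢ R) ≠ ⊤ := by
    rw [Measure.volume_eq_prod, Measure.prod_prod]; exact ENNReal.mul_ne_top hSt hRt
  have h0 : (0 : ℝ) ≤ volume.real S := measureReal_nonneg
  have hes : sliceVol E t = volume.real S := rfl
  calc sliceVol (farPairs E r) t ≤ volume.real (R ×ˢ S ∪ S ×ˢ R) :=
        measureReal_mono hsub (by finiteness)
    _ ≤ volume.real (R ×ˢ S) + volume.real (S ×ˢ R) := measureReal_union_le _ _
    _ ≤ 2 * η * (sliceVol E t * sliceVol E t) := by
        rw [hp1, hp2]; rw [hes] at h ⊢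
        nlinarith [mul_le_mul_of_nonneg_right h h0]

/-- In a near-extremal set, few pairs in a common slice are far apart. -/
lemma NearBM.volume_farPairs_le {c δ η l r : ℝ} (hZ : BrunnMinkowski Z c) (hc : 0 < c)
    {E E' : Set (ℝ × (ℝ × Z))} (h : NearBM (2 * (2 * c)) δ E E') (hη : 0 < η) (hη1 : η ≤ 1)
    (hδ0 : 0 ≤ δ) (hδ : δ ≤ η ^ 3 / 19200) (hl : 0 < l)
    (hthin : volume.real (thinPart E l) ≤ 3 * η * volume.real E)
    (hr : 2400 / η ^ 2 * ((⨆ t, sliceVol E t) / l) ≤ r) :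
    volume.real (farPairs E r) ≤ 6 * η * (⨆ t, sliceVol E t) * volume.real E := by
  have hX := hZ.prod hc
  set a := ⨆ t, sliceVol E t with ha
  have hsa : ∀ t, sliceVol E t ≤ a := fun t => le_ciSup (bddAbove_range_sliceVol h.left) t
  have ha0 : 0 ≤ a := (sliceVol_nonneg E 0).trans (hsa 0)
  have hEm := h.left.measurableSet
  have hEt : volume E ≠ ⊤ := h.left.measure_ne_top
  set q := sliceVol (farPairs E r) with hq
  set T := thinPart E l with hT
  have hTm : MeasurableSet T := measurableSet_thinPart hEm l
  have hTE : T ⊆ E := inter_subset_left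
  have hTt : volume T ≠ ⊤ := measure_ne_top_of_subset hTE hEt
  set N : Set ℝ := {t | 2 * η * (sliceVol E t * sliceVol E t) < q t ∧
    sliceVol T t ≠ sliceVol E t} with hN
  have hqm : Measurable q := measurable_sliceVol (measurableSet_farPairs hEm r)
  have hsm := measurable_sliceVol hEm
  have hNm : MeasurableSet N :=
    (measurableSet_lt (measurable_const.mul (hsm.mul hsm)) hqm).inter
      (measurableSet_eq_fun (measurable_sliceVol hTm) hsm).compl
  set δ₁ := η ^ 2 / 12800 with hδ₁
  have hδ₁0 : 0 < δ₁ := by positivity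
  have hgain : ∀ t ∈ N, ∀ s, 2 * c * √((1 + (2 * δ₁ + δ₁ ^ 2)) * sliceVol E t * sliceVol E' s) ≤
      sliceVol (E + E') (t + s) := by
    rintro t ⟨ht1, ht2⟩ s
    by_contra! hlt
    have hE's := isCompact_slice h.right s
    have hEs := isCompact_slice h.left t
    have hpos : 0 < sliceVol E t := by
      refine lt_of_le_of_ne (sliceVol_nonneg _ _) fun h0 => ?_
      have := sliceVol_farPairs_le h.left r t
      rw [← h0] at this ht1
      linarith
    have hpos' : 0 < sliceVol E' s := by
      refine lt_of_le_of_ne (sliceVol_nonneg _ _) fun h0 => ?_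
      rw [← h0, mul_zero, Real.sqrt_zero, mul_zero] at hlt
      exact absurd (sliceVol_nonneg (E + E') (t + s)) (not_le.mpr hlt)
    have hnear : NearBM (2 * c) δ₁ (Prod.mk t ⁻¹' E) (Prod.mk s ⁻¹' E') := by
      refine ⟨hEs, hE's, hpos, hpos', ?_⟩
      have h1 : volume.real (Prod.mk t ⁻¹' E + Prod.mk s ⁻¹' E') ≤ sliceVol (E + E') (t + s) :=
        measureReal_mono (slice_add_subset E E' t s)
          (isCompact_slice (h.left.add h.right) _).measure_ne_top
      refine h1.trans (hlt.le.trans (le_of_eq ?_))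
      rw [show 1 + (2 * δ₁ + δ₁ ^ 2) = (1 + δ₁) * (1 + δ₁) by ring, mul_assoc (_ * _),
        Real.sqrt_mul (mul_self_nonneg _), Real.sqrt_mul_self (by positivity), ← mul_assoc]
      rfl
    obtain ⟨d, hd⟩ := hnear.exists_interval hZ hc hη hη1 le_rfl
    have hx : ∃ x, l ≤ sliceVol (Prod.mk t ⁻¹' E) x := by
      by_contra! hx
      apply ht2
      have : Prod.mk t ⁻¹' T = Prod.mk t ⁻¹' E :=
        Set.ext fun u => ⟨fun hu => hu.1, fun hu => ⟨hu, hx u.1⟩⟩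
      rw [sliceVol, sliceVol, this]
    obtain ⟨x, hx⟩ := hx
    have hext : extent (Prod.mk t ⁻¹' E) ≤ a / l := by
      refine div_le_div₀ ha0 (hsa t) hl ?_
      exact hx.trans (le_ciSup (bddAbove_range_sliceVol hEs) x)
    have hlen : 2400 / η ^ 2 * extent (Prod.mk t ⁻¹' E) ≤ r :=
      (mul_le_mul_of_nonneg_left hext (by positivity)).trans hr
    exact absurd (sliceVol_farPairs_le_of_interval h.left hlen hd) (not_le.mpr ht1)
  have hmass : volume.real (E ∩ Prod.fst ⁻¹' N) ≤ η * volume.real E := by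
    have h1 := hX.mul_volume_gain_le (by positivity) (κ := 2 * δ₁ + δ₁ ^ 2) (by positivity)
      (by linarith) h.left h.right h.right_pos h.le hNm hgain
    have hδ1 : δ ≤ 1 := by
      have : η ^ 3 ≤ 1 := pow_le_one₀ hη.le hη1
      linarith
    have h2 : 2 * δ + δ ^ 2 ≤ (2 * δ₁ + δ₁ ^ 2) * η := by
      have : δ ^ 2 ≤ δ := by nlinarith
      have h3 : 2 * δ₁ * η = 3 * (η ^ 3 / 19200) := by rw [hδ₁]; ring
      nlinarith [mul_pos (pow_pos hδ₁0 2) hη]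
    have h3 : (0 : ℝ) < 2 * δ₁ + δ₁ ^ 2 := by positivity
    have h4 := h1.trans (mul_le_mul_of_nonneg_right h2 h.left_pos.le)
    rw [mul_assoc] at h4
    exact le_of_mul_le_mul_left h4 h3
  have hpt : ∀ t, q t ≤ 2 * η * a * sliceVol E t + a * sliceVol (E ∩ Prod.fst ⁻¹' N) t +
      a * sliceVol T t := by
    intro t
    have hs0 := sliceVol_nonneg E t
    have hss : sliceVol E t * sliceVol E t ≤ a * sliceVol E t :=
      mul_le_mul_of_nonneg_right (hsa t) hs0
    have hT0 := sliceVol_nonneg T t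
    have hN0 := sliceVol_nonneg (E ∩ Prod.fst ⁻¹' N) t
    have hA0 : 0 ≤ 2 * η * a * sliceVol E t := by positivity
    have hA1 := mul_nonneg ha0 hT0
    have hA2 := mul_nonneg ha0 hN0
    have hq2 := sliceVol_farPairs_le h.left r t
    by_cases h1 : 2 * η * (sliceVol E t * sliceVol E t) < q t
    · by_cases h2 : sliceVol T t = sliceVol E t
      · rw [h2]
        change q t ≤ _ at hq2
        linarith
      · have htN : t ∈ N := ⟨h1, h2⟩
        have : Prod.mk t ⁻¹' (E ∩ Prod.fst ⁻¹' N) = Prod.mk t ⁻¹' E := by ext; simp [htN]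
        have h3 : sliceVol (E ∩ Prod.fst ⁻¹' N) t = sliceVol E t := by rw [sliceVol, this]; rfl
        rw [h3]
        change q t ≤ _ at hq2
        linarith
    · push Not at h1
      nlinarith
  have hWm := measurableSet_farPairs hEm r
  have hENm : MeasurableSet (E ∩ Prod.fst ⁻¹' N) := hEm.inter (measurable_fst hNm)
  have hENt : volume (E ∩ Prod.fst ⁻¹' N) ≠ ⊤ := measure_ne_top_of_subset inter_subset_left hEt
  have hi1 := (integrable_sliceVol hEm hEt).const_mul (2 * η * a)
  have hi2 := (integrable_sliceVol hENm hENt).const_mul a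
  have hi3 := (integrable_sliceVol hTm hTt).const_mul a
  have hint := integral_mono
    (integrable_sliceVol hWm (volume_farPairs_ne_top h.left r)) ((hi1.add hi2).add hi3) hpt
  rw [integral_sliceVol hWm (volume_farPairs_ne_top h.left r)] at hint
  simp only [Pi.add_apply] at hint
  rw [integral_add (by exact hi1.add hi2) hi3, integral_add hi1 hi2, integral_const_mul,
    integral_const_mul, integral_const_mul, integral_sliceVol hEm hEt, integral_sliceVol hENm hENt,
    integral_sliceVol hTm hTt] at hint
  nlinarith [mul_le_mul_of_nonneg_left hmass ha0, mul_le_mul_of_nonneg_left hthin ha0]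

end

lemma volume_prod_le_linear_preimage {S T : Set ℝ} {x x' L : ℝ} (hx : x ≠ x')
    (hL : |x - x'| ≤ L) :
    volume S * volume T ≤ ENNReal.ofReal L *
      volume {p : ℝ × ℝ | p.2 + p.1 * x ∈ S ∧ p.2 + p.1 * x' ∈ T} := by
  set f := Matrix.toLin (Module.Basis.finTwoProd ℝ) (Module.Basis.finTwoProd ℝ) !![x, 1; x', 1]
    with hf
  have hdet : LinearMap.det f = x - x' := by
    rw [hf, LinearMap.det_toLin, Matrix.det_fin_two_of]; ring
  have hne : LinearMap.det f ≠ 0 := by rw [hdet]; exact sub_ne_zero.mpr hx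
  have hpre : f ⁻¹' (S ×ˢ T) = {p : ℝ × ℝ | p.2 + p.1 * x ∈ S ∧ p.2 + p.1 * x' ∈ T} := by
    ext p
    rw [mem_preimage, hf, Matrix.toLin_finTwoProd_apply, mem_prod]
    simp only [one_mul, mem_ofPred_eq]
    rw [show x * p.1 + p.2 = p.2 + p.1 * x by ring, show x' * p.1 + p.2 = p.2 + p.1 * x' by ring]
  rw [← hpre, Measure.addHaar_preimage_linearMap _ hne, hdet, ← mul_assoc,
    ← ENNReal.ofReal_mul ((abs_nonneg _).trans hL), Measure.volume_eq_prod, Measure.prod_prod]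
  refine le_mul_of_one_le_left (zero_le) ?_
  rw [ENNReal.one_le_ofReal, abs_inv]
  rw [← div_eq_mul_inv]
  exact (one_le_div₀ (abs_pos.mpr (sub_ne_zero.mpr hx))).mpr hL

section

variable {Z : Type*} [AddCommGroup Z] [TopologicalSpace Z] [IsTopologicalAddGroup Z] [T2Space Z]
  [SecondCountableTopology Z] [MeasureSpace Z] [BorelSpace Z] [SFinite (volume : Measure Z)]
  [IsFiniteMeasureOnCompacts (volume : Measure Z)]

/-- Triples consisting of a line and two points of `D` above it that are far apart. -/
def lineTriples (D : Set (ℝ × (ℝ × Z))) (M r : ℝ) : Set ((ℝ × ℝ) × ((ℝ × Z) × (ℝ × Z))) :=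
  {p | |p.1.1| ≤ M ∧ (p.1.2 + p.1.1 * p.2.1.1, p.2.1) ∈ D ∧
    (p.1.2 + p.1.1 * p.2.2.1, p.2.2) ∈ D ∧ r < |p.2.1.1 - p.2.2.1|}

lemma measurableSet_lineTriples {D : Set (ℝ × (ℝ × Z))} (hD : MeasurableSet D) (M r : ℝ) :
    MeasurableSet (lineTriples D M r) := by
  have h0 : Measurable fun p : (ℝ × ℝ) × ((ℝ × Z) × (ℝ × Z)) => |p.1.1| := by fun_prop
  have h1 : Measurable fun p : (ℝ × ℝ) × ((ℝ × Z) × (ℝ × Z)) =>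
    (p.1.2 + p.1.1 * p.2.1.1, p.2.1) := by fun_prop
  have h2 : Measurable fun p : (ℝ × ℝ) × ((ℝ × Z) × (ℝ × Z)) =>
    (p.1.2 + p.1.1 * p.2.2.1, p.2.2) := by fun_prop
  have h3 : Measurable fun p : (ℝ × ℝ) × ((ℝ × Z) × (ℝ × Z)) => |p.2.1.1 - p.2.2.1| := by fun_prop
  exact (measurableSet_le h0 measurable_const).inter
    ((h1 hD).inter ((h2 hD).inter (measurableSet_lt measurable_const h3)))

lemma volume_lineTriples_le {D : Set (ℝ × (ℝ × Z))} (hD : IsCompact D) {M r : ℝ} {w : ENNReal}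
    (hw : ∀ m, volume (farPairs (shear Z m '' D) r) ≤ w) :
    volume (lineTriples D M r) ≤ w * ENNReal.ofReal (2 * M) := by
  have hm := measurableSet_lineTriples hD.measurableSet M r
  rw [Measure.volume_eq_prod, Measure.prod_apply hm, Measure.volume_eq_prod,
    lintegral_prod _ (measurable_measure_prodMk_left hm).aemeasurable]
  calc _ ≤ ∫⁻ m, (Icc (-M) M).indicator (fun _ => w) m := by
        refine lintegral_mono fun m => ?_
        by_cases h : m ∈ Icc (-M) M
        · rw [indicator_of_mem h]
          refine le_trans ?_ (hw m)
          have hm' : MeasurableSet (farPairs (shear Z m '' D) r) := measurableSet_farPairs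
            (hD.image (shear Z m).continuous).measurableSet r
          refine le_trans ?_ (Measure.prod_apply (μ := volume) (ν := volume) hm').ge
          refine lintegral_mono fun t => measure_mono ?_
          rintro u ⟨-, h1, h2, h3⟩
          exact ⟨mem_shear_image.mpr h1, mem_shear_image.mpr h2, h3⟩
        · rw [indicator_of_notMem h]
          refine le_of_eq ?_
          have : ∀ t : ℝ, Prod.mk (m, t) ⁻¹' lineTriples D M r = ∅ := by
            intro t
            refine eq_empty_of_forall_notMem ?_
            rintro u ⟨h1, -⟩
            exact h (abs_le.mp h1)
          simp [this]
    _ = w * ENNReal.ofReal (2 * M) := by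
        rw [lintegral_indicator_const measurableSet_Icc, Real.volume_Icc]
        congr 2; ring

/-- If all shears of `D` have few far pairs, then a bounded part of `D` is small, up to the
contribution of close pairs. -/
lemma sq_volume_le_of_farPairs {D D₀ : Set (ℝ × (ℝ × Z))} (hD : IsCompact D)
    (hD₀ : MeasurableSet D₀) (hsub : D₀ ⊆ D) {L L' M r r₀ : ℝ} (hr : r ≤ r₀) (hr₀ : 0 < r₀)
    (hM : L' ≤ M * r₀)
    (hL : ∀ p ∈ D₀, ∀ p' ∈ D₀, |p.2.1 - p'.2.1| ≤ L) (hL' : ∀ p ∈ D₀, ∀ p' ∈ D₀, |p.1 - p'.1| ≤ L')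
    {μ w : ENNReal} (hμ : ∀ x, volume (D ∩ {p | |x - p.2.1| ≤ r₀}) ≤ μ)
    (hw : ∀ m, volume (farPairs (shear Z m '' D) r) ≤ w) :
    volume D₀ * volume D₀ ≤
      ENNReal.ofReal L * (w * ENNReal.ofReal (2 * M)) + volume D * μ := by
  have hDm := hD.measurableSet
  have hKm := measurableSet_lineTriples hDm M r
  set f : ℝ × Z → ENNReal := fun u => volume ((fun y => (y, u)) ⁻¹' D₀) with hf
  set F : ℝ × Z → ENNReal := fun u => volume ((fun y => (y, u)) ⁻¹' D) with hF
  set K : (ℝ × Z) × (ℝ × Z) → ENNReal := fun p => volume ((fun y => (y, p)) ⁻¹' lineTriples D M r)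
    with hK
  have hfm : Measurable f := measurable_measure_prodMk_right hD₀
  have hFm : Measurable F := measurable_measure_prodMk_right hDm
  have hKm' : Measurable K := measurable_measure_prodMk_right hKm
  set R : Set ((ℝ × Z) × (ℝ × Z)) := {p | |p.1.1 - p.2.1| ≤ r₀} with hR
  have hRm : MeasurableSet R := by
    have h3 : Measurable fun p : (ℝ × Z) × (ℝ × Z) => |p.1.1 - p.2.1| := by fun_prop
    exact measurableSet_le h3 measurable_const
  have hfF : ∀ u, f u ≤ F u := fun u => measure_mono (preimage_mono hsub)
  have hpt : ∀ p : (ℝ × Z) × (ℝ × Z),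
      f p.1 * f p.2 ≤ ENNReal.ofReal L * K p + R.indicator (fun p => F p.1 * F p.2) p := by
    rintro ⟨u, u'⟩
    by_cases hp : (u, u') ∈ R
    · rw [indicator_of_mem hp]
      exact (mul_le_mul' (hfF u) (hfF u')).trans (le_add_of_nonneg_left (zero_le))
    · rw [indicator_of_notMem hp, add_zero]
      by_cases h0 : f u = 0
      · rw [h0, zero_mul]; exact zero_le
      by_cases h0' : f u' = 0
      · rw [h0', mul_zero]; exact zero_le
      have hp' : r₀ < |u.1 - u'.1| := not_le.mp hp
      obtain ⟨y, hy⟩ := nonempty_of_measure_ne_zero h0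
      obtain ⟨y', hy'⟩ := nonempty_of_measure_ne_zero h0'
      have hne : u.1 ≠ u'.1 := fun h => by
        rw [h, sub_self, abs_zero] at hp'; linarith
      refine (volume_prod_le_linear_preimage hne (hL _ hy _ hy')).trans ?_
      refine mul_le_mul' le_rfl (measure_mono ?_)
      rintro ⟨m, t⟩ ⟨h1, h2⟩
      refine ⟨?_, hsub h1, hsub h2, hr.trans_lt hp'⟩
      have h3 := hL' _ h1 _ h2
      simp only at h3
      rw [show t + m * u.1 - (t + m * u'.1) = m * (u.1 - u'.1) by ring, abs_mul] at h3
      by_contra! h4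
      simp only at h4
      have h5 : 0 ≤ L' := (mul_nonneg (abs_nonneg _) (abs_nonneg _)).trans h3
      have h6 : 0 < |m| := by
        rcases (abs_nonneg m).lt_or_eq with h | h
        · exact h
        · rw [← h] at h4; nlinarith
      nlinarith
  have hvD₀ : volume D₀ = ∫⁻ u, f u := by
    rw [Measure.volume_eq_prod, Measure.prod_apply_symm hD₀]
  have hvD : volume D = ∫⁻ u, F u := by
    rw [Measure.volume_eq_prod, Measure.prod_apply_symm hDm]
  have hvK : volume (lineTriples D M r) = ∫⁻ p, K p := by
    rw [Measure.volume_eq_prod, Measure.prod_apply_symm hKm]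
  have hvR : ∫⁻ p, R.indicator (fun p => F p.1 * F p.2) p ≤ volume D * μ := by
    have hm : Measurable fun p : (ℝ × Z) × (ℝ × Z) => F p.1 * F p.2 :=
      (hFm.comp measurable_fst).mul (hFm.comp measurable_snd)
    rw [Measure.volume_eq_prod, lintegral_prod _ (hm.indicator hRm).aemeasurable, hvD,
      ← lintegral_mul_const _ hFm]
    refine lintegral_mono fun u => ?_
    set S : Set (ℝ × (ℝ × Z)) := D ∩ {p | |u.1 - p.2.1| ≤ r₀} with hS
    have hSm : MeasurableSet S := by
      have h3 : Measurable fun p : ℝ × (ℝ × Z) => |u.1 - p.2.1| := by fun_prop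
      exact hDm.inter (measurableSet_le h3 measurable_const)
    refine le_trans ?_ (mul_le_mul' le_rfl (hμ u.1))
    rw [show volume S = _ from Measure.prod_apply_symm (μ := volume) (ν := volume) hSm,
      ← lintegral_const_mul _ (measurable_measure_prodMk_right hSm)]
    refine lintegral_mono fun u' => ?_
    simp only
    by_cases hp : (u, u') ∈ R
    · rw [indicator_of_mem hp]
      refine mul_le_mul' le_rfl (measure_mono fun y hy => ⟨hy, hp⟩)
    · rw [indicator_of_notMem hp]; exact zero_le
  calc volume D₀ * volume D₀ = ∫⁻ p : (ℝ × Z) × (ℝ × Z), f p.1 * f p.2 := by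
        rw [Measure.volume_eq_prod (ℝ × Z) (ℝ × Z),
          lintegral_prod_mul hfm.aemeasurable hfm.aemeasurable, ← hvD₀]
    _ ≤ ∫⁻ p, (ENNReal.ofReal L * K p + R.indicator (fun p => F p.1 * F p.2) p) :=
        lintegral_mono hpt
    _ = ENNReal.ofReal L * volume (lineTriples D M r) +
        ∫⁻ p, R.indicator (fun p => F p.1 * F p.2) p := by
        rw [lintegral_add_left (hKm'.const_mul _), lintegral_const_mul _ hKm', hvK]
    _ ≤ _ := add_le_add (mul_le_mul' le_rfl (volume_lineTriples_le hD hw)) hvR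

end

section

variable {X : Type*} [AddCommGroup X] [TopologicalSpace X] [IsTopologicalAddGroup X] [T2Space X]
  [SecondCountableTopology X] [MeasureSpace X] [BorelSpace X] [SFinite (volume : Measure X)]
  [IsFiniteMeasureOnCompacts (volume : Measure X)]

lemma volume_le_mul_of_slice_le {T : Set (ℝ × X)} (hT : MeasurableSet T) {S : Set ℝ}
    (hS : MeasurableSet S) (hTS : T ⊆ Prod.fst ⁻¹' S) {b : ENNReal}
    (hb : ∀ x ∈ S, volume (Prod.mk x ⁻¹' T) ≤ b) : volume T ≤ b * volume S := by
  rw [Measure.volume_eq_prod, Measure.prod_apply hT, ← lintegral_indicator_const hS]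
  refine lintegral_mono fun x => ?_
  by_cases hx : x ∈ S
  · rw [indicator_of_mem hx]; exact hb x hx
  · have : Prod.mk x ⁻¹' T = ∅ := eq_empty_of_forall_notMem fun z hz => hx (hTS hz)
    simp [this]

end

section

variable {Z : Type*} [AddCommGroup Z] [TopologicalSpace Z] [IsTopologicalAddGroup Z] [T2Space Z]
  [SecondCountableTopology Z] [MeasureSpace Z] [BorelSpace Z] [SFinite (volume : Measure Z)]
  [IsFiniteMeasureOnCompacts (volume : Measure Z)]

lemma thinPart_shear (D : Set (ℝ × (ℝ × Z))) (m l : ℝ) :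
    thinPart (shear Z m '' D) l = shear Z m '' thinPart D l := by
  ext ⟨t, x, z⟩
  rw [mem_shear_image]
  have h : Prod.mk x ⁻¹' (Prod.mk t ⁻¹' (shear Z m '' D)) =
      Prod.mk x ⁻¹' (Prod.mk (t + m * x) ⁻¹' D) := by
    ext w
    exact mem_shear_image
  simp only [thinPart, mem_inter_iff, mem_shear_image, mem_ofPred_eq, sliceVol, h]

lemma volume_thinPart_inter_le {D : Set (ℝ × (ℝ × Z))} (hD : IsCompact D) {S : Set ℝ}
    (hS : MeasurableSet S) {l ε : ℝ}
    (hε : ∀ x ∈ S, volume (Prod.fst '' (Prod.mk x ⁻¹' (swapFst Z '' D))) ≤ ENNReal.ofReal ε) :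
    volume (thinPart D l ∩ {p | p.2.1 ∈ S}) ≤
      ENNReal.ofReal l * ENNReal.ofReal ε * volume S := by
  set T := thinPart D l ∩ {p | p.2.1 ∈ S} with hT
  have hTm : MeasurableSet T := by
    refine (measurableSet_thinPart hD.measurableSet l).inter ?_
    exact (measurable_fst.comp measurable_snd) hS
  have hpre : MeasurableSet (swapFst Z ⁻¹' T) := (swapFst Z).continuous.measurable hTm
  rw [← measurePreserving_swapFst.measure_preimage hTm.nullMeasurableSet]
  refine volume_le_mul_of_slice_le hpre hS (fun p hp => hp.2) fun x hx => ?_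
  refine le_trans ?_ (mul_le_mul' le_rfl (hε x hx))
  have hA : IsCompact (swapFst Z '' D) := hD.image (swapFst Z).continuous
  refine volume_le_mul_of_slice_le (measurable_prodMk_left hpre)
    ((isCompact_slice hA x).image continuous_fst).measurableSet ?_ ?_
  · rintro ⟨y, z⟩ hp
    exact ⟨(y, z), mem_swapFst_image.mpr hp.1.1, rfl⟩
  · rintro y -
    by_cases hy : sliceVol (Prod.mk y ⁻¹' D) x < l
    · calc volume (Prod.mk y ⁻¹' (Prod.mk x ⁻¹' (swapFst Z ⁻¹' T)))
          ≤ volume (Prod.mk x ⁻¹' (Prod.mk y ⁻¹' D)) := measure_mono fun z hz => hz.1.1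
        _ = ENNReal.ofReal (sliceVol (Prod.mk y ⁻¹' D) x) :=
            (ofReal_measureReal (isCompact_slice (isCompact_slice hD y) x).measure_ne_top).symm
        _ ≤ ENNReal.ofReal l := ENNReal.ofReal_le_ofReal hy.le
    · have : Prod.mk y ⁻¹' (Prod.mk x ⁻¹' (swapFst Z ⁻¹' T)) = ∅ :=
        eq_empty_of_forall_notMem fun z hz => hy hz.1.2
      simp [this]

lemma volume_strip_le {D : Set (ℝ × (ℝ × Z))} (hD : IsCompact D) (x r : ℝ) :
    volume (D ∩ {p | |x - p.2.1| ≤ r}) ≤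
      ENNReal.ofReal (⨆ t, sliceVol (swapFst Z '' D) t) * ENNReal.ofReal (2 * r) := by
  set T := D ∩ {p | |x - p.2.1| ≤ r} with hT
  have hTm : MeasurableSet T := by
    have h3 : Measurable fun p : ℝ × (ℝ × Z) => |x - p.2.1| := by fun_prop
    exact hD.measurableSet.inter (measurableSet_le h3 measurable_const)
  have hpre : MeasurableSet (swapFst Z ⁻¹' T) := (swapFst Z).continuous.measurable hTm
  rw [← measurePreserving_swapFst.measure_preimage hTm.nullMeasurableSet,
    show 2 * r = (x + r) - (x - r) by ring, ← Real.volume_Icc]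
  have hA : IsCompact (swapFst Z '' D) := hD.image (swapFst Z).continuous
  refine volume_le_mul_of_slice_le hpre measurableSet_Icc (fun p hp => ?_) fun y _ => ?_
  · have h1 : |x - p.1| ≤ r := hp.2
    rw [abs_le] at h1
    exact ⟨by linarith, by linarith⟩
  · calc volume (Prod.mk y ⁻¹' (swapFst Z ⁻¹' T))
        ≤ volume (Prod.mk y ⁻¹' (swapFst Z '' D)) :=
          measure_mono fun z hz => mem_swapFst_image.mpr hz.1
      _ = ENNReal.ofReal (sliceVol (swapFst Z '' D) y) :=
          (ofReal_measureReal (isCompact_slice hA y).measure_ne_top).symm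
      _ ≤ _ := ENNReal.ofReal_le_ofReal (le_ciSup (bddAbove_range_sliceVol hA) y)

/-- A near-extremal set whose slices in a second direction have bounded shadows has bounded extent,
provided shearing does not increase its largest slice much. -/
lemma extent_le_of_shadow {c δ η ε : ℝ} (hZ : BrunnMinkowski Z c) (hc : 0 < c)
    {D G : Set (ℝ × (ℝ × Z))} (h : NearBM (2 * (2 * c)) δ D G) (hη : 0 < η)
    (hη' : 240 * 960000 ^ 2 * η ≤ 1 / 2) (hδ0 : 0 ≤ δ) (hδ : δ ≤ η ^ 3 / 19200) (hε : 0 < ε)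
    {S : Set ℝ} (hS : MeasurableSet S)
    (hmass : volume.real (D ∩ {p | p.2.1 ∉ S}) ≤ η * volume.real D)
    (hshadow : ∀ x ∈ S,
      volume (Prod.fst '' (Prod.mk x ⁻¹' (swapFst Z '' D))) ≤ ENNReal.ofReal ε)
    (hshear : ∀ m, ⨆ t, sliceVol (shear Z m '' D) t ≤ 2 * ⨆ t, sliceVol D t) :
    extent D ≤ 20 * (2400 / η ^ 2) ^ 2 / η * ε := by
  by_contra! hcon
  have hX := hZ.prod hc
  have h2c : 0 < 2 * c := by positivity
  have hη1 : η ≤ 1 / 10 ^ 14 := by norm_num at hη' ⊢; linarith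
  have hδ1 : δ ≤ η ^ 2 / 12800 := by
    have : η ^ 3 ≤ η ^ 2 := pow_le_pow_of_le_one hη.le (by linarith) (by norm_num)
    have := sq_nonneg η
    linarith
  have hδ2 : δ ≤ (1 / 20) ^ 2 / 12800 := by
    have : η ^ 2 ≤ (1 / 20) ^ 2 := pow_le_pow_left₀ hη.le (by linarith) 2
    linarith
  have hDpos := h.left_pos
  have hDt : volume D ≠ ⊤ := h.left.measure_ne_top
  have hDm := h.left.measurableSet
  have hA := h.swapFst
  obtain ⟨d₁, hd₁⟩ := hA.exists_interval hX h2c hη (by linarith) hδ1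
  obtain ⟨d₂, hd₂⟩ := hA.exists_interval hX h2c (by norm_num : (0 : ℝ) < 1 / 20) (by norm_num) hδ2
  obtain ⟨d₃, hd₃⟩ := h.exists_interval hX h2c (by norm_num : (0 : ℝ) < 1 / 20) (by norm_num) hδ2
  have hfx0 : 0 < extent (swapFst Z '' D) := hA.extent_pos hX h2c
  have hf0 : 0 < extent D := h.extent_pos hX h2c
  have hax : (⨆ t, sliceVol (swapFst Z '' D) t) = volume.real D / extent (swapFst Z '' D) := by
    rw [extent, volume_real_swapFst, div_div_cancel₀ hDpos.ne']
  have ha0 : (⨆ t, sliceVol D t) = volume.real D / extent D := by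
    rw [extent, div_div_cancel₀ hDpos.ne']
  rw [volume_real_swapFst] at hd₁ hd₂
  set fx := extent (swapFst Z '' D) with hfx
  set f0 := extent D with hf0'
  set V := volume.real D with hV
  have hswap : ∀ I : Set ℝ, volume.real (D ∩ {p | p.2.1 ∉ I}) =
      volume.real (swapFst Z '' D ∩ Prod.fst ⁻¹' Iᶜ) := by
    intro I
    rw [← volume_real_swapFst]
    congr 1
    ext ⟨x, y, z⟩
    rw [mem_swapFst_image, mem_inter_iff, mem_inter_iff, mem_swapFst_image]
    rfl
  rw [← hswap] at hd₁ hd₂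
  set Cη := 2400 / η ^ 2 with hCη
  have hCη0 : 0 < Cη := by positivity
  set l := η * V / (ε * (Cη * fx)) with hl
  have hl0 : 0 < l := by positivity
  set I₁ := Icc d₁ (d₁ + Cη * fx) with hI₁
  have hthin : volume.real (thinPart D l) ≤ 3 * η * V := by
    have hsub : thinPart D l ⊆ (D ∩ {p | p.2.1 ∉ S}) ∪ (D ∩ {p | p.2.1 ∉ I₁}) ∪
        (thinPart D l ∩ {p | p.2.1 ∈ S ∩ I₁}) := by
      intro p hp
      by_cases h1 : p.2.1 ∈ S
      · by_cases h2 : p.2.1 ∈ I₁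
        · exact Or.inr ⟨hp, h1, h2⟩
        · exact Or.inl (Or.inr ⟨hp.1, h2⟩)
      · exact Or.inl (Or.inl ⟨hp.1, h1⟩)
    have h3 : volume.real (thinPart D l ∩ {p | p.2.1 ∈ S ∩ I₁}) ≤ η * V := by
      have h4 := volume_thinPart_inter_le h.left (l := l) (hS.inter measurableSet_Icc)
        (fun x hx => hshadow x hx.1) (S := S ∩ I₁)
      have h5 : volume (S ∩ I₁) ≤ ENNReal.ofReal (Cη * fx) := by
        refine (measure_mono inter_subset_right).trans ?_
        rw [hI₁, Real.volume_Icc, add_sub_cancel_left]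
      have h6 := h4.trans (mul_le_mul' le_rfl h5)
      rw [← ENNReal.ofReal_mul hl0.le, ← ENNReal.ofReal_mul (by positivity)] at h6
      refine (ENNReal.toReal_le_of_le_ofReal (by positivity) h6).trans (le_of_eq ?_)
      rw [hl]; field_simp
    have hfin : ∀ T : Set (ℝ × (ℝ × Z)), volume (D ∩ T) ≠ ⊤ := fun T =>
      measure_ne_top_of_subset inter_subset_left hDt
    have hfin' : volume (thinPart D l ∩ {p | p.2.1 ∈ S ∩ I₁}) ≠ ⊤ :=
      measure_ne_top_of_subset (inter_subset_left.trans inter_subset_left) hDt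
    have h7 := (measureReal_mono hsub (measure_union_ne_top
      (measure_union_ne_top (hfin _) (hfin _)) hfin')).trans
      ((measureReal_union_le _ _).trans (add_le_add_left (measureReal_union_le _ _) _))
    linarith
  set r := Cη * (2 * (V / f0) / l) with hr
  set r₀ := fx / 10 with hr₀
  have hrr₀ : r ≤ r₀ := by
    have : r = (20 * Cη ^ 2 / η * ε) * (fx / (10 * f0)) := by
      rw [hr, hl]; field_simp; norm_num
    rw [this]
    calc _ ≤ f0 * (fx / (10 * f0)) := mul_le_mul_of_nonneg_right hcon.le (by positivity)
      _ = r₀ := by rw [hr₀]; field_simp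
  have hw : ∀ m, volume (farPairs (shear Z m '' D) r) ≤ ENNReal.ofReal (12 * η * (V / f0) * V) := by
    intro m
    have hm := h.shear m
    have h1 := hm.volume_farPairs_le hZ hc hη (by linarith) hδ0 hδ hl0 (r := r) (by
        rw [thinPart_shear, volume_real_shear, volume_real_shear]; exact hthin) (by
        refine mul_le_mul_of_nonneg_left (div_le_div_of_nonneg_right ?_ hl0.le) hCη0.le
        rw [← ha0]; exact hshear m)
    rw [volume_real_shear] at h1
    rw [← ofReal_measureReal (volume_farPairs_ne_top hm.left r)]
    refine ENNReal.ofReal_le_ofReal (h1.trans ?_)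
    have h2 := hshear m
    rw [ha0] at h2
    have : 6 * η * V * ⨆ t, sliceVol (⇑(shear Z m) '' D) t ≤ 6 * η * V * (2 * (V / f0)) :=
      mul_le_mul_of_nonneg_left h2 (by positivity)
    linarith
  set I := Icc d₂ (d₂ + 2400 / (1 / 20) ^ 2 * fx) with hI
  set J := Icc d₃ (d₃ + 2400 / (1 / 20) ^ 2 * f0) with hJ
  set D₀ := D ∩ {p | p.1 ∈ J ∧ p.2.1 ∈ I} with hD₀
  have hD₀m : MeasurableSet D₀ := by
    refine hDm.inter (MeasurableSet.inter (measurable_fst measurableSet_Icc) ?_)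
    exact (measurable_fst.comp measurable_snd) measurableSet_Icc
  have hD₀V : 9 / 10 * V ≤ volume.real D₀ := by
    have hsub : D ⊆ D₀ ∪ (D ∩ Prod.fst ⁻¹' Jᶜ) ∪ (D ∩ {p | p.2.1 ∉ I}) := by
      intro p hp
      by_cases h1 : p.1 ∈ J
      · by_cases h2 : p.2.1 ∈ I
        · exact Or.inl (Or.inl ⟨hp, h1, h2⟩)
        · exact Or.inr ⟨hp, h2⟩
      · exact Or.inl (Or.inr ⟨hp, h1⟩)
    have hfin : ∀ T : Set (ℝ × (ℝ × Z)), volume (D ∩ T) ≠ ⊤ := fun T =>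
      measure_ne_top_of_subset inter_subset_left hDt
    have h7 := (measureReal_mono hsub (measure_union_ne_top
      (measure_union_ne_top (hfin _) (hfin _)) (hfin _))).trans
      ((measureReal_union_le _ _).trans (add_le_add_left (measureReal_union_le _ _) _))
    linarith
  have hIcc : ∀ {a b x y : ℝ}, x ∈ Icc a (a + b) → y ∈ Icc a (a + b) → |x - y| ≤ b := by
    intro a b x y hx hy
    rw [abs_le]
    constructor <;> linarith [hx.1, hx.2, hy.1, hy.2]
  have key := sq_volume_le_of_farPairs h.left hD₀m inter_subset_left hrr₀ (by positivity)
    (L := 2400 / (1 / 20) ^ 2 * fx) (L' := 2400 / (1 / 20) ^ 2 * f0)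
    (M := 2400 / (1 / 20) ^ 2 * f0 / r₀) (by rw [div_mul_cancel₀ _ (by positivity)])
    (fun p hp p' hp' => hIcc hp.2.2 hp'.2.2) (fun p hp p' hp' => hIcc hp.2.1 hp'.2.1)
    (fun x => volume_strip_le h.left x r₀) hw
  have hD₀t : volume D₀ ≠ ⊤ := measure_ne_top_of_subset inter_subset_left hDt
  rw [hax, ← ofReal_measureReal hD₀t, ← ofReal_measureReal hDt,
    ← ENNReal.ofReal_mul measureReal_nonneg, ← ENNReal.ofReal_mul (by positivity),
    ← ENNReal.ofReal_mul (by positivity), ← ENNReal.ofReal_mul (by positivity),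
    ← ENNReal.ofReal_mul hDpos.le, ← ENNReal.ofReal_add (by positivity) (by positivity),
    ENNReal.ofReal_le_ofReal_iff (by positivity)] at key
  have e1 : 2400 / (1 / 20) ^ 2 * fx * (12 * η * (V / f0) * V *
      (2 * (2400 / (1 / 20) ^ 2 * f0 / r₀))) = 240 * 960000 ^ 2 * η * V ^ 2 := by
    rw [hr₀]; field_simp; norm_num
  have e2 : V * (V / fx * (2 * r₀)) = 1 / 5 * V ^ 2 := by
    rw [hr₀]; field_simp; norm_num
  change _ ≤ _ + V * (V / fx * (2 * r₀)) at key
  rw [e1, e2] at key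
  have h8 : (9 / 10 * V) * (9 / 10 * V) ≤ volume.real D₀ * volume.real D₀ :=
    mul_self_le_mul_self (by positivity) hD₀V
  have h9 : 0 < V ^ 2 := by positivity
  nlinarith [mul_le_mul_of_nonneg_right hη' h9.le]

end

section

variable {X : Type*} [AddCommGroup X] [TopologicalSpace X] [IsTopologicalAddGroup X] [T2Space X]
  [SecondCountableTopology X] [MeasureSpace X] [BorelSpace X] [SFinite (volume : Measure X)]
  [IsFiniteMeasureOnCompacts (volume : Measure X)]

/-- A continuous, subadditive, even function. -/
structure IsGauge {X : Type*} [AddCommGroup X] [TopologicalSpace X] (ρ : X → ℝ) : Prop where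
  continuous : Continuous ρ
  add_le : ∀ x y, ρ (x + y) ≤ ρ x + ρ y
  neg : ∀ x, ρ (-x) = ρ x

lemma IsGauge.sub_le {ρ : X → ℝ} (hρ : IsGauge ρ) (x y : X) : ρ x - ρ y ≤ ρ (x + y) := by
  have := hρ.add_le (x + y) (-y)
  rw [add_neg_cancel_right, hρ.neg] at this
  linarith

/-- The part of a set in a gauge ball. -/
def ballPart (ρ : X → ℝ) (a : X) (t : ℝ) (A : Set X) : Set X := A ∩ {p | ρ (p - a) ≤ t}

lemma ballPart_subset {ρ : X → ℝ} {a : X} {t : ℝ} {A : Set X} : ballPart ρ a t A ⊆ A :=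
  inter_subset_left

lemma IsGauge.isCompact_ballPart {ρ : X → ℝ} (hρ : IsGauge ρ) (a : X) (t : ℝ) {A : Set X}
    (hA : IsCompact A) : IsCompact (ballPart ρ a t A) :=
  hA.inter_right (isClosed_le (hρ.continuous.comp (continuous_id.sub continuous_const))
    continuous_const)

lemma BrunnMinkowski.volume_ballPart_add_le {c : ℝ} (hX : BrunnMinkowski X c) {ρ : X → ℝ}
    (hρ : IsGauge ρ) {A B : Set X} (hA : IsCompact A) (hB : IsCompact B) (a b : X) {r s t : ℝ}
    (h : 2 * t + r < s) :
    volume.real (ballPart ρ a t A + ballPart ρ b t B) +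
      c * √(volume.real (A ∩ {p | s ≤ ρ (p - a)}) * volume.real (ballPart ρ b r B)) ≤
    volume.real (A + B) := by
  have hF : IsCompact (A ∩ {p | s ≤ ρ (p - a)}) :=
    hA.inter_right (isClosed_le continuous_const
      (hρ.continuous.comp (continuous_id.sub continuous_const)))
  have hBr := hρ.isCompact_ballPart b r hB
  have hAt := hρ.isCompact_ballPart a t hA
  have hBt := hρ.isCompact_ballPart b t hB
  refine (add_le_add_right (hX _ _ hF hBr) _).trans ?_
  rw [← measureReal_union _ (hF.add hBr).measurableSet (hAt.add hBt).measure_ne_top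
    (hF.add hBr).measure_ne_top]
  · refine measureReal_mono (union_subset ?_ ?_) (hA.add hB).measure_ne_top
    · exact add_subset_add ballPart_subset ballPart_subset
    · exact add_subset_add inter_subset_left ballPart_subset
  · rw [Set.disjoint_left]
    rintro _ ⟨p, hp, q, hq, rfl⟩ ⟨p', hp', q', hq', h'⟩
    simp only at h'
    have h1 : ρ (p + q - (a + b)) ≤ 2 * t := by
      have := hρ.add_le (p - a) (q - b)
      rw [show p - a + (q - b) = p + q - (a + b) by abel] at this
      linarith [hp.2.out, hq.2.out]
    have h2 : s - r ≤ ρ (p + q - (a + b)) := by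
      have := hρ.sub_le (p' - a) (q' - b)
      rw [show p' - a + (q' - b) = p' + q' - (a + b) by abel, h'] at this
      linarith [hp'.2.out, hq'.2.out]
    linarith

/-- The larger of the fractions of two sets outside gauge balls. -/
noncomputable def lossFrac (ρ : X → ℝ) (a b : X) (A B : Set X) (t : ℝ) : ℝ :=
  max (1 - volume.real (ballPart ρ a t A) / volume.real A)
    (1 - volume.real (ballPart ρ b t B) / volume.real B)

lemma lossFrac_comm (ρ : X → ℝ) (a b : X) (A B : Set X) (t : ℝ) :
    lossFrac ρ a b A B t = lossFrac ρ b a B A t := max_comm _ _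

lemma lossFrac_le_iff {ρ : X → ℝ} {a b : X} {A B : Set X} {t f : ℝ} (hA : 0 < volume.real A)
    (hB : 0 < volume.real B) : lossFrac ρ a b A B t ≤ f ↔
      (1 - f) * volume.real A ≤ volume.real (ballPart ρ a t A) ∧
      (1 - f) * volume.real B ≤ volume.real (ballPart ρ b t B) := by
  rw [lossFrac, max_le_iff, sub_le_comm, sub_le_comm (c := f), le_div_iff₀ hA, le_div_iff₀ hB]

lemma lossFrac_nonneg {ρ : X → ℝ} {a b : X} {A B : Set X} {t : ℝ} (hA : IsCompact A)
    (hA' : 0 < volume.real A) : 0 ≤ lossFrac ρ a b A B t := by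
  refine le_max_of_le_left (sub_nonneg.mpr ((div_le_one hA').mpr ?_))
  exact measureReal_mono ballPart_subset hA.measure_ne_top

lemma volume_sub_ballPart_le (ρ : X → ℝ) (a : X) (s : ℝ) {A : Set X}
    (hA : IsCompact A) :
    volume.real A - volume.real (ballPart ρ a s A) ≤ volume.real (A ∩ {p | s ≤ ρ (p - a)}) := by
  rw [sub_le_iff_le_add']
  have hsub : A ⊆ ballPart ρ a s A ∪ A ∩ {p | s ≤ ρ (p - a)} := fun p hp => by
    rcases le_total (ρ (p - a)) s with h | h
    exacts [Or.inl ⟨hp, h⟩, Or.inr ⟨hp, h⟩]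
  refine (measureReal_mono hsub ?_).trans (measureReal_union_le _ _)
  exact measure_ne_top_of_subset (union_subset ballPart_subset inter_subset_left)
    hA.measure_ne_top

lemma BrunnMinkowski.volume_ballPart_add_le_aux {c : ℝ} (hX : BrunnMinkowski X c) (hc : 0 < c)
    {ρ : X → ℝ} (hρ : IsGauge ρ) {A B : Set X} (hA : IsCompact A) (hB : IsCompact B)
    (hA' : 0 < volume.real A) (hB' : 0 < volume.real B) (a b : X) {r s t : ℝ}
    (h : 2 * t + r < s) (hr : lossFrac ρ a b A B r ≤ 1) :
    volume.real (ballPart ρ a t A + ballPart ρ b t B) + c * √(volume.real A * volume.real B) *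
      √((1 - volume.real (ballPart ρ a s A) / volume.real A) * (1 - lossFrac ρ a b A B r)) ≤
    volume.real (A + B) := by
  refine le_trans (add_le_add_right ?_ _) (hX.volume_ballPart_add_le hρ hA hB a b h)
  rw [mul_assoc, ← Real.sqrt_mul (by positivity)]
  refine mul_le_mul_of_nonneg_left (Real.sqrt_le_sqrt ?_) hc.le
  rw [mul_mul_mul_comm]
  refine mul_le_mul ?_ ?_ (mul_nonneg hB'.le (by linarith)) measureReal_nonneg
  · rw [mul_one_sub, mul_div_cancel₀ _ hA'.ne']
    exact volume_sub_ballPart_le ρ a s hA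
  · rw [mul_comm]
    exact ((lossFrac_le_iff hA' hB').mp le_rfl).2

lemma BrunnMinkowski.volume_add_add_lossFrac_le {c : ℝ} (hX : BrunnMinkowski X c) (hc : 0 < c)
    {ρ : X → ℝ} (hρ : IsGauge ρ) {A B : Set X} (hA : IsCompact A) (hB : IsCompact B)
    (hA' : 0 < volume.real A) (hB' : 0 < volume.real B) (a b : X) {r s t : ℝ}
    (h : 2 * t + r < s) (hr : lossFrac ρ a b A B r ≤ 1) :
    volume.real (ballPart ρ a t A + ballPart ρ b t B) + c * √(volume.real A * volume.real B) *
      √(lossFrac ρ a b A B s * (1 - lossFrac ρ a b A B r)) ≤ volume.real (A + B) := by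
  rcases max_choice (1 - volume.real (ballPart ρ a s A) / volume.real A)
    (1 - volume.real (ballPart ρ b s B) / volume.real B) with h1 | h1
  · rw [show lossFrac ρ a b A B s = _ from h1]
    exact hX.volume_ballPart_add_le_aux hc hρ hA hB hA' hB' a b h hr
  · rw [show lossFrac ρ a b A B s = _ from h1, lossFrac_comm, add_comm (ballPart ρ a t A),
      add_comm A, mul_comm (volume.real A)]
    exact hX.volume_ballPart_add_le_aux hc hρ hB hA hB' hA' b a h (by rwa [lossFrac_comm])

lemma one_sub_lossFrac_le {c : ℝ} (hc : 0 < c) {ρ : X → ℝ} {A B : Set X}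
    (hA' : 0 < volume.real A) (hB' : 0 < volume.real B) (a b : X) {t : ℝ}
    (ht : lossFrac ρ a b A B t ≤ 1) :
    c * √(volume.real A * volume.real B) * (1 - lossFrac ρ a b A B t) ≤
      c * √(volume.real (ballPart ρ a t A) * volume.real (ballPart ρ b t B)) := by
  obtain ⟨h1, h2⟩ := (lossFrac_le_iff (ρ := ρ) (a := a) (b := b) (t := t) hA' hB').mp le_rfl
  have h0 : 0 ≤ 1 - lossFrac ρ a b A B t := by linarith
  rw [mul_assoc]
  refine mul_le_mul_of_nonneg_left ?_ hc.le
  rw [← Real.sqrt_mul_self h0, ← Real.sqrt_mul (by positivity)]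
  refine Real.sqrt_le_sqrt ?_
  have := mul_le_mul h1 h2 (by positivity) measureReal_nonneg
  refine le_trans (le_of_eq ?_) this
  ring

/-- A near-extremal pair mostly contained in gauge balls can be cut down to slightly larger gauge
balls so that the loss of measure is controlled by the decrease of the deficit. -/
lemma BrunnMinkowski.exists_cut {c : ℝ} (hX : BrunnMinkowski X c) (hc : 0 < c) {e : ℝ}
    (he : 0 < e) (he1 : e ≤ 1) : ∃ T : ℝ, 1 ≤ T ∧ ∀ (δ : ℝ) (A B : Set X) (ρ : X → ℝ) (a b : X),
      δ ≤ 1 / 100 → 0 ≤ δ → NearBM c δ A B → IsGauge ρ → lossFrac ρ a b A B 1 ≤ 1 / 10 →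
      ∃ t s δ', t ≤ T ∧ 0 ≤ s ∧ s / 10 + δ' ≤ δ + e ∧
        NearBM c δ' (ballPart ρ a t A) (ballPart ρ b t B) ∧
        (1 - s) * volume.real A ≤ volume.real (ballPart ρ a t A) ∧
        (1 - s) * volume.real B ≤ volume.real (ballPart ρ b t B) := by
  obtain ⟨J, hJ⟩ : ∃ J : ℕ, (1 / 4 : ℝ) ^ J < e / 3 :=
    exists_pow_lt_of_lt_one (by positivity) (by norm_num)
  refine ⟨4 ^ J, one_le_pow₀ (by norm_num), fun δ A B ρ a b hδ hδ0 h hρ h1 => ?_⟩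
  set g : ℕ → ℝ := fun i => lossFrac ρ a b A B (4 ^ i) with hg
  have hg0 : ∀ i, 0 ≤ g i := fun i => lossFrac_nonneg h.left h.left_pos
  set M := c * √(volume.real A * volume.real B) with hM
  have hM0 : 0 < M := mul_pos hc (Real.sqrt_pos.mpr (mul_pos h.left_pos h.right_pos))
  have hle : volume.real (A + B) ≤ M * (1 + δ) := by
    refine h.le.trans (le_of_eq ?_); rw [hM]; ring
  have hg1 : g 0 ≤ 1 / 10 := by rw [hg]; simpa using h1
  have near : ∀ i δ', g i ≤ 1 / 10 → 0 ≤ 1 + δ' →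
      volume.real (ballPart ρ a (4 ^ i) A + ballPart ρ b (4 ^ i) B) ≤
        M * ((1 - g i) * (1 + δ')) →
      NearBM c δ' (ballPart ρ a (4 ^ i) A) (ballPart ρ b (4 ^ i) B) := by
    intro i δ' hi hδ' hv
    obtain ⟨h3, h4⟩ := (lossFrac_le_iff h.left_pos h.right_pos).mp (le_refl (g i))
    have h5 : 0 < 1 - g i := by linarith
    refine ⟨hρ.isCompact_ballPart _ _ h.left, hρ.isCompact_ballPart _ _ h.right,
      (mul_pos h5 h.left_pos).trans_le h3, (mul_pos h5 h.right_pos).trans_le h4, hv.trans ?_⟩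
    have h6 := one_sub_lossFrac_le hc h.left_pos h.right_pos a b (ρ := ρ)
      (t := 4 ^ i) (show g i ≤ 1 by linarith)
    have := mul_le_mul_of_nonneg_right h6 hδ'
    refine le_trans (le_of_eq ?_) (this.trans (le_of_eq ?_)) <;> ring
  by_cases hex : ∃ i < J, g i ≤ 1 / 10 ∧ g i / 4 ≤ g (i + 1)
  · obtain ⟨i, hiJ, hi, hi'⟩ := hex
    set w := √(g i) with hw
    have hw0 : 0 ≤ w := Real.sqrt_nonneg _
    have hww : w * w = g i := Real.mul_self_sqrt (hg0 i)
    have hw1 : w ≤ 32 / 100 := by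
      by_contra! hcon
      nlinarith
    refine ⟨4 ^ i, g i, δ - w / 10, pow_le_pow_right₀ (by norm_num) hiJ.le, hg0 i,
      by nlinarith, near i _ hi (by linarith) ?_,
      ((lossFrac_le_iff h.left_pos h.right_pos).mp (le_refl (g i)))⟩
    have h4 : (1 : ℝ) ≤ 4 ^ i := one_le_pow₀ (by norm_num)
    have h2 := hX.volume_add_add_lossFrac_le hc hρ h.left h.right h.left_pos h.right_pos a b
      (r := 1) (s := 4 ^ (i + 1)) (t := 4 ^ i) (by rw [pow_succ]; linarith) (by linarith)
    have h3 : 474 / 1000 * w ≤ √(g (i + 1) * (1 - lossFrac ρ a b A B 1)) := by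
      refine Real.le_sqrt_of_sq_le ?_
      have : g i / 4 * (9 / 10) ≤ g (i + 1) * (1 - lossFrac ρ a b A B 1) :=
        mul_le_mul hi' (by linarith) (by norm_num) (hg0 _)
      nlinarith
    have h5 := mul_le_mul_of_nonneg_left h3 hM0.le
    have h6 : volume.real (ballPart ρ a (4 ^ i) A + ballPart ρ b (4 ^ i) B) ≤
        M * (1 + δ - 474 / 1000 * w) := by
      change _ + M * √(g (i + 1) * _) ≤ _ at h2
      linarith
    refine h6.trans (mul_le_mul_of_nonneg_left ?_ hM0.le)
    rw [← hww]
    nlinarith [mul_nonneg hw0 hw0, mul_nonneg (mul_nonneg hw0 hw0) hw0, mul_nonneg hw0 hδ0]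
  · push Not at hex
    have hdec : ∀ i ≤ J, g i ≤ 1 / 10 * (1 / 4) ^ i := by
      intro i
      induction i with
      | zero => intro _; simpa using hg1
      | succ i ih =>
        intro hi
        have h3 := ih (by omega)
        have h4 : (1 / 4 : ℝ) ^ i ≤ 1 := pow_le_one₀ (by norm_num) (by norm_num)
        have h5 := hex i (by omega) (by linarith)
        rw [pow_succ]
        linarith
    have hJ' := hdec J le_rfl
    refine ⟨4 ^ J, g J, δ + e / 2, le_rfl, hg0 J, by linarith, near J _ (by linarith) (by linarith) ?_,
      ((lossFrac_le_iff h.left_pos h.right_pos).mp (le_refl (g J)))⟩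
    have h6 : volume.real (ballPart ρ a (4 ^ J) A + ballPart ρ b (4 ^ J) B) ≤ M * (1 + δ) :=
      (measureReal_mono (add_subset_add ballPart_subset ballPart_subset)
        (h.left.add h.right).measure_ne_top).trans hle
    refine h6.trans (mul_le_mul_of_nonneg_left ?_ hM0.le)
    nlinarith [hg0 J]

end

section

variable {X : Type*} [AddCommGroup X] [TopologicalSpace X] [IsTopologicalAddGroup X] [T2Space X]
  [SecondCountableTopology X] [MeasureSpace X] [BorelSpace X] [SFinite (volume : Measure X)]
  [IsFiniteMeasureOnCompacts (volume : Measure X)]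

lemma NearBM.nonneg {c δ : ℝ} (hX : BrunnMinkowski X c) (hc : 0 < c) {A B : Set X}
    (h : NearBM c δ A B) : 0 ≤ δ := by
  have h1 := (hX A B h.left h.right).trans h.le
  have h2 : 0 < c * √(volume.real A * volume.real B) :=
    mul_pos hc (Real.sqrt_pos.mpr (mul_pos h.left_pos h.right_pos))
  by_contra! h3
  nlinarith

/-- A near-extremal pair has a near-extremal pair of large slices. -/
lemma NearBM.exists_slices {c δ δ' l : ℝ} (hX : BrunnMinkowski X c) (hc : 0 < c)
    {A B : Set (ℝ × X)} (h : NearBM (2 * c) δ A B) (hδ : δ ≤ 1 / 100) (hδ0 : 0 ≤ δ)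
    (hδ' : δ' ≤ 1 / 2) (hl : 0 < l) (hlδ : 20 * √l ≤ δ' - δ) :
    ∃ x y, l * (⨆ x, sliceVol A x) < sliceVol A x ∧ l * (⨆ x, sliceVol B x) < sliceVol B y ∧
      NearBM c δ' (Prod.mk x ⁻¹' A) (Prod.mk y ⁻¹' B) := by
  by_contra! hcon
  have hsl : 0 < √l := Real.sqrt_pos.mpr hl
  obtain ⟨ha, -⟩ := hX.exists_profile hc h.left h.right h.left_pos h.right_pos h.le
  obtain ⟨hb, -⟩ := hX.exists_profile hc h.symm.left h.symm.right h.symm.left_pos h.symm.right_pos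
    h.symm.le
  have trunc : ∀ {A B : Set (ℝ × X)}, NearBM (2 * c) δ A B →
      ∃ N : Set ℝ, N = {x | l * (⨆ x, sliceVol A x) < sliceVol A x} ∧
        Measurable (N.indicator (sliceVol A)) ∧ (∀ x, 0 ≤ N.indicator (sliceVol A) x) ∧
        BddAbove (range (N.indicator (sliceVol A))) ∧ Integrable (N.indicator (sliceVol A)) ∧
        (1 - 6 * √l) * volume.real A ≤ ∫ x, N.indicator (sliceVol A) x := by
    intro A B h
    have hAm := h.left.measurableSet
    have hm := measurable_sliceVol hAm
    have hAt : volume A ≠ ⊤ := h.left.measure_ne_top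
    have hN : MeasurableSet {x | l * (⨆ x, sliceVol A x) < sliceVol A x} :=
      measurableSet_lt measurable_const hm
    refine ⟨_, rfl, hm.indicator hN, fun x => indicator_nonneg (fun _ _ => sliceVol_nonneg A _) x,
      ?_, (integrable_sliceVol hAm hAt).indicator hN, ?_⟩
    · obtain ⟨M, hM⟩ := bddAbove_range_sliceVol h.left
      refine ⟨M, ?_⟩
      rintro _ ⟨x, rfl⟩
      exact (indicator_le_self' (fun _ _ => sliceVol_nonneg A _) x).trans (hM ⟨x, rfl⟩)
    · rw [integral_indicator hN, setIntegral_sliceVol hAm hAt hN]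
      have h1 := h.volume_low_slices_le hX hc hδ l
      have h2 := measureReal_inter_add_sdiff (μ := volume) (s := A) (measurable_fst (β := X) hN) hAt
      have h3 : A \ (Prod.fst ⁻¹' {x | l * (⨆ x, sliceVol A x) < sliceVol A x}) =
          A ∩ {p | sliceVol A p.1 ≤ l * ⨆ x, sliceVol A x} := by
        ext p
        simp [not_lt]
      rw [h3] at h2
      linarith
  obtain ⟨N, hN, hN1, hN2, hN3, hN4, hN5⟩ := trunc h
  obtain ⟨N', hN', hN1', hN2', hN3', hN4', hN5'⟩ := trunc h.symm
  have hδ'0 : 0 < 1 + δ' := by linarith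
  have hmaj := isMajorant_sliceVol (c := c * (1 + δ')) (by positivity) h.left h.right
    (φ := N.indicator (sliceVol A)) (ψ := N'.indicator (sliceVol B)) (by
      intro x y
      have h0 := sliceVol_nonneg (A + B) (x + y)
      by_cases hx : x ∈ N
      swap
      · simpa [hx] using h0
      by_cases hy : y ∈ N'
      swap
      · simpa [hy] using h0
      rw [indicator_of_mem hx, indicator_of_mem hy]
      rw [hN, mem_ofPred_eq] at hx
      rw [hN', mem_ofPred_eq] at hy
      by_contra! hlt
      refine hcon x y hx hy ⟨isCompact_slice h.left x, isCompact_slice h.right y,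
        (mul_pos hl ha).trans hx, (mul_pos hl hb).trans hy, le_trans ?_ hlt.le⟩
      exact measureReal_mono (slice_add_subset A B x y)
        (isCompact_slice (h.left.add h.right) _).measure_ne_top)
  have key := hmaj.two_mul_sqrt_le hN1 hN2 hN3 hN4 hN1' hN2' hN3' hN4'
  rw [integral_div, integral_sliceVol (h.left.add h.right).measurableSet
    (h.left.add h.right).measure_ne_top, le_div_iff₀ (by positivity)] at key
  have h6 : 0 ≤ 1 - 6 * √l := by linarith
  have hsq : (1 - 6 * √l) * √(volume.real A * volume.real B) ≤
      √((∫ x, N.indicator (sliceVol A) x) * ∫ x, N'.indicator (sliceVol B) x) := by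
    refine Real.le_sqrt_of_sq_le ?_
    rw [mul_pow, Real.sq_sqrt (by positivity)]
    have := mul_le_mul hN5 hN5' (by positivity) (integral_nonneg hN2)
    linarith
  have hP : 0 < √(volume.real A * volume.real B) :=
    Real.sqrt_pos.mpr (mul_pos h.left_pos h.right_pos)
  have h7 := key.trans h.le
  have h8 : 2 * ((1 - 6 * √l) * √(volume.real A * volume.real B)) * (c * (1 + δ')) ≤
      2 * c * (1 + δ) * √(volume.real A * volume.real B) := by
    refine le_trans ?_ h7
    have := mul_le_mul_of_nonneg_right hsq (show 0 ≤ 2 * (c * (1 + δ')) by positivity)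
    linarith
  have h9 : 0 < (2 * c) * √(volume.real A * volume.real B) := by positivity
  have h10 : (1 - 6 * √l) * (1 + δ') ≤ 1 + δ := by
    refine le_of_mul_le_mul_left ?_ h9
    linarith
  nlinarith

/-- Successive cuts by gauge balls, with controlled total loss. -/
lemma BrunnMinkowski.exists_cuts {c : ℝ} (hX : BrunnMinkowski X c) (hc : 0 < c) {e : ℝ}
    (he : 0 < e) (he1 : e ≤ 1) : ∃ T : ℝ, 1 ≤ T ∧ ∀ {ι : Type} (P : ι → (X → ℝ) → Prop)
      (δ δ₁ : ℝ) (A₀ B₀ : Set X), NearBM c δ A₀ B₀ → δ₁ ≤ 1 / 200 →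
      (∀ j A B δ', A ⊆ A₀ → B ⊆ B₀ → NearBM c δ' A B → δ' ≤ δ₁ →
        9 / 10 * volume.real A₀ ≤ volume.real A → 9 / 10 * volume.real B₀ ≤ volume.real B →
        ∃ ρ a b, P j ρ ∧ IsGauge ρ ∧ lossFrac ρ a b A B 1 ≤ 1 / 10) →
      ∀ s : Finset ι, δ + s.card * e ≤ δ₁ → ∃ A B δ' σ, A ⊆ A₀ ∧ B ⊆ B₀ ∧ NearBM c δ' A B ∧
        0 ≤ σ ∧ σ / 10 + δ' ≤ δ + s.card * e ∧ (1 - σ) * volume.real A₀ ≤ volume.real A ∧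
        (1 - σ) * volume.real B₀ ≤ volume.real B ∧
        ∀ j ∈ s, ∃ ρ a b, P j ρ ∧ IsGauge ρ ∧ A ⊆ {p | ρ (p - a) ≤ T} ∧
          B ⊆ {p | ρ (p - b) ≤ T} := by
  classical
  obtain ⟨T, hT, hcut⟩ := hX.exists_cut hc he he1
  refine ⟨T, hT, fun P δ δ₁ A₀ B₀ h₀ hδ₁ H s => ?_⟩
  induction s using Finset.induction_on with
  | empty =>
    intro _
    exact ⟨A₀, B₀, δ, 0, subset_rfl, subset_rfl, h₀, le_rfl, by simp, by simp, by simp, by simp⟩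
  | insert j s hj ih =>
    intro hs
    rw [Finset.card_insert_of_notMem hj] at hs ⊢
    push_cast at hs ⊢
    obtain ⟨A, B, δ', σ, hA, hB, h, hσ, hσδ, hAv, hBv, hall⟩ := ih (by linarith)
    have hδ' := h.nonneg hX hc
    have hσ1 : σ ≤ 1 / 10 := by linarith
    obtain ⟨ρ, a, b, hP, hρ, hloss⟩ := H j A B δ' hA hB h (by linarith)
      (by nlinarith [h₀.left_pos]) (by nlinarith [h₀.right_pos])
    obtain ⟨t, τ, δ'', ht, hτ, hτδ, h', hA', hB'⟩ :=
      hcut δ' A B ρ a b (by linarith) hδ' h hρ hloss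
    have hδ'' := h'.nonneg hX hc
    have hτ1 : 0 ≤ 1 - τ := by linarith
    refine ⟨_, _, δ'', σ + τ, ballPart_subset.trans hA, ballPart_subset.trans hB, h', by positivity,
      by linarith, ?_, ?_, ?_⟩
    · have := mul_le_mul_of_nonneg_left hAv hτ1
      nlinarith [mul_nonneg (mul_nonneg hσ hτ) h₀.left_pos.le]
    · have := mul_le_mul_of_nonneg_left hBv hτ1
      nlinarith [mul_nonneg (mul_nonneg hσ hτ) h₀.right_pos.le]
    · intro i hi
      rw [Finset.mem_insert] at hi
      rcases hi with rfl | hi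
      · exact ⟨ρ, a, b, hP, hρ, fun p hp => hp.2.out.trans ht, fun p hp => hp.2.out.trans ht⟩
      · obtain ⟨ρ', a', b', h1, h2, h3, h4⟩ := hall i hi
        exact ⟨ρ', a', b', h1, h2, ballPart_subset.trans h3, ballPart_subset.trans h4⟩

end

lemma isGauge_abs_div {X : Type*} [AddCommGroup X] [TopologicalSpace X] {f : X → ℝ}
    (hf : Continuous f) (hadd : ∀ x y, f (x + y) = f x + f y) {W : ℝ} (hW : 0 ≤ W) :
    IsGauge fun p => |f p| / W where
  continuous := (hf.abs).div_const W
  add_le x y := by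
    rw [← add_div, hadd]
    exact div_le_div_of_nonneg_right (abs_add_le _ _) hW
  neg x := by
    have : f (-x) = -f x := map_neg (AddMonoidHom.mk' f hadd) x
    rw [this, abs_neg]

lemma lossFrac_image {X Y : Type*} [AddCommGroup X] [TopologicalSpace X] [MeasureSpace X]
    [AddCommGroup Y] [TopologicalSpace Y] [MeasureSpace Y] {κ : ℝ} (e : X ≃ₜ+ Y) (hκ : 0 < κ)
    (he : ∀ S : Set X, volume.real (e '' S) = κ * volume.real S) (ρ : Y → ℝ) (a b : X)
    (A B : Set X) (t : ℝ) :
    lossFrac ρ (e a) (e b) (e '' A) (e '' B) t = lossFrac (fun p => ρ (e p)) a b A B t := by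
  have h : ∀ (a : X) (A : Set X),
      ballPart ρ (e a) t (e '' A) = e '' (ballPart (fun p => ρ (e p)) a t A) := by
    intro a A
    ext q
    constructor
    · rintro ⟨⟨p, hp, rfl⟩, hq⟩
      refine ⟨p, ⟨hp, ?_⟩, rfl⟩
      rw [mem_ofPred_eq] at hq ⊢
      rw [← map_sub] at hq
      exact hq
    · rintro ⟨p, ⟨hp, hq⟩, rfl⟩
      refine ⟨⟨p, hp, rfl⟩, ?_⟩
      rw [mem_ofPred_eq] at hq ⊢
      rw [← map_sub]
      exact hq
  rw [lossFrac, lossFrac, h, h, he, he, he, he, mul_div_mul_left _ _ hκ.ne',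
    mul_div_mul_left _ _ hκ.ne']

section

variable {X : Type*} [AddCommGroup X] [TopologicalSpace X] [IsTopologicalAddGroup X] [T2Space X]
  [SecondCountableTopology X] [MeasureSpace X] [BorelSpace X] [SFinite (volume : Measure X)]
  [IsFiniteMeasureOnCompacts (volume : Measure X)]

lemma NearBM.exists_lossFrac_fst_le {c δ W : ℝ} (hX : BrunnMinkowski X c) (hc : 0 < c)
    {A B : Set (ℝ × X)} (h : NearBM (2 * c) δ A B) (hδ : δ ≤ (1 / 20) ^ 2 / 12800)
    (hW : 2 * 960000 * extent A ≤ W) :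
    ∃ a b, lossFrac (fun p : ℝ × X => |p.1| / W) a b A B 1 ≤ 1 / 20 := by
  have hA0 := h.extent_pos hX hc
  have hB0 := h.symm.extent_pos hX hc
  have hBA := h.symm.extent_le hX hc (hδ.trans (by norm_num))
  have key : ∀ {A B : Set (ℝ × X)}, NearBM (2 * c) δ A B → 960000 * extent A ≤ W →
      ∃ a : ℝ × X, (1 - 1 / 20) * volume.real A ≤
        volume.real (ballPart (fun p : ℝ × X => |p.1| / W) a 1 A) := by
    intro A B h hAW
    have hA0 := h.extent_pos hX hc
    obtain ⟨d, hd⟩ := h.exists_interval hX hc (by norm_num : (0 : ℝ) < 1 / 20) (by norm_num) hδ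
    refine ⟨(d, 0), ?_⟩
    have hW0 : 0 < W := by linarith
    have hAt : volume A ≠ ⊤ := h.left.measure_ne_top
    have hsub : A ⊆ ballPart (fun p : ℝ × X => |p.1| / W) (d, 0) 1 A ∪
        A ∩ Prod.fst ⁻¹' (Icc d (d + 2400 / (1 / 20) ^ 2 * extent A))ᶜ := by
      intro p hp
      by_cases h1 : p.1 ∈ Icc d (d + 2400 / (1 / 20) ^ 2 * extent A)
      · refine Or.inl ⟨hp, ?_⟩
        rw [mem_ofPred_eq, div_le_one hW0, Prod.fst_sub, abs_le]
        constructor <;> norm_num at h1 ⊢ <;> linarith [h1.1, h1.2]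
      · exact Or.inr ⟨hp, h1⟩
    have h2 := (measureReal_mono hsub (measure_ne_top_of_subset
      (union_subset ballPart_subset inter_subset_left) hAt)).trans (measureReal_union_le _ _)
    have := h.left_pos
    linarith
  obtain ⟨a, ha⟩ := key h (by linarith)
  obtain ⟨b, hb⟩ := key h.symm (by linarith)
  exact ⟨a, b, (lossFrac_le_iff h.left_pos h.right_pos).mpr ⟨ha, hb⟩⟩

end

section

variable {Z : Type*} [AddCommGroup Z] [TopologicalSpace Z] [IsTopologicalAddGroup Z] [T2Space Z]
  [SecondCountableTopology Z] [MeasureSpace Z] [BorelSpace Z] [SFinite (volume : Measure Z)]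
  [IsFiniteMeasureOnCompacts (volume : Measure Z)]

lemma shear_image_shear_image (m m' : ℝ) (D : Set (ℝ × (ℝ × Z))) :
    shear Z m '' (shear Z m' '' D) = shear Z (m' + m) '' D := by
  ext ⟨t, u⟩
  rw [mem_shear_image, mem_shear_image, mem_shear_image]
  ring_nf

lemma exists_shear_sup_le {D : Set (ℝ × (ℝ × Z))} (hD : IsCompact D)
    (hpos : 0 < ⨆ t, sliceVol D t) :
    ∃ m₀, ∀ m, ⨆ t, sliceVol (shear Z m '' D) t ≤ 2 * ⨆ t, sliceVol (shear Z m₀ '' D) t := by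
  set s : ℝ → ℝ := fun m => ⨆ t, sliceVol (shear Z m '' D) t with hs
  have hb : BddAbove (range s) := by
    refine ⟨volume.real (Prod.snd '' D), ?_⟩
    rintro _ ⟨m, rfl⟩
    refine ciSup_le fun t => measureReal_mono (fun u hu => ?_)
      (hD.image continuous_snd).measure_ne_top
    exact ⟨_, mem_shear_image.mp hu, rfl⟩
  have h0 : s 0 = ⨆ t, sliceVol D t := by
    have : shear Z 0 '' D = D := by
      ext ⟨t, u⟩
      rw [mem_shear_image, zero_mul, add_zero]
    rw [hs]; simp only [this]
  have hS : 0 < ⨆ m, s m := (h0 ▸ hpos).trans_le (le_ciSup hb 0)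
  obtain ⟨m₀, hm₀⟩ := exists_lt_of_lt_ciSup (half_lt_self hS)
  exact ⟨m₀, fun m => by
    have := le_ciSup hb m
    simp only [hs] at this hm₀ ⊢
    linarith⟩

/-- In a near-extremal pair with bounded shadows of slices, the second coordinate is mostly within
bounded distance of a linear function of the first. -/
lemma NearBM.exists_lossFrac_snd_le {c δ η ε W : ℝ} (hZ : BrunnMinkowski Z c) (hc : 0 < c)
    {A B : Set (ℝ × (ℝ × Z))} (h : NearBM (2 * (2 * c)) δ A B) (hη : 0 < η)
    (hη' : 240 * 960000 ^ 2 * η ≤ 1 / 2) (hδ : δ ≤ η ^ 3 / 19200) (hε : 0 < ε)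
    {S : Set ℝ} (hS : MeasurableSet S)
    (hmass : volume.real (A ∩ {p | p.1 ∉ S}) ≤ η * volume.real A)
    (hshadow : ∀ x ∈ S, volume (Prod.fst '' (Prod.mk x ⁻¹' A)) ≤ ENNReal.ofReal ε)
    (hW : 2 * 960000 * (20 * (2400 / η ^ 2) ^ 2 / η * ε) ≤ W) :
    ∃ m a b, lossFrac (fun p : ℝ × (ℝ × Z) => |p.2.1 - m * p.1| / W) a b A B 1 ≤ 1 / 10 := by
  have hX := hZ.prod hc
  have hδ0 := h.nonneg (hX.prod (by positivity)) (by positivity)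
  have hδ2 : δ ≤ (1 / 20) ^ 2 / 12800 := by
    have h1 : η ≤ 1 / 20 := by norm_num at hη' ⊢; linarith
    have h2 : η ^ 3 ≤ (1 / 20) ^ 3 := pow_le_pow_left₀ hη.le h1 3
    norm_num at h2 ⊢
    linarith
  have hD := h.swapFst
  have hDpos := (hX.exists_profile (by positivity) hD.left hD.right hD.left_pos hD.right_pos
    hD.le).1
  obtain ⟨m₀, hm₀⟩ := exists_shear_sup_le hD.left hDpos
  have hE := hD.shear m₀
  have hext : extent (_root_.shear Z m₀ '' (_root_.swapFst Z '' A)) ≤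
      20 * (2400 / η ^ 2) ^ 2 / η * ε := by
    refine extent_le_of_shadow hZ hc hE hη hη' hδ0 hδ hε hS ?_ ?_ ?_
    · have hout : _root_.shear Z m₀ '' (_root_.swapFst Z '' A) ∩ {p | p.2.1 ∉ S} =
          _root_.shear Z m₀ '' (_root_.swapFst Z '' (A ∩ {p | p.1 ∉ S})) := by
        ext ⟨y, x, z⟩
        simp only [mem_shear_image, mem_swapFst_image, mem_inter_iff, mem_ofPred_eq]
      rw [hout, volume_real_shear, volume_real_swapFst, volume_real_shear, volume_real_swapFst]
      exact hmass
    · intro x hx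
      refine le_trans (le_of_eq ?_) (hshadow x hx)
      rw [← measure_preimage_add_right volume (m₀ * x) (Prod.fst '' (Prod.mk x ⁻¹' A))]
      congr 1
      ext t
      constructor
      · rintro ⟨⟨y, z⟩, hp, rfl⟩
        rw [mem_preimage, mem_swapFst_image, mem_shear_image, mem_swapFst_image] at hp
        exact ⟨(_, z), hp, rfl⟩
      · rintro ⟨⟨y, z⟩, hp, hy⟩
        refine ⟨(t, z), ?_, rfl⟩
        rw [mem_preimage, mem_swapFst_image, mem_shear_image, mem_swapFst_image]
        simp only at hy ⊢
        rw [← hy]; exact hp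
    · intro m
      rw [shear_image_shear_image]
      exact hm₀ _
  obtain ⟨a, b, hab⟩ := hE.exists_lossFrac_fst_le hX (by positivity) hδ2 (W := W) (by linarith)
  obtain ⟨a, rfl⟩ := (_root_.shear Z m₀).surjective a
  obtain ⟨b, rfl⟩ := (_root_.shear Z m₀).surjective b
  obtain ⟨a, rfl⟩ := (_root_.swapFst Z).surjective a
  obtain ⟨b, rfl⟩ := (_root_.swapFst Z).surjective b
  rw [lossFrac_image _ one_pos (fun S => by rw [volume_real_shear, one_mul]),
    lossFrac_image _ one_pos (fun S => by rw [volume_real_swapFst, one_mul])] at hab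
  exact ⟨m₀, a, b, hab.trans (by norm_num)⟩

end

/-- The map `e` multiplies volumes by `κ`. -/
def ScalesVolume {V W : Type*} [MeasureSpace V] [MeasureSpace W] (e : V → W) (κ : ℝ) : Prop :=
  ∀ S : Set V, volume.real (e '' S) = κ * volume.real S

lemma ScalesVolume.comp {U V W : Type*} [MeasureSpace U] [MeasureSpace V] [MeasureSpace W]
    {f : V → W} {e : U → V} {κ κ' : ℝ} (hf : ScalesVolume f κ) (he : ScalesVolume e κ') :
    ScalesVolume (fun p => f (e p)) (κ * κ') := by
  intro S
  rw [mul_assoc, ← he, ← hf, image_image]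

lemma scalesVolume_det {V : Type*} [NormedAddCommGroup V] [NormedSpace ℝ V]
    [FiniteDimensional ℝ V] [MeasureSpace V] [BorelSpace V]
    [(volume : Measure V).IsAddHaarMeasure] (e : V ≃L[ℝ] V) :
    ScalesVolume e |LinearMap.det (e : V →ₗ[ℝ] V)| := by
  intro S
  rw [measureReal_def, Measure.addHaar_image_continuousLinearEquiv, ENNReal.toReal_mul,
    ENNReal.toReal_ofReal (abs_nonneg _), measureReal_def]

/-- Splitting off the `j`-th coordinate. -/
noncomputable def splitCoord {n : ℕ} (j : Fin (n + 1)) :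
    (Fin (n + 1) → ℝ) ≃L[ℝ] ℝ × (Fin n → ℝ) :=
  LinearEquiv.toContinuousLinearEquiv
    { toFun := fun w => (w j, fun i => w (j.succAbove i))
      invFun := fun p => j.insertNth p.1 p.2
      map_add' := fun _ _ => rfl
      map_smul' := fun _ _ => rfl
      left_inv := fun w => Fin.insertNth_self_removeNth j w
      right_inv := fun p => by simp }

lemma splitCoord_apply {n : ℕ} (j : Fin (n + 1)) (w : Fin (n + 1) → ℝ) :
    splitCoord j w = (w j, fun i => w (j.succAbove i)) := rfl

lemma measurePreserving_splitCoord {n : ℕ} (j : Fin (n + 1)) :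
    MeasurePreserving (splitCoord j) :=
  volume_preserving_piFinSuccAbove (fun _ : Fin (n + 1) => ℝ) j

lemma scalesVolume_splitCoord {n : ℕ} (j : Fin (n + 1)) : ScalesVolume (splitCoord j) 1 := by
  intro S
  rw [one_mul]
  exact volume_real_image_of_measurePreserving (splitCoord j).toContinuousAddEquiv
    (measurePreserving_splitCoord j) S

lemma scalesVolume_splitCoord_symm {n : ℕ} (j : Fin (n + 1)) :
    ScalesVolume (splitCoord j).symm 1 := by
  intro S
  have := scalesVolume_splitCoord j ((splitCoord j).symm '' S)
  rw [image_image] at this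
  simp only [ContinuousLinearEquiv.apply_symm_apply, image_id'] at this
  linarith

/-- Splitting off the `j`-th coordinate of the second factor. -/
noncomputable def splitSnd {n : ℕ} (j : Fin (n + 1)) :
    (ℝ × (Fin (n + 1) → ℝ)) ≃L[ℝ] ℝ × (ℝ × (Fin n → ℝ)) :=
  (ContinuousLinearEquiv.refl ℝ ℝ).prodCongr (splitCoord j)

lemma scalesVolume_splitSnd {n : ℕ} (j : Fin (n + 1)) : ScalesVolume (splitSnd j) 1 := by
  intro S
  rw [one_mul]
  exact volume_real_image_of_measurePreserving (splitSnd j).toContinuousAddEquiv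
    ((MeasurePreserving.id volume).prod (measurePreserving_splitCoord j)) S

lemma isAddHaarMeasure_prod_pi (n : ℕ) :
    (volume : Measure (ℝ × (Fin n → ℝ))).IsAddHaarMeasure :=
  inferInstanceAs ((volume.prod volume : Measure (ℝ × (Fin n → ℝ))).IsAddHaarMeasure)

lemma scalesVolume_refl_prodCongr {n : ℕ} (e : (Fin n → ℝ) ≃L[ℝ] (Fin n → ℝ)) :
    ScalesVolume ((ContinuousLinearEquiv.refl ℝ ℝ).prodCongr e)
      |LinearMap.det (e : (Fin n → ℝ) →ₗ[ℝ] (Fin n → ℝ))| := by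
  have := isAddHaarMeasure_prod_pi n
  have h := scalesVolume_det ((ContinuousLinearEquiv.refl ℝ ℝ).prodCongr e)
  have : (((ContinuousLinearEquiv.refl ℝ ℝ).prodCongr e : _ ≃L[ℝ] _) :
      ℝ × (Fin n → ℝ) →ₗ[ℝ] ℝ × (Fin n → ℝ)) =
      LinearMap.prodMap LinearMap.id (e : (Fin n → ℝ) →ₗ[ℝ] (Fin n → ℝ)) := rfl
  rwa [this, LinearMap.det_prodMap, LinearMap.det_id, one_mul] at h

/-- The map `(x, w) ↦ (u x, v (w - x m))`. -/
noncomputable def scaleShear {n : ℕ} (u v : ℝˣ) (m : Fin n → ℝ) :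
    (ℝ × (Fin n → ℝ)) ≃L[ℝ] ℝ × (Fin n → ℝ) :=
  LinearEquiv.toContinuousLinearEquiv
    { toFun := fun p => ((u : ℝ) * p.1, (v : ℝ) • (p.2 - p.1 • m))
      invFun := fun p => ((↑u⁻¹ : ℝ) * p.1, (↑v⁻¹ : ℝ) • p.2 + ((↑u⁻¹ : ℝ) * p.1) • m)
      map_add' := fun p q => by ext <;> simp <;> ring
      map_smul' := fun c p => by ext <;> simp <;> ring
      left_inv := fun p => by ext <;> simp
      right_inv := fun p => by ext <;> simp }

lemma scaleShear_apply {n : ℕ} (u v : ℝˣ) (m : Fin n → ℝ) (p : ℝ × (Fin n → ℝ)) :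
    scaleShear u v m p = ((u : ℝ) * p.1, (v : ℝ) • (p.2 - p.1 • m)) := rfl

lemma measurePreserving_scaleShear_one {n : ℕ} (m : Fin n → ℝ) :
    MeasurePreserving (scaleShear 1 1 m) := by
  have h := (MeasurePreserving.id (volume : Measure ℝ)).skew_product
    (μc := (volume : Measure (Fin n → ℝ))) (μd := volume) (g := fun x w => w - x • m)
    (by fun_prop) (Filter.Eventually.of_forall fun x => by
      simp_rw [sub_eq_add_neg]; exact (measurePreserving_add_right volume _).map_eq)
  have he : ⇑(scaleShear 1 1 m) = fun p => (id p.1, p.2 - p.1 • m) := by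
    ext p <;> simp [scaleShear_apply]
  rw [he]
  exact h

lemma scalesVolume_scaleShear {n : ℕ} (u v : ℝˣ) (m : Fin n → ℝ) :
    ScalesVolume (scaleShear u v m) (|(u : ℝ)| * |(v : ℝ)| ^ n) := by
  have h1 : ScalesVolume (scaleShear 1 1 m) 1 := fun S => by
    rw [one_mul]
    exact volume_real_image_of_measurePreserving (scaleShear 1 1 m).toContinuousAddEquiv
      (measurePreserving_scaleShear_one m) S
  have := isAddHaarMeasure_prod_pi n
  have h2 := scalesVolume_det (scaleShear u v (0 : Fin n → ℝ))
  have : ((scaleShear u v (0 : Fin n → ℝ) : _ ≃L[ℝ] _) :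
      ℝ × (Fin n → ℝ) →ₗ[ℝ] ℝ × (Fin n → ℝ)) =
      LinearMap.prodMap ((u : ℝ) • LinearMap.id) ((v : ℝ) • LinearMap.id) := by
    ext <;> simp [scaleShear_apply]
  rw [this, LinearMap.det_prodMap, LinearMap.det_smul, LinearMap.det_smul, LinearMap.det_id,
    LinearMap.det_id, mul_one, mul_one, Module.finrank_self, pow_one, Module.finrank_fin_fun,
    abs_mul, abs_pow] at h2
  have h3 := h2.comp h1
  rw [mul_one] at h3
  convert h3 using 2 with p
  simp [scaleShear_apply]

lemma brunnMinkowski_pi (n : ℕ) : BrunnMinkowski (Fin n → ℝ) (2 ^ n) := by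
  induction n with
  | zero =>
    intro A B hA hB
    rcases A.eq_empty_or_nonempty with rfl | hA'
    · simp
    rcases B.eq_empty_or_nonempty with rfl | hB'
    · simp
    rw [Subsingleton.eq_univ_of_nonempty hA', Subsingleton.eq_univ_of_nonempty hB',
      univ_add_univ]
    simp
  | succ n ih =>
    intro A B hA hB
    have h := ih.prod (by positivity) _ _ (hA.image (splitCoord 0).continuous)
      (hB.image (splitCoord 0).continuous)
    rw [← Set.image_add, scalesVolume_splitCoord, scalesVolume_splitCoord,
      scalesVolume_splitCoord, one_mul, one_mul, one_mul] at h
    rwa [pow_succ']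

section

variable {X : Type*} [AddCommGroup X] [TopologicalSpace X] [IsTopologicalAddGroup X] [T2Space X]
  [SecondCountableTopology X] [MeasureSpace X] [BorelSpace X] [SFinite (volume : Measure X)]
  [IsFiniteMeasureOnCompacts (volume : Measure X)]

lemma volume_image_mul_le [(volume : Measure X).IsAddLeftInvariant] {f : X → ℝ}
    (hf : Continuous f) (hadd : ∀ x y, f (x + y) = f x + f y) {A B : Set X} (hA : IsCompact A)
    (hB : IsCompact B) {v : ℝ} (hv : ∀ b ∈ B, |f b - v| ≤ 1) :
    volume (f '' A) * volume B ≤ 2 * volume (A + B) := by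
  set Q : Set (ℝ × X) := (f '' A) ×ˢ (A + B) ∩ {p | |f p.2 - v - p.1| ≤ 1} with hQ
  have hP : MeasurableSet (f '' A) := (hA.image hf).measurableSet
  have hAB : MeasurableSet (A + B) := (hA.add hB).measurableSet
  have hQm : MeasurableSet Q :=
    (hP.prod hAB).inter (isClosed_le (by fun_prop) continuous_const).measurableSet
  calc volume (f '' A) * volume B = ∫⁻ t, (f '' A).indicator (fun _ => volume B) t := by
        rw [lintegral_indicator_const hP, mul_comm]
    _ ≤ ∫⁻ t, volume (Prod.mk t ⁻¹' Q) := by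
        refine lintegral_mono fun t => ?_
        by_cases ht : t ∈ f '' A
        · rw [indicator_of_mem ht]
          obtain ⟨u, hu, rfl⟩ := ht
          rw [← measure_vadd volume u B]
          refine measure_mono ?_
          rintro _ ⟨b, hb, rfl⟩
          refine ⟨⟨⟨u, hu, rfl⟩, ⟨u, hu, b, hb, rfl⟩⟩, ?_⟩
          have := hv b hb
          rw [mem_ofPred_eq]
          simp only [vadd_eq_add, hadd]
          rwa [show f u + f b - v - f u = f b - v by ring]
        · rw [indicator_of_notMem ht]; exact zero_le
    _ = volume Q := by rw [Measure.volume_eq_prod, Measure.prod_apply hQm]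
    _ = ∫⁻ y, volume ((fun t => (t, y)) ⁻¹' Q) := by
        rw [Measure.volume_eq_prod, Measure.prod_apply_symm hQm]
    _ ≤ ∫⁻ y, (A + B).indicator (fun _ => 2) y := by
        refine lintegral_mono fun y => ?_
        by_cases hy : y ∈ A + B
        · rw [indicator_of_mem hy]
          have : (fun t => (t, y)) ⁻¹' Q ⊆ Icc (f y - v - 1) (f y - v + 1) := by
            rintro t ⟨-, ht⟩
            have := abs_le.mp ht.out
            simp only at this
            constructor <;> linarith
          refine (measure_mono this).trans ?_
          rw [Real.volume_Icc, show f y - v + 1 - (f y - v - 1) = 2 by ring]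
          simp
        · rw [indicator_of_notMem hy]
          have : (fun t => (t, y)) ⁻¹' Q = ∅ :=
            eq_empty_of_forall_notMem fun t ht => hy ht.1.2
          simp [this]
    _ = _ := by rw [lintegral_indicator_const hAB]

lemma volume_inter_large_sum_slice_le {A B : Set (ℝ × X)} (hA : IsCompact A) (hB : IsCompact B)
    (y : ℝ) {K : ℝ} (hK : 0 < K) :
    volume.real (A ∩ Prod.fst ⁻¹' {x | sliceVol (A + B) (x + y) ≤ K}ᶜ) ≤
      (⨆ x, sliceVol A x) / K * volume.real (A + B) := by
  have hm := measurable_sliceVol (hA.add hB).measurableSet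
  have hS : MeasurableSet {x | sliceVol (A + B) (x + y) ≤ K} :=
    measurableSet_le (hm.comp (measurable_add_const y)) measurable_const
  have hi := (integrable_sliceVol (hA.add hB).measurableSet (hA.add hB).measure_ne_top)
  have hi' := (hi.comp_add_right y).const_mul ((⨆ x, sliceVol A x) / K)
  have ha : 0 ≤ (⨆ x, sliceVol A x) := Real.iSup_nonneg (sliceVol_nonneg A)
  rw [← setIntegral_sliceVol hA.measurableSet hA.measure_ne_top hS.compl]
  calc ∫ x in {x | sliceVol (A + B) (x + y) ≤ K}ᶜ, sliceVol A x
      ≤ ∫ x in {x | sliceVol (A + B) (x + y) ≤ K}ᶜ,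
          (⨆ x, sliceVol A x) / K * sliceVol (A + B) (x + y) := by
        refine setIntegral_mono_on (integrable_sliceVol hA.measurableSet
          hA.measure_ne_top).integrableOn hi'.integrableOn hS.compl fun x hx => ?_
        have hx' : K < sliceVol (A + B) (x + y) := not_le.mp hx
        refine (le_ciSup (bddAbove_range_sliceVol hA) x).trans ?_
        rw [div_mul_eq_mul_div, le_div_iff₀ hK]
        exact mul_le_mul_of_nonneg_left hx'.le ha
    _ ≤ ∫ x, (⨆ x, sliceVol A x) / K * sliceVol (A + B) (x + y) :=
        setIntegral_le_integral hi' (Filter.Eventually.of_forall fun x =>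
          mul_nonneg (div_nonneg ha hK.le) (sliceVol_nonneg _ _))
    _ = _ := by
        rw [integral_const_mul, integral_add_right_eq_self,
          integral_sliceVol (hA.add hB).measurableSet (hA.add hB).measure_ne_top]

lemma lossFrac_le_of_subset {ρ : X → ℝ} {a b : X} {A B A' B' : Set X} {t : ℝ}
    (hρ : IsGauge ρ) (hA : IsCompact A) (hB : IsCompact B) (hA' : A' ⊆ A) (hB' : B' ⊆ B)
    (hA0 : 0 < volume.real A) (hB0 : 0 < volume.real B)
    (hAv : 9 / 10 * volume.real A ≤ volume.real A')
    (hBv : 9 / 10 * volume.real B ≤ volume.real B') (h : lossFrac ρ a b A B t ≤ 1 / 20) :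
    lossFrac ρ a b A' B' t ≤ 1 / 10 := by
  obtain ⟨h1, h2⟩ := (lossFrac_le_iff hA0 hB0).mp h
  have key : ∀ {a : X} {A A' : Set X}, IsCompact A → A' ⊆ A →
      9 / 10 * volume.real A ≤ volume.real A' →
      (1 - 1 / 20) * volume.real A ≤ volume.real (ballPart ρ a t A) →
      (1 - 1 / 10) * volume.real A' ≤ volume.real (ballPart ρ a t A') := by
    intro a A A' hA hA' hAv h
    have hsub : A' ⊆ ballPart ρ a t A' ∪ A \ ballPart ρ a t A := by
      intro p hp
      by_cases hq : ρ (p - a) ≤ t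
      · exact Or.inl ⟨hp, hq⟩
      · exact Or.inr ⟨hA' hp, fun hq' => hq hq'.2⟩
    have hAt : volume A ≠ ⊤ := hA.measure_ne_top
    have h3 := (measureReal_mono hsub (measure_ne_top_of_subset
      (union_subset (ballPart_subset.trans hA') sdiff_subset) hAt)).trans
        (measureReal_union_le _ _)
    rw [measureReal_sdiff (s₁ := A) ballPart_subset (hρ.isCompact_ballPart a t hA).measurableSet hAt] at h3
    have h4 : 0 ≤ volume.real A := measureReal_nonneg
    linarith
  exact (lossFrac_le_iff (by linarith) (by linarith)).mpr
    ⟨key hA hA' hAv h1, key hB hB' hBv h2⟩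

end

lemma NearBM.exists_lossFrac_coord_le {n : ℕ} {δ η ε W : ℝ} {A B : Set (ℝ × (Fin n → ℝ))}
    (h : NearBM (2 * 2 ^ n) δ A B) (hη : 0 < η)
    (hη' : 240 * 960000 ^ 2 * η ≤ 1 / 2) (hδ : δ ≤ η ^ 3 / 19200) (hε : 0 < ε)
    {S : Set ℝ} (hS : MeasurableSet S)
    (hmass : volume.real (A ∩ Prod.fst ⁻¹' Sᶜ) ≤ η * volume.real A) (j : Fin n)
    (hshadow : ∀ x ∈ S, volume ((fun w => w j) '' (Prod.mk x ⁻¹' A)) ≤ ENNReal.ofReal ε)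
    (hW : 2 * 960000 * (20 * (2400 / η ^ 2) ^ 2 / η * ε) ≤ W) :
    ∃ m a b, lossFrac (fun p : ℝ × (Fin n → ℝ) => |p.2 j - m * p.1| / W) a b A B 1 ≤ 1 / 10 := by
  cases n with
  | zero => exact j.elim0
  | succ n =>
    have hsc : ∀ S, volume.real ((splitSnd j).toContinuousAddEquiv '' S) = 1 * volume.real S :=
      scalesVolume_splitSnd j
    have h' := h.image (splitSnd j).toContinuousAddEquiv one_pos hsc
    rw [pow_succ'] at h'
    have hmass' : volume.real ((splitSnd j).toContinuousAddEquiv '' A ∩ {p | p.1 ∉ S}) ≤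
        η * volume.real ((splitSnd j).toContinuousAddEquiv '' A) := by
      have : (splitSnd j).toContinuousAddEquiv '' A ∩ {p | p.1 ∉ S} =
          (splitSnd j).toContinuousAddEquiv '' (A ∩ Prod.fst ⁻¹' Sᶜ) := by
        ext q
        constructor
        · rintro ⟨⟨p, hp, rfl⟩, hq⟩
          exact ⟨p, ⟨hp, hq⟩, rfl⟩
        · rintro ⟨p, ⟨hp, hq⟩, rfl⟩
          exact ⟨⟨p, hp, rfl⟩, hq⟩
      rw [this, hsc, hsc]
      linarith
    have hshadow' : ∀ x ∈ S, volume (Prod.fst '' (Prod.mk x ⁻¹'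
        ((splitSnd j).toContinuousAddEquiv '' A))) ≤ ENNReal.ofReal ε := by
      intro x hx
      refine (measure_mono ?_).trans (hshadow x hx)
      rintro _ ⟨q, ⟨⟨x', w⟩, hp, hq⟩, rfl⟩
      obtain ⟨rfl, rfl⟩ := Prod.mk.inj hq
      exact ⟨w, hp, rfl⟩
    obtain ⟨m, a, b, hab⟩ := h'.exists_lossFrac_snd_le (brunnMinkowski_pi n)
      (by positivity) hη hη' hδ hε hS hmass' hshadow' hW
    obtain ⟨a, rfl⟩ := (splitSnd j).toContinuousAddEquiv.surjective a
    obtain ⟨b, rfl⟩ := (splitSnd j).toContinuousAddEquiv.surjective b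
    rw [lossFrac_image _ one_pos hsc] at hab
    exact ⟨m, a, b, hab⟩

/-- Most of `A` and of `B` lies in parallelepipeds which are translates of each other and
are not much larger than `A` and `B`. -/
def IsRounded {V : Type*} [NormedAddCommGroup V] [NormedSpace ℝ V] [MeasureSpace V] (n : ℕ)
    (c : ℝ) (A B : Set V) : Prop :=
  ∃ (T : V ≃L[ℝ] (Fin n → ℝ)) (κ : ℝ) (a b : V), 0 < κ ∧ ScalesVolume T κ ∧
    c ≤ κ * √(volume.real A * volume.real B) ∧
    lossFrac (fun p => ‖T p‖) a b A B 1 ≤ 1 / 10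

lemma IsRounded.of_image {V W : Type*} [NormedAddCommGroup V] [NormedSpace ℝ V] [MeasureSpace V]
    [NormedAddCommGroup W] [NormedSpace ℝ W] [MeasureSpace W] {n : ℕ} {c κ : ℝ} {A B : Set V}
    (e : V ≃L[ℝ] W) (hκ : 0 < κ) (he : ScalesVolume e κ)
    (h : IsRounded n c (e '' A) (e '' B)) : IsRounded n c A B := by
  obtain ⟨T, κ', a, b, hκ', hT, hc, hl⟩ := h
  obtain ⟨a, rfl⟩ := e.surjective a
  obtain ⟨b, rfl⟩ := e.surjective b
  refine ⟨e.trans T, κ' * κ, a, b, mul_pos hκ' hκ, hT.comp he, hc.trans_eq ?_, ?_⟩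
  · rw [he, he, mul_mul_mul_comm, Real.sqrt_mul (mul_self_nonneg κ), Real.sqrt_mul_self hκ.le,
      mul_assoc]
  · exact (lossFrac_image e.toContinuousAddEquiv hκ he (fun p => ‖T p‖) a b A B 1).symm.trans_le
      hl

lemma NearBM.exists_isRounded {n : ℕ} {δ τ η c₁ C₁ : ℝ} (hδ : 0 ≤ δ) (hδτ : δ < τ) (hη : 0 < η)
    (hη' : 240 * 960000 ^ 2 * η ≤ 1 / 2) (hτ : τ ≤ η ^ 3 / 19200) (hc₁ : 0 < c₁) (hC₁ : 0 < C₁) :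
    ∃ c, 0 < c ∧ ∀ (A B : Set (ℝ × (Fin n → ℝ))) (y : ℝ) (v : Fin n → ℝ),
      NearBM (2 * 2 ^ n) δ A B → c₁ ≤ (⨆ x, sliceVol A x) → (⨆ x, sliceVol A x) ≤ C₁ →
      c₁ ≤ (⨆ x, sliceVol B x) → (⨆ x, sliceVol B x) ≤ C₁ →
      c₁ ≤ volume.real (Prod.mk y ⁻¹' B ∩ Metric.closedBall v 1) →
      IsRounded (n + 1) c A B := by
  have hX := brunnMinkowski_pi n
  have hτ' : τ ≤ 1 / 10 ^ 9 := by
    have h1 : η ≤ 1 / 100 := by norm_num at hη' ⊢; linarith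
    have h2 : η ^ 3 ≤ (1 / 100) ^ 3 := pow_le_pow_left₀ hη.le h1 3
    norm_num at h2 ⊢
    linarith
  have hn : (0 : ℝ) < n + 1 := by positivity
  have he : 0 < (τ - δ) / (n + 1) := div_pos (by linarith) hn
  have he1 : (τ - δ) / (n + 1) ≤ 1 := by
    rw [div_le_one hn]
    have : (0 : ℝ) ≤ n := n.cast_nonneg
    linarith
  obtain ⟨T, hT1, hcuts⟩ := (hX.prod (by positivity)).exists_cuts (by positivity) he he1
  have hT : 0 < T := by linarith
  set K : ℝ := 2 * (8 * 2 ^ n * C₁) / η with hK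
  have hK0 : 0 < K := by positivity
  set ε : ℝ := 2 * K / c₁ with hε
  have hε0 : 0 < ε := by positivity
  set W : ℝ := 2 * 960000 * (20 * (2400 / η ^ 2) ^ 2 / η * ε) with hW
  have hW0 : 0 < W := by positivity
  refine ⟨c₁ / (3840000 * T) * (T * W)⁻¹ ^ n, by positivity,
    fun A B y v h hA1 hA2 hB1 hB2 hv => ?_⟩
  have hf := h.extent_pos hX (by positivity)
  have hg := h.symm.extent_pos hX (by positivity)
  have hfg := h.extent_le hX (by positivity) (by linarith)
  have hgf := h.symm.extent_le hX (by positivity) (by linarith)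
  have ha : 0 < ⨆ x, sliceVol A x := by linarith
  have hb : 0 < ⨆ x, sliceVol B x := by linarith
  have hAe : volume.real A = (⨆ x, sliceVol A x) * extent A := (mul_div_cancel₀ _ ha.ne').symm
  have hBe : volume.real B = (⨆ x, sliceVol B x) * extent B := (mul_div_cancel₀ _ hb.ne').symm
  set f := extent A
  set g := extent B
  have hAB : volume.real (A + B) ≤ 8 * 2 ^ n * C₁ * f := by
    have h1 : √(volume.real A * volume.real B) ≤ 2 * C₁ * f := by
      refine Real.sqrt_le_iff.mpr ⟨by positivity, ?_⟩
      have h2 : volume.real A ≤ C₁ * f := hAe ▸ mul_le_mul_of_nonneg_right hA2 hf.le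
      have h3 : volume.real B ≤ C₁ * (2 * f) := hBe ▸ mul_le_mul hB2 hgf hg.le hC₁.le
      calc volume.real A * volume.real B ≤ (C₁ * f) * (C₁ * (2 * f)) :=
            mul_le_mul h2 h3 measureReal_nonneg (by positivity)
        _ ≤ (2 * C₁ * f) ^ 2 := by nlinarith [sq_nonneg (C₁ * f)]
    calc volume.real (A + B) ≤ 2 * 2 ^ n * (1 + δ) * √(volume.real A * volume.real B) := h.le
      _ ≤ 2 * 2 ^ n * 2 * (2 * C₁ * f) := by
          refine mul_le_mul (mul_le_mul_of_nonneg_left (by linarith) (by positivity)) h1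
            (Real.sqrt_nonneg _) (by positivity)
      _ = _ := by ring
  set S : Set ℝ := {x | sliceVol (A + B) (x + y) ≤ K} with hSdef
  have hS : MeasurableSet S :=
    measurableSet_le ((measurable_sliceVol (h.left.add h.right).measurableSet).comp
      (measurable_add_const y)) measurable_const
  have hmass : volume.real (A ∩ Prod.fst ⁻¹' Sᶜ) ≤ η / 2 * volume.real A := by
    refine (volume_inter_large_sum_slice_le h.left h.right y hK0).trans ?_
    calc (⨆ x, sliceVol A x) / K * volume.real (A + B)
        ≤ (⨆ x, sliceVol A x) / K * (8 * 2 ^ n * C₁ * f) :=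
          mul_le_mul_of_nonneg_left hAB (by positivity)
      _ = η / 2 * volume.real A := by rw [hAe, hK]; field_simp
  have hshadow : ∀ x ∈ S, ∀ j, volume ((fun w => w j) '' (Prod.mk x ⁻¹' A)) ≤
      ENNReal.ofReal ε := by
    intro x hx j
    have hBv : IsCompact (Prod.mk y ⁻¹' B ∩ Metric.closedBall v 1) :=
      (isCompact_slice h.right y).inter_right Metric.isClosed_closedBall
    have h1 := volume_image_mul_le (continuous_apply j) (fun _ _ => rfl)
      (isCompact_slice h.left x) hBv (v := v j) (fun b hb => by
        have := (norm_le_pi_norm (b - v) j).trans (mem_closedBall_iff_norm.mp hb.2)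
        simpa using this)
    have h2 : volume (Prod.mk x ⁻¹' A + (Prod.mk y ⁻¹' B ∩ Metric.closedBall v 1)) ≤
        ENNReal.ofReal K := by
      refine (measure_mono ((add_subset_add_left inter_subset_left).trans
        (slice_add_subset A B x y))).trans ?_
      rw [← ENNReal.ofReal_toReal (isCompact_slice (h.left.add h.right) (x + y)).measure_ne_top]
      exact ENNReal.ofReal_le_ofReal hx
    have h3 : ENNReal.ofReal c₁ ≤ volume (Prod.mk y ⁻¹' B ∩ Metric.closedBall v 1) := by
      rw [← ENNReal.ofReal_toReal hBv.measure_ne_top]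
      exact ENNReal.ofReal_le_ofReal hv
    rw [hε, ENNReal.ofReal_div_of_pos hc₁, ENNReal.le_div_iff_mul_le
      (Or.inl (by simpa using hc₁)) (Or.inl ENNReal.ofReal_ne_top),
      ENNReal.ofReal_mul (by norm_num), ENNReal.ofReal_ofNat]
    exact (mul_le_mul_right h3 _).trans (h1.trans (mul_le_mul_right h2 _))
  have hfst : IsGauge fun p : ℝ × (Fin n → ℝ) => |p.1| / (1920000 * f) :=
    isGauge_abs_div continuous_fst (fun _ _ => rfl) (by positivity)
  obtain ⟨A', B', δ', σ, hA', hB', h', hσ, hσδ, hAv, hBv, hall⟩ :=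
    hcuts (ι := Option (Fin n)) (fun j ρ => j.elim (ρ = fun p => |p.1| / (1920000 * f))
      (fun j => ∃ m, ρ = fun p => |p.2 j - m * p.1| / W)) δ τ A B h (by linarith)
      (by
        intro j A' B' δ' hA' hB' h' hδ' hAv hBv
        cases j with
        | none =>
          obtain ⟨a, b, hab⟩ := h.exists_lossFrac_fst_le hX (by positivity) (by linarith)
            (show 2 * 960000 * f ≤ 1920000 * f by linarith)
          exact ⟨_, a, b, rfl, hfst, lossFrac_le_of_subset hfst h.left h.right hA' hB' h.left_pos
            h.right_pos hAv hBv hab⟩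
        | some j =>
          obtain ⟨m, a, b, hab⟩ := h'.exists_lossFrac_coord_le hη hη' (hδ'.trans hτ) hε0 hS
            (by
              have h1 : volume.real (A' ∩ Prod.fst ⁻¹' Sᶜ) ≤
                  volume.real (A ∩ Prod.fst ⁻¹' Sᶜ) :=
                measureReal_mono (inter_subset_inter_left _ hA')
                  (measure_ne_top_of_subset inter_subset_left h.left.measure_ne_top)
              have h2 := mul_le_mul_of_nonneg_left hAv hη.le
              have h3 := mul_pos hη h.left_pos
              linarith) j
            (fun x hx => (measure_mono (image_mono (preimage_mono hA'))).trans (hshadow x hx j))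
            hW.ge
          exact ⟨_, a, b, ⟨m, rfl⟩, isGauge_abs_div (by fun_prop) (fun p q => by
            simp only [Prod.snd_add, Prod.fst_add, Pi.add_apply]; ring) hW0.le, hab⟩)
      Finset.univ (by
        rw [Finset.card_univ, Fintype.card_option, Fintype.card_fin]
        push_cast
        rw [mul_div_cancel₀ _ hn.ne']
        linarith)
  rw [Finset.card_univ, Fintype.card_option, Fintype.card_fin] at hσδ
  push_cast at hσδ
  rw [mul_div_cancel₀ _ hn.ne'] at hσδ
  have hδ'0 := h'.nonneg (hX.prod (by positivity)) (by positivity)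
  obtain ⟨_, a₀, b₀, rfl, -, hA₀, hB₀⟩ := hall none (Finset.mem_univ _)
  have hsome : ∀ j : Fin n, ∃ m α β : ℝ, (∀ p ∈ A', |p.2 j - m * p.1 - α| ≤ T * W) ∧
      ∀ p ∈ B', |p.2 j - m * p.1 - β| ≤ T * W := by
    intro j
    obtain ⟨_, a, b, ⟨m, rfl⟩, -, ha, hb⟩ := hall (some j) (Finset.mem_univ _)
    refine ⟨m, a.2 j - m * a.1, b.2 j - m * b.1, fun p hp => ?_, fun p hp => ?_⟩
    · have := (div_le_iff₀ hW0).mp (ha hp).out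
      refine (le_of_eq (congrArg _ ?_)).trans this
      simp only [Prod.snd_sub, Prod.fst_sub, Pi.sub_apply]; ring
    · have := (div_le_iff₀ hW0).mp (hb hp).out
      refine (le_of_eq (congrArg _ ?_)).trans this
      simp only [Prod.snd_sub, Prod.fst_sub, Pi.sub_apply]; ring
  choose m α β hα hβ using hsome
  have hTf : 0 < T * (1920000 * f) := by positivity
  have hTW : 0 < T * W := by positivity
  set u : ℝˣ := Units.mk0 (T * (1920000 * f))⁻¹ (inv_ne_zero hTf.ne')
  set w : ℝˣ := Units.mk0 (T * W)⁻¹ (inv_ne_zero hTW.ne')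
  set E : (ℝ × (Fin n → ℝ)) ≃L[ℝ] (Fin (n + 1) → ℝ) :=
    (scaleShear u w m).trans (splitCoord 0).symm
  have hE : ∀ {D : Set (ℝ × (Fin n → ℝ))} {d : ℝ × (Fin n → ℝ)} {γ : Fin n → ℝ},
      D ⊆ {p | |(p - d).1| / (1920000 * f) ≤ T} →
      (∀ j, ∀ p ∈ D, |p.2 j - m j * p.1 - γ j| ≤ T * W) →
      ∀ p ∈ D, ‖E (p - (d.1, γ + d.1 • m))‖ ≤ 1 := by
    intro D d γ hD hγ p hp
    have hval : splitCoord 0 (E (p - (d.1, γ + d.1 • m))) =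
        scaleShear u w m (p - (d.1, γ + d.1 • m)) := (splitCoord 0).apply_symm_apply _
    rw [splitCoord_apply, scaleShear_apply, Prod.mk.injEq] at hval
    rw [pi_norm_le_iff_of_nonneg zero_le_one, Fin.forall_fin_succ]
    constructor
    · rw [hval.1, Real.norm_eq_abs, abs_mul, Units.val_mk0, abs_inv, abs_of_pos hTf,
        inv_mul_le_iff₀ hTf, mul_one]
      exact (div_le_iff₀ (by positivity)).mp (hD hp)
    · intro j
      have := congrFun hval.2 j
      rw [Fin.zero_succAbove] at this
      rw [this, Real.norm_eq_abs, Pi.smul_apply, smul_eq_mul, abs_mul, Units.val_mk0, abs_inv,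
        abs_of_pos hTW, inv_mul_le_iff₀ hTW, mul_one]
      refine (le_of_eq (congrArg _ ?_)).trans (hγ j p hp)
      simp only [Prod.snd_sub, Prod.fst_sub, Pi.sub_apply, Pi.add_apply, Pi.smul_apply,
        smul_eq_mul]
      ring
  have hEs : ScalesVolume E (|(u : ℝ)| * |(w : ℝ)| ^ n) := by
    have := (scalesVolume_splitCoord_symm (0 : Fin (n + 1))).comp (scalesVolume_scaleShear u w m)
    rw [one_mul] at this
    exact this
  rw [Units.val_mk0, Units.val_mk0, abs_of_pos (inv_pos.mpr hTf), abs_of_pos (inv_pos.mpr hTW)]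
    at hEs
  refine ⟨E, _, (a₀.1, α + a₀.1 • m), (b₀.1, β + b₀.1 • m), by positivity, hEs, ?_, ?_⟩
  · have h1 : c₁ * f / 2 ≤ √(volume.real A * volume.real B) := by
      refine Real.le_sqrt_of_sq_le ?_
      have h2 : c₁ * f ≤ volume.real A := hAe ▸ mul_le_mul_of_nonneg_right hA1 hf.le
      have h3 : c₁ * (f / 2) ≤ volume.real B :=
        hBe ▸ mul_le_mul hB1 (by linarith) (by positivity) hb.le
      calc (c₁ * f / 2) ^ 2 ≤ (c₁ * f) * (c₁ * (f / 2)) := by nlinarith [sq_nonneg (c₁ * f)]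
        _ ≤ _ := mul_le_mul h2 h3 (by positivity) measureReal_nonneg
    refine le_trans (le_of_eq ?_) (mul_le_mul_of_nonneg_left h1 (by positivity))
    field_simp
    norm_num
  · have hσ1 : σ ≤ 1 / 10 := by linarith
    refine (lossFrac_le_iff h.left_pos h.right_pos).mpr ⟨?_, ?_⟩
    · refine (mul_le_mul_of_nonneg_right (by linarith) measureReal_nonneg).trans (hAv.trans
        (measureReal_mono (fun p hp => ⟨hA' hp, hE hA₀ hα p hp⟩)
          (measure_ne_top_of_subset ballPart_subset h.left.measure_ne_top)))
    · refine (mul_le_mul_of_nonneg_right (by linarith) measureReal_nonneg).trans (hBv.trans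
        (measureReal_mono (fun p hp => ⟨hB' hp, hE hB₀ hβ p hp⟩)
          (measure_ne_top_of_subset ballPart_subset h.right.measure_ne_top)))

lemma slice_refl_prodCongr {n : ℕ} (e : (Fin n → ℝ) ≃L[ℝ] (Fin n → ℝ))
    (A : Set (ℝ × (Fin n → ℝ))) (x : ℝ) :
    Prod.mk x ⁻¹' ((ContinuousLinearEquiv.refl ℝ ℝ).prodCongr e '' A) =
      e '' (Prod.mk x ⁻¹' A) := by
  ext w
  constructor
  · rintro ⟨⟨x', w'⟩, hp, hq⟩
    obtain ⟨rfl, rfl⟩ := Prod.mk.inj hq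
    exact ⟨w', hp, rfl⟩
  · rintro ⟨w', hp, rfl⟩
    exact ⟨(x, w'), hp, rfl⟩

lemma volume_real_image_ballPart_le {n : ℕ} (T : (Fin n → ℝ) ≃L[ℝ] (Fin n → ℝ))
    (a : Fin n → ℝ) (A : Set (Fin n → ℝ)) :
    volume.real (T '' ballPart (fun p => ‖T p‖) a 1 A) ≤ 2 ^ n := by
  have hsub : T '' ballPart (fun p => ‖T p‖) a 1 A ⊆ Metric.closedBall (T a) 1 := by
    rintro _ ⟨p, ⟨-, hp⟩, rfl⟩
    rw [mem_closedBall_iff_norm, ← map_sub]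
    exact hp
  refine (measureReal_mono hsub Metric.isBounded_closedBall.measure_lt_top.ne).trans
    (le_of_eq ?_)
  rw [measureReal_def, Real.volume_pi_closedBall _ zero_le_one, mul_one, Fintype.card_fin,
    ENNReal.toReal_ofReal (by positivity)]

/-- Near-extremal pairs in `ℝⁿ` are rounded up to a small proportion. -/
lemma exists_isRounded {τ η : ℝ} (hη : 0 < η) (hη' : 240 * 960000 ^ 2 * η ≤ 1 / 2)
    (hτ : τ ≤ η ^ 3 / 19200) (hτ' : τ ≤ 1 / 100) (n : ℕ) : ∀ δ < τ, ∃ c, 0 < c ∧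
      ∀ A B : Set (Fin n → ℝ), NearBM (2 ^ n) δ A B → IsRounded n c A B := by
  induction n with
  | zero =>
    refine fun δ _ => ⟨1, one_pos, fun A B h => ?_⟩
    have huniv : ∀ {A : Set (Fin 0 → ℝ)}, 0 < volume.real A → A = univ := by
      intro A hA
      refine Subsingleton.eq_univ_of_nonempty (nonempty_iff_ne_empty.mpr ?_)
      rintro rfl
      simp at hA
    obtain rfl := huniv h.left_pos
    obtain rfl := huniv h.right_pos
    refine ⟨ContinuousLinearEquiv.refl ℝ _, 1, 0, 0, one_pos, fun S => by simp,
      by simp [measureReal_def, volume_pi], ?_⟩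
    have hb : ballPart (fun p : Fin 0 → ℝ => ‖ContinuousLinearEquiv.refl ℝ _ p‖) 0 1 univ =
        univ := by
      refine eq_univ_of_forall fun p =>
        ⟨mem_univ _, (pi_norm_le_iff_of_nonneg zero_le_one).mpr fun i => i.elim0⟩
    refine (lossFrac_le_iff h.left_pos h.right_pos).mpr ⟨?_, ?_⟩ <;>
    · rw [hb]
      linarith [h.left_pos]
  | succ n ih =>
    intro δ hδτ
    by_cases hδ : 0 ≤ δ
    swap
    · exact ⟨1, one_pos, fun A B h =>
        absurd (h.nonneg (brunnMinkowski_pi _) (by positivity)) hδ⟩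
    have hX := brunnMinkowski_pi n
    obtain ⟨c₀, hc₀, hrd⟩ := ih ((δ + τ) / 2) (by linarith)
    set l : ℝ := ((τ - δ) / 40) ^ 2 with hl
    have hτδ : 0 < τ - δ := by linarith
    have hl0 : 0 < l := by positivity
    have hc₁ : 0 < 9 / 10 * (c₀ ^ 2 / 2 ^ (n + 1)) := by positivity
    have hC₁ : 0 < 2 ^ (n + 1) / l := by positivity
    obtain ⟨c, hc, hcore⟩ := NearBM.exists_isRounded (n := n) hδ hδτ hη hη' hτ hc₁ hC₁
    refine ⟨c, hc, fun A B h => ?_⟩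
    have hs0 := scalesVolume_splitCoord (0 : Fin (n + 1))
    have h1 := h.image (splitCoord 0).toContinuousAddEquiv one_pos hs0
    refine IsRounded.of_image (splitCoord 0) one_pos hs0 ?_
    change NearBM _ δ (splitCoord 0 '' A) (splitCoord 0 '' B) at h1
    generalize splitCoord 0 '' A = A₁ at *
    generalize splitCoord 0 '' B = B₁ at *
    rw [pow_succ'] at h1
    obtain ⟨x, y, hx, hy, hxy⟩ := h1.exists_slices (δ' := (δ + τ) / 2) hX (by positivity)
      (by linarith) hδ (by linarith) hl0 (by
        rw [hl, Real.sqrt_sq (by positivity)]; linarith)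
    obtain ⟨T, κ, a, b, hκ, hTκ, hcκ, hloss⟩ := hrd _ _ hxy
    obtain ⟨hal, hbl⟩ := (lossFrac_le_iff hxy.left_pos hxy.right_pos).mp hloss
    have hs1 := scalesVolume_refl_prodCongr T
    have hdet : |LinearMap.det (T : (Fin n → ℝ) →ₗ[ℝ] (Fin n → ℝ))| = κ :=
      mul_right_cancel₀ hxy.left_pos.ne' (by rw [← hTκ, ← scalesVolume_det T])
    rw [hdet] at hs1
    have h2 := h1.image ((ContinuousLinearEquiv.refl ℝ ℝ).prodCongr T).toContinuousAddEquiv hκ hs1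
    refine IsRounded.of_image ((ContinuousLinearEquiv.refl ℝ ℝ).prodCongr T) hκ hs1 ?_
    have hslice : ∀ (A : Set (ℝ × (Fin n → ℝ))) x,
        sliceVol ((ContinuousLinearEquiv.refl ℝ ℝ).prodCongr T '' A) x = κ * sliceVol A x := by
      intro A x
      rw [sliceVol, slice_refl_prodCongr, hTκ, sliceVol]
    have hsup : ∀ A : Set (ℝ × (Fin n → ℝ)),
        (⨆ x, sliceVol ((ContinuousLinearEquiv.refl ℝ ℝ).prodCongr T '' A) x) =
          κ * ⨆ x, sliceVol A x := by
      intro A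
      simp_rw [hslice, Real.mul_iSup_of_nonneg hκ.le]
    have hball : ∀ {a : Fin n → ℝ} {D : Set (Fin n → ℝ)}, 0 < volume.real D →
        (1 - 1 / 10) * volume.real D ≤ volume.real (ballPart (fun p => ‖T p‖) a 1 D) →
        κ * volume.real D ≤ 2 ^ (n + 1) := by
      intro a D hD h
      have h3 := volume_real_image_ballPart_le T a D
      rw [hTκ] at h3
      have h4 := mul_le_mul_of_nonneg_left h hκ.le
      have h5 := mul_pos hκ hD
      rw [pow_succ]
      linarith
    have hxu := hball hxy.left_pos hal
    have hyu := hball hxy.right_pos hbl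
    have hprod : c₀ ^ 2 ≤ (κ * sliceVol A₁ x) * (κ * sliceVol B₁ y) := by
      refine (pow_le_pow_left₀ hc₀.le hcκ 2).trans (le_of_eq ?_)
      rw [mul_pow, Real.sq_sqrt (by positivity)]
      simp only [sliceVol]
      ring
    have hxl : c₀ ^ 2 / 2 ^ (n + 1) ≤ κ * sliceVol A₁ x := by
      rw [div_le_iff₀ (by positivity)]
      exact hprod.trans (mul_le_mul_of_nonneg_left hyu (mul_nonneg hκ.le (sliceVol_nonneg _ _)))
    have hyl : c₀ ^ 2 / 2 ^ (n + 1) ≤ κ * sliceVol B₁ y := by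
      rw [div_le_iff₀ (by positivity), mul_comm]
      exact (hprod.trans (mul_le_mul_of_nonneg_right hxu
        (mul_nonneg hκ.le (sliceVol_nonneg _ _)))).trans_eq (by ring)
    have hsupl : ∀ {A : Set (ℝ × (Fin n → ℝ))} {x}, IsCompact A →
        c₀ ^ 2 / 2 ^ (n + 1) ≤ κ * sliceVol A x →
        9 / 10 * (c₀ ^ 2 / 2 ^ (n + 1)) ≤ κ * ⨆ x, sliceVol A x := by
      intro A x hA hx
      have h3 := mul_le_mul_of_nonneg_left (le_ciSup (bddAbove_range_sliceVol hA) x) hκ.le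
      have h4 : 0 < c₀ ^ 2 / 2 ^ (n + 1) := by positivity
      linarith
    have hsupu : ∀ {A : Set (ℝ × (Fin n → ℝ))} {x}, l * (⨆ x, sliceVol A x) < sliceVol A x →
        κ * sliceVol A x ≤ 2 ^ (n + 1) → κ * (⨆ x, sliceVol A x) ≤ 2 ^ (n + 1) / l := by
      intro A x h3 h4
      rw [le_div_iff₀ hl0]
      have := mul_le_mul_of_nonneg_left h3.le hκ.le
      linarith
    refine hcore _ _ y (T b) h2 (hsup A₁ ▸ hsupl h1.left hxl) (hsup A₁ ▸ hsupu hx hxu)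
      (hsup B₁ ▸ hsupl h1.right hyl) (hsup B₁ ▸ hsupu hy hyu) ?_
    have hsub : T '' ballPart (fun p => ‖T p‖) b 1 (Prod.mk y ⁻¹' B₁) ⊆
        Prod.mk y ⁻¹' ((ContinuousLinearEquiv.refl ℝ ℝ).prodCongr T '' B₁) ∩
          Metric.closedBall (T b) 1 := by
      rw [slice_refl_prodCongr]
      rintro _ ⟨p, ⟨hp, hp'⟩, rfl⟩
      refine ⟨⟨p, hp, rfl⟩, ?_⟩
      rw [mem_closedBall_iff_norm, ← map_sub]
      exact hp'
    refine le_trans ?_ (measureReal_mono hsub (measure_ne_top_of_subset inter_subset_right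
      Metric.isBounded_closedBall.measure_lt_top.ne))
    rw [hTκ]
    have h3 := mul_le_mul_of_nonneg_left hbl hκ.le
    simp only [sliceVol] at hyl
    linarith

lemma NearBM.mono {X : Type*} [AddCommGroup X] [TopologicalSpace X] [MeasureSpace X]
    {c δ δ' : ℝ} {A B : Set X} (h : NearBM c δ A B) (hc : 0 ≤ c) (hδ : δ ≤ δ') :
    NearBM c δ' A B where
  left := h.left
  right := h.right
  left_pos := h.left_pos
  right_pos := h.right_pos
  le := h.le.trans (mul_le_mul_of_nonneg_right
    (mul_le_mul_of_nonneg_left (by linarith) hc) (Real.sqrt_nonneg _))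

section

variable {X : Type*} [AddCommGroup X] [TopologicalSpace X] [IsTopologicalAddGroup X] [T2Space X]
  [SecondCountableTopology X] [MeasureSpace X] [BorelSpace X] [SFinite (volume : Measure X)]
  [IsFiniteMeasureOnCompacts (volume : Measure X)]

lemma NearBM.lossFrac_mul_le {c δ : ℝ} (hX : BrunnMinkowski X c) (hc : 0 < c) {A B : Set X}
    (h : NearBM c δ A B) {ρ : X → ℝ} (hρ : IsGauge ρ) (a b : X) {t : ℝ} (ht : 0 < t)
    (hl : lossFrac ρ a b A B t ≤ 1) :
    lossFrac ρ a b A B (4 * t) * (1 - lossFrac ρ a b A B t) ≤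
      (δ + lossFrac ρ a b A B t) ^ 2 := by
  have h0 := lossFrac_nonneg (ρ := ρ) (a := a) (b := b) (B := B) (t := t) h.left h.left_pos
  have h0' := lossFrac_nonneg (ρ := ρ) (a := a) (b := b) (B := B) (t := 4 * t) h.left h.left_pos
  have hδ := h.nonneg hX hc
  have h1 := hX.volume_add_add_lossFrac_le hc hρ h.left h.right h.left_pos h.right_pos a b
    (show 2 * t + t < 4 * t by linarith) hl
  have h2 := (one_sub_lossFrac_le hc h.left_pos h.right_pos a b hl).trans
    (hX _ _ (hρ.isCompact_ballPart a t h.left) (hρ.isCompact_ballPart b t h.right))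
  have hM : 0 < c * √(volume.real A * volume.real B) :=
    mul_pos hc (Real.sqrt_pos.mpr (mul_pos h.left_pos h.right_pos))
  have h3 : √(lossFrac ρ a b A B (4 * t) * (1 - lossFrac ρ a b A B t)) ≤
      δ + lossFrac ρ a b A B t := by
    refine le_of_mul_le_mul_left ?_ hM
    have := h.le
    linarith
  exact (Real.sqrt_le_left (by positivity)).mp h3

lemma IsGauge.volume_ballPart_add_add_le [(volume : Measure X).IsAddLeftInvariant] {ρ : X → ℝ}
    (hρ : IsGauge ρ) {A B : Set X} (hA : IsCompact A) (hB : IsCompact B) (a b : X) {t : ℝ} {p : X}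
    (hp : p ∈ A) (hpt : 3 * t < ρ (p - a)) :
    volume.real (ballPart ρ a t A + ballPart ρ b t B) + volume.real (ballPart ρ b t B) ≤
      volume.real (A + B) := by
  have hBt := hρ.isCompact_ballPart b t hB
  have hAt := hρ.isCompact_ballPart a t hA
  have hv : volume.real (p +ᵥ ballPart ρ b t B) = volume.real (ballPart ρ b t B) := by
    rw [measureReal_def, measure_vadd, measureReal_def]
  have hpB : IsCompact (p +ᵥ ballPart ρ b t B) := hBt.vadd p
  rw [← hv, ← measureReal_union _ hpB.measurableSet (hAt.add hBt).measure_ne_top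
    hpB.measure_ne_top]
  · refine measureReal_mono (union_subset ?_ ?_) (hA.add hB).measure_ne_top
    · exact add_subset_add ballPart_subset ballPart_subset
    · rintro _ ⟨q, hq, rfl⟩
      exact ⟨p, hp, q, hq.1, rfl⟩
  · rw [Set.disjoint_left]
    rintro _ ⟨p', hp', q', hq', rfl⟩ ⟨q, hq, h'⟩
    simp only [vadd_eq_add] at h'
    have h1 := hρ.add_le (p' - a) (q' - b)
    have h2 := hρ.sub_le (p - a) (q - b)
    rw [show p - a + (q - b) = p' - a + (q' - b) by
      rw [show p - a + (q - b) = p + q - (a + b) by abel, h']; abel] at h2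
    linarith [hp'.2.out, hq'.2.out, hq.2.out]

lemma NearBM.gauge_le_three_mul [(volume : Measure X).IsAddLeftInvariant] {c δ : ℝ}
    (hX : BrunnMinkowski X c) (hc : 0 < c) {A B : Set X}
    (h : NearBM c δ A B) {ρ : X → ℝ} (hρ : IsGauge ρ) (a b : X) {t : ℝ}
    (hl : lossFrac ρ a b A B t ≤ 1 / 10) (hcl : c * (δ + lossFrac ρ a b A B t) ≤ 1 / 2)
    (hB : 99 / 100 * √(volume.real A * volume.real B) ≤ volume.real B) :
    ∀ p ∈ A, ρ (p - a) ≤ 3 * t := by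
  intro p hp
  by_contra! hpt
  have h0 := lossFrac_nonneg (ρ := ρ) (a := a) (b := b) (B := B) (t := t) h.left h.left_pos
  have h1 := hρ.volume_ballPart_add_add_le h.left h.right a b hp hpt
  have h2 := (one_sub_lossFrac_le hc h.left_pos h.right_pos a b (hl.trans (by norm_num))).trans
    (hX _ _ (hρ.isCompact_ballPart a t h.left) (hρ.isCompact_ballPart b t h.right))
  obtain ⟨-, h3⟩ := (lossFrac_le_iff h.left_pos h.right_pos).mp hl
  have hR : 0 < √(volume.real A * volume.real B) :=
    Real.sqrt_pos.mpr (mul_pos h.left_pos h.right_pos)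
  have h4 := mul_le_mul_of_nonneg_right hcl hR.le
  have := h.le
  linarith

end

/-- A near-extremal pair in `ℝᵏ` loses only about `δ²` of its volume outside a large ball. -/
lemma NearBM.lossFrac_le {k : ℕ} {δ : ℝ} {A B : Set (Fin k → ℝ)} (h : NearBM (2 ^ k) δ A B)
    (hδ : δ ≤ 1 / 1000) {ρ : (Fin k → ℝ) → ℝ} (hρ : IsGauge ρ) (a b : Fin k → ℝ)
    (hl : lossFrac ρ a b A B 1 ≤ 1 / 10)
    (hA : 99 / 100 * √(volume.real A * volume.real B) ≤ volume.real A)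
    (hB : 99 / 100 * √(volume.real A * volume.real B) ≤ volume.real B) :
    lossFrac ρ a b A B (4 ^ (k + 2)) ≤ δ ^ 2 + 20 * δ ^ 3 := by
  have hX := brunnMinkowski_pi k
  have hc : (0 : ℝ) < 2 ^ k := by positivity
  have hδ0 := h.nonneg hX hc
  set f : ℕ → ℝ := fun j => lossFrac ρ a b A B (4 ^ j) with hf
  have hf0 : ∀ j, 0 ≤ f j := fun j => lossFrac_nonneg h.left h.left_pos
  have hrec : ∀ j, f j ≤ 1 / 10 → f (j + 1) * (1 - f j) ≤ (δ + f j) ^ 2 := by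
    intro j hj
    have := h.lossFrac_mul_le hX hc hρ a b (t := 4 ^ j) (by positivity) (hj.trans (by norm_num))
    rwa [← pow_succ'] at this
  have hsmall : ∀ j, f j ≤ δ → f (j + 1) ≤ 9 / 2 * δ ^ 2 := by
    intro j hj
    have h1 := hrec j (by linarith)
    have h2 : (δ + f j) ^ 2 ≤ (2 * δ) ^ 2 := pow_le_pow_left₀ (by linarith [hf0 j]) (by linarith) 2
    have h3 : f (j + 1) * (9 / 10) ≤ f (j + 1) * (1 - f j) :=
      mul_le_mul_of_nonneg_left (by linarith) (hf0 _)
    nlinarith [sq_nonneg δ]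
  have hdecay : ∀ j, f j ≤ max ((1 / 2) ^ j / 10) δ := by
    intro j
    induction j with
    | zero =>
      refine le_max_of_le_left ?_
      simpa [hf] using hl
    | succ j ih =>
      have hj1 : f j ≤ 1 / 10 := ih.trans (max_le (by
        have : ((1 : ℝ) / 2) ^ j ≤ 1 := pow_le_one₀ (by norm_num) (by norm_num)
        linarith) (by linarith))
      rcases le_total (f j) δ with hj | hj
      · refine le_max_of_le_right ((hsmall j hj).trans ?_)
        nlinarith
      · have hstep : f (j + 1) ≤ f j / 2 := by
          have h1 := hrec j hj1
          have h2 : (δ + f j) ^ 2 ≤ (2 * f j) ^ 2 :=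
            pow_le_pow_left₀ (by linarith [hf0 j]) (by linarith) 2
          have h3 : f (j + 1) * (9 / 10) ≤ f (j + 1) * (1 - f j) :=
            mul_le_mul_of_nonneg_left (by linarith) (hf0 _)
          nlinarith [mul_le_mul_of_nonneg_left hj1 (hf0 j)]
        rcases le_max_iff.mp ih with h1 | h1
        · refine le_max_of_le_left ?_
          rw [pow_succ]
          linarith
        · exact le_max_of_le_right (by linarith [hf0 j])
  have hk : (1 / 2 : ℝ) ^ k * 2 ^ k = 1 := by rw [← mul_pow]; norm_num
  rcases le_total ((1 / 2) ^ k / 4) δ with hcase | hcase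
  · have h1 : f k ≤ δ := (hdecay k).trans (max_le (by
      have : (0 : ℝ) < (1 / 2) ^ k := by positivity
      linarith) le_rfl)
    have h2 := hsmall k h1
    have h3 : f (k + 1) ≤ 1 / 100 * δ := by nlinarith
    have h4 := hrec (k + 1) (by linarith)
    have h5 := hf0 (k + 1)
    change f (k + 2) ≤ _
    rw [show k + 1 + 1 = k + 2 from rfl] at h4
    have h6 : f (k + 2) * (1 - 9 / 2 * δ ^ 2) ≤ (δ + 9 / 2 * δ ^ 2) ^ 2 :=
      (mul_le_mul_of_nonneg_left (by linarith) (hf0 _)).trans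
        (h4.trans (pow_le_pow_left₀ (by linarith) (by linarith) 2))
    have h7 : 0 < 1 - 9 / 2 * δ ^ 2 := by nlinarith
    refine le_of_mul_le_mul_right (h6.trans ?_) h7
    have : 0 ≤ δ ^ 3 * (11 - 25 * δ - 90 * δ ^ 2) :=
      mul_nonneg (by positivity) (by nlinarith)
    nlinarith [this]
  · have hlk : lossFrac ρ a b A B (4 ^ k) ≤ (1 / 2) ^ k / 4 := (hdecay k).trans (max_le (by
      have : (0 : ℝ) < (1 / 2) ^ k := by positivity
      linarith) hcase)
    have hlk' : lossFrac ρ a b A B (4 ^ k) ≤ 1 / 10 := (hdecay k).trans (max_le (by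
      have : ((1 : ℝ) / 2) ^ k ≤ 1 := pow_le_one₀ (by norm_num) (by norm_num)
      linarith) (by linarith))
    have hcl : (2 : ℝ) ^ k * (δ + lossFrac ρ a b A B (4 ^ k)) ≤ 1 / 2 := by
      calc (2 : ℝ) ^ k * (δ + lossFrac ρ a b A B (4 ^ k))
          ≤ 2 ^ k * ((1 / 2) ^ k / 4 + (1 / 2) ^ k / 4) :=
            mul_le_mul_of_nonneg_left (by linarith) hc.le
        _ = 1 / 2 := by linear_combination hk / 2
    have hAf := h.gauge_le_three_mul hX hc hρ a b hlk' hcl hB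
    have hBf := h.symm.gauge_le_three_mul hX hc hρ b a (by rwa [lossFrac_comm])
      (by rwa [lossFrac_comm]) (by rwa [mul_comm (volume.real B)])
    have h4 : (3 : ℝ) * 4 ^ k ≤ 4 ^ (k + 2) := by
      rw [pow_add]
      have : (0 : ℝ) < 4 ^ k := by positivity
      linarith
    refine le_trans ((lossFrac_le_iff (f := 0) h.left_pos h.right_pos).mpr ⟨?_, ?_⟩)
      (by positivity)
    · rw [sub_zero, one_mul]
      exact measureReal_mono (fun p hp => ⟨hp, (hAf p hp).trans h4⟩)
        (measure_ne_top_of_subset ballPart_subset h.left.measure_ne_top)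
    · rw [sub_zero, one_mul]
      exact measureReal_mono (fun p hp => ⟨hp, (hBf p hp).trans h4⟩)
        (measure_ne_top_of_subset ballPart_subset h.right.measure_ne_top)

lemma exists_isCompact_volume_real_sdiff_le {k : ℕ} {A : Set (Fin k → ℝ)} (hA : MeasurableSet A)
    (hA' : volume A ≠ ⊤) {ε : ℝ} (hε : 0 < ε) :
    ∃ K ⊆ A, IsCompact K ∧ volume.real (A \ K) ≤ ε := by
  obtain ⟨K, hKA, hK, h⟩ := hA.exists_isCompact_sdiff_lt hA' (ε := ENNReal.ofReal ε) (by simpa)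
  exact ⟨K, hKA, hK, ENNReal.toReal_le_of_le_ofReal hε.le h.le⟩

lemma ContinuousLinearEquiv.isGauge_norm {V W : Type*} [NormedAddCommGroup V] [NormedSpace ℝ V]
    [NormedAddCommGroup W] [NormedSpace ℝ W] (T : V ≃L[ℝ] W) : IsGauge fun p => ‖T p‖ where
  continuous := by fun_prop
  add_le x y := by rw [map_add]; exact norm_add_le _ _
  neg x := by rw [map_neg, norm_neg]

lemma volume_convexHull_le {k : ℕ} (T : (Fin k → ℝ) ≃L[ℝ] (Fin k → ℝ)) {κ : ℝ} (hκ : 0 < κ)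
    (hT : ScalesVolume T κ) {S : Set (Fin k → ℝ)} (a : Fin k → ℝ) {t : ℝ} (ht : 0 ≤ t)
    (hS : ∀ p ∈ S, ‖T (p - a)‖ ≤ t) :
    volume (convexHull ℝ S) ≤ ENNReal.ofReal ((2 * t) ^ k / κ) := by
  have hpre : convexHull ℝ S ⊆ T ⁻¹' Metric.closedBall (T a) t := by
    refine convexHull_min (fun p hp => ?_) ?_
    · rw [mem_preimage, mem_closedBall_iff_norm, ← map_sub]
      exact hS p hp
    · exact (convex_closedBall (T a) t).linear_preimage (T : (Fin k → ℝ) →ₗ[ℝ] (Fin k → ℝ))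
  have hcomp : IsCompact (T ⁻¹' Metric.closedBall (T a) t) :=
    T.toHomeomorph.isCompact_preimage.mpr (isCompact_closedBall _ _)
  refine (measure_mono hpre).trans ?_
  rw [← ofReal_measureReal hcomp.measure_ne_top]
  refine ENNReal.ofReal_le_ofReal ?_
  rw [le_div_iff₀ hκ, mul_comm, ← hT, image_preimage_eq _ T.surjective, measureReal_def,
    Real.volume_pi_closedBall _ ht, ENNReal.toReal_ofReal (by positivity), Fintype.card_fin]

lemma volume_real_sdiff_ballPart_le {k : ℕ} {A K : Set (Fin k → ℝ)} (hK : IsCompact K)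
    (hKA : K ⊆ A) (hA : volume A ≠ ⊤) {ρ : (Fin k → ℝ) → ℝ} (hρ : IsGauge ρ) {a : Fin k → ℝ}
    {t f ε : ℝ} (hf : 0 ≤ f) (hε : volume.real (A \ K) ≤ ε * volume.real A)
    (h : (1 - f) * volume.real K ≤ volume.real (ballPart ρ a t K)) :
    volume.real (A \ ballPart ρ a t K) ≤ (f + ε) * volume.real A := by
  have h1 : volume.real (K \ ballPart ρ a t K) = _ :=
    measureReal_sdiff (s₁ := K) ballPart_subset (hρ.isCompact_ballPart a t hK).measurableSet
      hK.measure_ne_top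
  have h2 : volume.real (A \ ballPart ρ a t K) ≤
      volume.real (A \ K) + volume.real (K \ ballPart ρ a t K) := by
    refine (measureReal_mono ?_ ?_).trans (measureReal_union_le _ _)
    · intro p hp
      by_cases hpK : p ∈ K
      · exact Or.inr ⟨hpK, hp.2⟩
      · exact Or.inl ⟨hp.1, hpK⟩
    · exact measure_ne_top_of_subset (union_subset sdiff_subset (sdiff_subset.trans hKA)) hA
  have h3 := mul_le_mul_of_nonneg_left (measureReal_mono hKA hA) hf
  linarith

/-- Passing to compact subsets of almost full volume. -/
lemma exists_nearBM_subset {k : ℕ} {δ ε : ℝ} (hδ : 0 ≤ δ) (hε : 0 < ε) (hε' : ε ≤ 1 / 100)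
    (hδ' : δ ≤ 1 / 100) {A B : Set (Fin k → ℝ)} (hA : MeasurableSet A) (hB : MeasurableSet B)
    (hA' : volume A ≠ ⊤) (hB' : volume B ≠ ⊤) (hAB : volume.real A = volume.real B)
    (hA0 : 0 < volume.real A) (hAB' : volume (A + B) ≠ ⊤)
    (h : volume.real (A + B) ≤ 2 ^ k * (1 + δ) * volume.real A) :
    ∃ K ⊆ A, ∃ L ⊆ B, NearBM (2 ^ k) (δ + 4 * ε) K L ∧
      volume.real (A \ K) ≤ ε * volume.real A ∧ volume.real (B \ L) ≤ ε * volume.real B := by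
  obtain ⟨K, hKA, hK, hKε⟩ := exists_isCompact_volume_real_sdiff_le hA hA' (mul_pos hε hA0)
  obtain ⟨L, hLB, hL, hLε⟩ :=
    exists_isCompact_volume_real_sdiff_le hB hB' (mul_pos hε (hAB ▸ hA0))
  have hKs := measureReal_sdiff (μ := volume) (s₁ := A) hKA hK.measurableSet hA'
  have hLs := measureReal_sdiff (μ := volume) (s₁ := B) hLB hL.measurableSet hB'
  have hK1 : (1 - ε) * volume.real A ≤ volume.real K := by linarith
  have hL1 : (1 - ε) * volume.real A ≤ volume.real L := by rw [← hAB] at hLε hLs; linarith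
  have hpos : 0 < (1 - ε) * volume.real A := mul_pos (by linarith) hA0
  refine ⟨K, hKA, L, hLB, ⟨hK, hL, hpos.trans_le hK1, hpos.trans_le hL1, ?_⟩, hKε, hLε⟩
  have hsqrt : (1 - ε) * volume.real A ≤ √(volume.real K * volume.real L) := by
    refine Real.le_sqrt_of_sq_le ?_
    rw [sq]
    exact mul_le_mul hK1 hL1 hpos.le measureReal_nonneg
  have h1 : 1 + δ ≤ (1 + (δ + 4 * ε)) * (1 - ε) := by nlinarith
  calc volume.real (K + L) ≤ volume.real (A + B) :=
        measureReal_mono (add_subset_add hKA hLB) hAB'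
    _ ≤ 2 ^ k * (1 + δ) * volume.real A := h
    _ ≤ 2 ^ k * ((1 + (δ + 4 * ε)) * (1 - ε)) * volume.real A := by gcongr
    _ = 2 ^ k * (1 + (δ + 4 * ε)) * ((1 - ε) * volume.real A) := by ring
    _ ≤ _ := mul_le_mul_of_nonneg_left hsqrt (by positivity)

/-- The quadratic stability estimate for small deficits. -/
lemma exists_subset_volume_convexHull_le {k : ℕ} {c τ δ : ℝ} (hc : 0 < c)
    (hround : ∀ A B : Set (Fin k → ℝ), NearBM (2 ^ k) τ A B → IsRounded k c A B)
    (hδ : 0 < δ) (hδτ : 5 / 4 * δ ≤ τ) (hτ : τ ≤ 1 / 1000) {A B : Set (Fin k → ℝ)}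
    (hA : MeasurableSet A) (hB : MeasurableSet B) (hA' : volume A ≠ ⊤) (hB' : volume B ≠ ⊤)
    (hAB : volume.real A = volume.real B) (hA0 : 0 < volume.real A) (hAB' : volume (A + B) ≠ ⊤)
    (h : volume.real (A + B) ≤ 2 ^ k * (1 + δ) * volume.real A) :
    ∃ (A' B' : Set (Fin k → ℝ)) (v : Fin k → ℝ), A' ⊆ A ∧ B' ⊆ B ∧
      MeasurableSet A' ∧ MeasurableSet B' ∧
      volume.real (A \ A') ≤ (δ ^ 2 + 30 * δ ^ 3) * volume.real A ∧
      volume.real (B \ B') ≤ (δ ^ 2 + 30 * δ ^ 3) * volume.real A ∧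
      volume (convexHull ℝ (A' ∪ (fun b => b + v) '' B')) ≤
        ENNReal.ofReal ((2 * 4 ^ (k + 2)) ^ k / c * volume.real A) := by
  have hδ1 : δ ≤ 1 / 1000 := by linarith
  have hδ2 : δ ^ 2 ≤ 1 / 1000 * δ := by nlinarith
  have hδ3 : δ ^ 3 ≤ 1 / 1000 * δ ^ 2 := by nlinarith [sq_nonneg δ]
  have hδ3' : 0 < δ ^ 3 := by positivity
  obtain ⟨K, hKA, L, hLB, hKL, hKε, hLε⟩ := exists_nearBM_subset hδ.le (ε := δ ^ 3 / 4)
    (by positivity) (by linarith) (by linarith) hA hB hA' hB' hAB hA0 hAB' h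
  rw [mul_div_cancel₀ _ (four_ne_zero' ℝ)] at hKL
  obtain ⟨T, κ, a, b, hκ, hT, hcκ, hl⟩ := hround K L (hKL.mono (by positivity) (by linarith))
  have hρ := T.isGauge_norm
  have hKV := measureReal_mono hKA hA'
  have hLV := measureReal_mono hLB hB'
  rw [← hAB] at hLV
  have hsqrt : √(volume.real K * volume.real L) ≤ volume.real A := by
    refine (Real.sqrt_le_left hA0.le).mpr ?_
    rw [sq]
    exact mul_le_mul hKV hLV hKL.right_pos.le hA0.le
  have hlow : ∀ {A K : Set (Fin k → ℝ)}, volume A ≠ ⊤ → K ⊆ A → MeasurableSet K →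
      volume.real (A \ K) ≤ δ ^ 3 / 4 * volume.real A →
      99 / 100 * volume.real A ≤ volume.real K := by
    intro A K hA hKA hK hKε
    rw [measureReal_sdiff (s₁ := A) hKA hK hA] at hKε
    have := mul_le_mul_of_nonneg_right (show δ ^ 3 / 4 ≤ 1 / 100 by linarith)
      (measureReal_nonneg (μ := volume) (s := A))
    linarith
  have hK99 := hlow hA' hKA hKL.left.measurableSet hKε
  have hL99 := hlow hB' hLB hKL.right.measurableSet hLε
  rw [← hAB] at hL99
  have hf := hKL.lossFrac_le (by linarith) hρ a b hl (by linarith) (by linarith)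
  have hf' : lossFrac (fun p => ‖T p‖) a b K L (4 ^ (k + 2)) ≤ δ ^ 2 + 29 * δ ^ 3 := by
    refine hf.trans ?_
    have h1 : (δ + δ ^ 3) ^ 2 ≤ δ ^ 2 + 3 * δ ^ 3 := by nlinarith
    have h2 : (δ + δ ^ 3) ^ 3 ≤ (101 / 100 * δ) ^ 3 :=
      pow_le_pow_left₀ (by positivity) (by linarith) 3
    rw [mul_pow] at h2
    linarith
  obtain ⟨hfA, hfB⟩ := (lossFrac_le_iff hKL.left_pos hKL.right_pos).mp hf'
  have h1 := volume_real_sdiff_ballPart_le hKL.left hKA hA' hρ (by positivity) hKε hfA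
  have h2 := volume_real_sdiff_ballPart_le hKL.right hLB hB' hρ (by positivity) hLε hfB
  refine ⟨_, _, a - b, ballPart_subset.trans hKA, ballPart_subset.trans hLB,
    (hρ.isCompact_ballPart a (4 ^ (k + 2)) hKL.left).measurableSet,
    (hρ.isCompact_ballPart b (4 ^ (k + 2)) hKL.right).measurableSet, h1.trans ?_, h2.trans ?_, ?_⟩
  · exact mul_le_mul_of_nonneg_right (by linarith) hA0.le
  · rw [← hAB]
    exact mul_le_mul_of_nonneg_right (by linarith) hA0.le
  · refine (volume_convexHull_le T hκ hT a (t := 4 ^ (k + 2)) (by positivity) ?_).trans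
      (ENNReal.ofReal_le_ofReal ?_)
    · rintro _ (hp | ⟨p, hp, rfl⟩)
      · exact hp.2
      · rw [show p + (a - b) - a = p - b by abel]
        exact hp.2
    · rw [div_mul_eq_mul_div, div_le_div_iff₀ hκ hc, mul_assoc]
      refine mul_le_mul_of_nonneg_left (hcκ.trans ?_) (by positivity)
      rw [mul_comm]
      exact mul_le_mul_of_nonneg_right hsqrt hκ.le

theorem stmt_16 :
    ∃ C₀ : ℝ, 0 < C₀ ∧ ∀ k : ℕ, 1 ≤ k → ∃ Ck : ℝ, 0 < Ck ∧
      ∀ δ : ℝ, δ ∈ Set.Ioc (0 : ℝ) 0.01 →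
        ∀ A B : Set (Fin k → ℝ), MeasurableSet A → MeasurableSet B →
          volume A = volume B → 0 < volume A → volume A < ⊤ →
          volume (A + B) ≤ ENNReal.ofReal (2 ^ k * (1 + δ)) * volume A →
          ∃ (A' B' : Set (Fin k → ℝ)) (v : Fin k → ℝ),
            A' ⊆ A ∧ B' ⊆ B ∧ MeasurableSet A' ∧ MeasurableSet B' ∧
            volume (A \ A') ≤ ENNReal.ofReal (δ ^ 2 + C₀ * δ ^ 3) * volume A ∧
            volume (B \ B') ≤ ENNReal.ofReal (δ ^ 2 + C₀ * δ ^ 3) * volume A ∧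
            volume (convexHull ℝ (A' ∪ (fun b => b + v) '' B'))
              ≤ ENNReal.ofReal Ck * volume A := by
  obtain ⟨η, hη⟩ : ∃ η : ℝ, η = 1 / 10 ^ 15 := ⟨_, rfl⟩
  obtain ⟨τ, hτ⟩ : ∃ τ : ℝ, τ = η ^ 3 / 19200 := ⟨_, rfl⟩
  have hη0 : 0 < η := by rw [hη]; positivity
  have hτ0 : 0 < τ := by rw [hτ]; positivity
  have hτ1 : τ ≤ 1 / 1000 := by rw [hτ, hη]; norm_num
  refine ⟨1 / (τ / 2) ^ 3 + 30, by positivity, fun k _ => ?_⟩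
  obtain ⟨c, hc, hround⟩ := exists_isRounded hη0 (by rw [hη]; norm_num) hτ.le (by linarith) k
    (3 / 4 * τ) (by linarith)
  refine ⟨(2 * 4 ^ (k + 2)) ^ k / c, by positivity, ?_⟩
  intro δ hδ A B hA hB hAB hA0 hAtop hsum
  have hδ0 : 0 < δ := hδ.1
  rcases le_total (τ / 2) δ with hlarge | hsmall
  · have h1 : 1 ≤ ENNReal.ofReal (δ ^ 2 + (1 / (τ / 2) ^ 3 + 30) * δ ^ 3) := by
      rw [ENNReal.one_le_ofReal]
      have h2 : (τ / 2) ^ 3 ≤ δ ^ 3 := pow_le_pow_left₀ (by positivity) hlarge 3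
      have h3 : 1 ≤ 1 / (τ / 2) ^ 3 * δ ^ 3 := by
        rwa [one_div_mul_eq_div, one_le_div (by positivity)]
      nlinarith [sq_nonneg δ, pow_pos hδ0 3]
    refine ⟨∅, ∅, 0, empty_subset _, empty_subset _, .empty, .empty, ?_, ?_, by simp⟩
    · rw [sdiff_empty]
      exact le_mul_of_one_le_left' h1
    · rw [sdiff_empty, ← hAB]
      exact le_mul_of_one_le_left' h1
  · have hBtop : volume B ≠ ⊤ := hAB ▸ hAtop.ne
    have hV : volume A = ENNReal.ofReal (volume.real A) := (ofReal_measureReal hAtop.ne).symm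
    have hsumtop : volume (A + B) ≠ ⊤ :=
      (hsum.trans_lt (ENNReal.mul_lt_top ENNReal.ofReal_lt_top hAtop)).ne
    have hsum' : volume.real (A + B) ≤ 2 ^ k * (1 + δ) * volume.real A := by
      refine ENNReal.toReal_le_of_le_ofReal (by positivity) ?_
      rwa [ENNReal.ofReal_mul (by positivity), ← hV]
    obtain ⟨A', B', v, hA'A, hB'B, hA', hB', h1, h2, h3⟩ :=
      exists_subset_volume_convexHull_le hc hround hδ0 (by linarith) (by linarith) hA hB hAtop.ne
        hBtop (by rw [measureReal_def, measureReal_def, hAB])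
        (ENNReal.toReal_pos hA0.ne' hAtop.ne) hsumtop hsum'
    have hconst : δ ^ 2 + 30 * δ ^ 3 ≤ δ ^ 2 + (1 / (τ / 2) ^ 3 + 30) * δ ^ 3 := by
      gcongr
      exact le_add_of_nonneg_left (by positivity)
    have hloss : ∀ S : Set (Fin k → ℝ), volume S ≠ ⊤ →
        volume.real S ≤ (δ ^ 2 + 30 * δ ^ 3) * volume.real A →
        volume S ≤ ENNReal.ofReal (δ ^ 2 + (1 / (τ / 2) ^ 3 + 30) * δ ^ 3) * volume A := by
      intro S hS h
      rw [hV, ← ENNReal.ofReal_mul (by positivity), ← ofReal_measureReal hS]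
      exact ENNReal.ofReal_le_ofReal
        (h.trans (mul_le_mul_of_nonneg_right hconst measureReal_nonneg))
    refine ⟨A', B', v, hA'A, hB'B, hA', hB',
      hloss _ (measure_ne_top_of_subset sdiff_subset hAtop.ne) h1,
      hloss _ (measure_ne_top_of_subset sdiff_subset hBtop) h2, ?_⟩
    rwa [hV, ← ENNReal.ofReal_mul (by positivity)]
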